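/- arXiv:1603.00207 — 3 statements merged into one kernel-verified Lean document; each statement's English description precedes it below -/
import Mathlib

section
/- For almost every α > 0 (with respect to Lebesgue measure) and every starting point x = (x₁, x₂) ∈ [0,1)², every polygon S ⊆ [0,1)² none of whose edges has slope α is a bounded remainder set for the continuous irrational rotation with slope α and starting point x. -/
open MeasureTheory

/-- The distributional error `Δ_T(S, α, x)` of the continuous irrational rotation
with slope `α` and starting point `(x₁, x₂)` for the set `S ⊆ [0,1)²`. -/
noncomputable def rotDelta (S : Set (ℝ × ℝ)) (α x₁ x₂ T : ℝ) : ℝ :=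
  (∫ t in (0:ℝ)..T,
    Set.indicator S (fun _ => (1:ℝ)) (Int.fract (x₁ + t), Int.fract (x₂ + α * t))) -
    T * (volume S).toReal

/-- `S` is a bounded remainder set for the continuous rotation with slope `α`
and starting point `(x₁, x₂)`. -/
def IsBoundedRemainderSet (S : Set (ℝ × ℝ)) (α x₁ x₂ : ℝ) : Prop :=
  ∃ C : ℝ, ∀ T : ℝ, 0 < T → |rotDelta S α x₁ x₂ T| ≤ C


lemma sum_cos_bound (a φ : ℝ) (h : Real.sin (φ/2) ≠ 0) (N : ℕ) :
    |∑ k ∈ Finset.range N, Real.cos (a + k * φ)| ≤ 1 / |Real.sin (φ/2)| := by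
  have key : 2 * Real.sin (φ/2) * ∑ k ∈ Finset.range N, Real.cos (a + k * φ)
      = Real.sin (a + N * φ - φ/2) - Real.sin (a - φ/2) := by
    induction N with
    | zero => simp
    | succ n ih =>
      rw [Finset.sum_range_succ, mul_add, ih]
      have h1 : Real.sin (a + (n+1:ℕ) * φ - φ/2) = Real.sin ((a + n * φ) + φ/2) := by
        congr 1; push_cast; ring
      have h2 : Real.sin (a + n * φ - φ/2) = Real.sin ((a + n * φ) - φ/2) := rfl
      rw [h1, h2, Real.sin_add, Real.sin_sub]; ring
  have hb : |2 * Real.sin (φ/2) * ∑ k ∈ Finset.range N, Real.cos (a + k * φ)| ≤ 2 := by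
    rw [key, abs_le]
    constructor <;> linarith [Real.neg_one_le_sin (a + N * φ - φ/2), Real.sin_le_one (a + N * φ - φ/2),
      Real.neg_one_le_sin (a - φ/2), Real.sin_le_one (a - φ/2)]
  rw [abs_mul, abs_mul, abs_two] at hb
  rw [le_div_iff₀ (abs_pos.mpr h)]
  nlinarith

noncomputable def B2 (x : ℝ) : ℝ := (Int.fract x)^2 - Int.fract x + 1/6

lemma B2_hasSum (x : ℝ) :
    HasSum (fun m : ℕ => 1 / (m:ℝ)^2 * Real.cos (2 * Real.pi * m * x)) (Real.pi^2 * B2 x) := by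
  have h := hasSum_one_div_nat_pow_mul_cos (k := 1) one_ne_zero (x := Int.fract x)
    ⟨Int.fract_nonneg x, (Int.fract_lt_one x).le⟩
  convert h using 1
  · funext m
    simp only [mul_one]
    congr 1
    have : 2 * Real.pi * m * x = 2 * Real.pi * m * Int.fract x + ((m * ⌊x⌋ : ℤ) : ℝ) * (2 * Real.pi) := by
      push_cast
      rw [Int.fract]; ring
    rw [this, Real.cos_add_int_mul_two_pi]
  · simp [B2, Polynomial.bernoulli, Finset.sum_range_succ, bernoulli_one, bernoulli_two, Nat.choose]
    ring

lemma B2_birkhoff (θ : ℝ) (hirr : ∀ m : ℕ, m ≠ 0 → Real.sin (Real.pi * m * θ) ≠ 0)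
    (hs : Summable (fun m : ℕ => 1 / (m:ℝ)^2 * (1 / |Real.sin (Real.pi * m * θ)|))) :
    ∃ C : ℝ, ∀ (y : ℝ) (N : ℕ), |∑ k ∈ Finset.range N, B2 (y + k * θ)| ≤ C := by
  refine ⟨(∑' m : ℕ, 1 / (m:ℝ)^2 * (1 / |Real.sin (Real.pi * m * θ)|)) / Real.pi^2, fun y N => ?_⟩
  rw [le_div_iff₀ (by positivity)]
  have h1 : HasSum (fun m : ℕ => ∑ k ∈ Finset.range N, 1 / (m:ℝ)^2 * Real.cos (2 * Real.pi * m * (y + k * θ)))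
      (∑ k ∈ Finset.range N, Real.pi^2 * B2 (y + k * θ)) :=
    hasSum_sum (fun k _ => B2_hasSum (y + k * θ))
  have hb : ∀ m : ℕ, ‖∑ k ∈ Finset.range N, 1 / (m:ℝ)^2 * Real.cos (2 * Real.pi * m * (y + k * θ))‖
      ≤ 1 / (m:ℝ)^2 * (1 / |Real.sin (Real.pi * m * θ)|) := by
    intro m
    rcases eq_or_ne m 0 with rfl | hm
    · simp
    rw [← Finset.mul_sum, norm_mul, Real.norm_of_nonneg (by positivity : (0:ℝ) ≤ 1 / (m:ℝ)^2)]
    gcongr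
    have := sum_cos_bound (2 * Real.pi * m * y) (2 * Real.pi * m * θ)
      (by rw [show 2 * Real.pi * m * θ / 2 = Real.pi * m * θ by ring]; exact hirr m hm) N
    rw [show 2 * Real.pi * m * θ / 2 = Real.pi * m * θ by ring] at this
    rw [Real.norm_eq_abs]
    have e : ∀ k : ℕ, 2 * Real.pi * m * (y + k * θ) = 2 * Real.pi * m * y + k * (2 * Real.pi * m * θ) := by
      intro k; ring
    simp_rw [e]
    exact this
  have h2 := tsum_of_norm_bounded hs.hasSum hb
  rw [h1.tsum_eq, ← Finset.mul_sum, Real.norm_eq_abs, abs_mul, abs_of_pos (by positivity)] at h2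
  linarith

lemma phi_int : IntervalIntegrable (fun x : ℝ => |Real.sin (Real.pi * x)| ^ (-(3/4) : ℝ)) volume 0 1 := by
  have i1 : IntervalIntegrable (fun x : ℝ => x ^ (-(3/4) : ℝ)) volume 0 1 :=
    intervalIntegral.intervalIntegrable_rpow' (by norm_num)
  have i2 : IntervalIntegrable (fun x : ℝ => (1 - x) ^ (-(3/4) : ℝ)) volume 0 1 := by
    have := (i1.comp_sub_left 1).symm
    simpa using this
  have i3 := i1.add i2
  refine i3.mono_fun ?_ ?_
  · exact (by fun_prop : Measurable (fun x : ℝ => |Real.sin (Real.pi * x)| ^ (-(3/4) : ℝ))).aestronglyMeasurable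
  · rw [Filter.EventuallyLE, ae_restrict_iff' measurableSet_uIoc]
    have h1 : ∀ᵐ x : ℝ ∂volume, x ≠ 1 := by simp [ae_iff]
    filter_upwards [h1] with x hx1 hx
    rw [Set.uIoc_of_le zero_le_one] at hx
    have hx0 := hx.1
    have hx1 : x < 1 := lt_of_le_of_ne hx.2 hx1
    have e1 : (0:ℝ) < x ^ (-(3/4) : ℝ) := Real.rpow_pos_of_pos hx0 _
    have e2 : (0:ℝ) < (1-x) ^ (-(3/4) : ℝ) := Real.rpow_pos_of_pos (by linarith) _
    rw [Real.norm_of_nonneg (by positivity), Real.norm_of_nonneg (by positivity)]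
    have hpi := Real.pi_pos
    rcases le_total x (1/2) with h | h
    · have : x ≤ |Real.sin (Real.pi * x)| := by
        have := Real.mul_le_sin (x := Real.pi * x) (by positivity) (by nlinarith)
        have e : 2 / Real.pi * (Real.pi * x) = 2 * x := by field_simp
        rw [e] at this
        linarith [le_abs_self (Real.sin (Real.pi * x))]
      have := Real.rpow_le_rpow_of_nonpos hx0 this (by norm_num : (-(3/4):ℝ) ≤ 0)
      linarith
    · have : 1 - x ≤ |Real.sin (Real.pi * x)| := by
        have := Real.mul_le_sin (x := Real.pi * (1-x)) (mul_nonneg hpi.le (by linarith)) (by nlinarith)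
        have e : 2 / Real.pi * (Real.pi * (1-x)) = 2 * (1-x) := by field_simp
        rw [e, show Real.pi * (1-x) = Real.pi - Real.pi * x by ring, Real.sin_pi_sub] at this
        linarith [le_abs_self (Real.sin (Real.pi * x))]
      have := Real.rpow_le_rpow_of_nonpos (by linarith) this (by norm_num : (-(3/4):ℝ) ≤ 0)
      linarith

lemma phi_per : Function.Periodic (fun x : ℝ => |Real.sin (Real.pi * x)| ^ (-(3/4) : ℝ)) 1 := by
  intro x
  simp only
  rw [mul_add, mul_one, Real.sin_add_pi, abs_neg]

lemma phi_int_all (a b : ℝ) : IntervalIntegrable (fun x : ℝ => |Real.sin (Real.pi * x)| ^ (-(3/4) : ℝ)) volume a b :=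
  phi_per.intervalIntegrable₀ one_ne_zero phi_int a b

lemma phi_scaled (M l m : ℕ) (hM : M ≠ 0) (hm : m ≠ 0) :
    ∫ x in (0:ℝ)..(M * l : ℝ), |Real.sin (Real.pi * m * (x / M))| ^ (-(3/4) : ℝ)
      = M * l * ∫ x in (0:ℝ)..1, |Real.sin (Real.pi * x)| ^ (-(3/4) : ℝ) := by
  have hM' : (M:ℝ) ≠ 0 := by exact_mod_cast hM
  have hm' : (m:ℝ) ≠ 0 := by exact_mod_cast hm
  have e : (fun x : ℝ => |Real.sin (Real.pi * m * (x / M))| ^ (-(3/4) : ℝ))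
      = fun x : ℝ => (fun u : ℝ => |Real.sin (Real.pi * u)| ^ (-(3/4) : ℝ)) ((m / M : ℝ) * x) := by
    funext x
    simp only
    congr 3
    ring
  rw [e, intervalIntegral.integral_comp_mul_left (fun u : ℝ => |Real.sin (Real.pi * u)| ^ (-(3/4) : ℝ)) (by positivity)]
  have h := phi_per.intervalIntegral_add_zsmul_eq (m * l : ℤ) 0 phi_int_all
  simp only [zero_add, zsmul_eq_mul, mul_one] at h
  rw [mul_zero, show (m / M : ℝ) * (M * l) = ((m * l : ℤ) : ℝ) by push_cast; field_simp, h]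
  push_cast
  rw [smul_eq_mul]
  field_simp

lemma phi_int_scaled (M m : ℕ) (hM : M ≠ 0) (hm : m ≠ 0) (b : ℝ) :
    IntervalIntegrable (fun x => |Real.sin (Real.pi * m * (x / M))| ^ (-(3/4) : ℝ)) volume 0 b := by
  have hM' : (M:ℝ) ≠ 0 := by exact_mod_cast hM
  have hm' : (m:ℝ) ≠ 0 := by exact_mod_cast hm
  have e : (fun x : ℝ => |Real.sin (Real.pi * m * (x / M))| ^ (-(3/4) : ℝ))
      = fun x : ℝ => (fun u : ℝ => |Real.sin (Real.pi * u)| ^ (-(3/4) : ℝ)) ((m / M : ℝ) * x) := by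
    funext x
    simp only
    congr 3
    ring
  rw [e]
  have := (phi_int_all 0 ((m/M:ℝ) * b)).comp_mul_left (c := (m / M : ℝ))
  convert this using 1
  · simp
  · field_simp

lemma ae_summable_aux (M l : ℕ) (hM : M ≠ 0) :
    ∀ᵐ α : ℝ ∂(volume.restrict (Set.Ioc (0:ℝ) (M * l))),
      Summable (fun m : ℕ => ((m:ℝ) ^ (-(3/2):ℝ)) * |Real.sin (Real.pi * m * (α / M))| ^ (-(3/4) : ℝ)) := by
  set I := ∫ x in (0:ℝ)..1, |Real.sin (Real.pi * x)| ^ (-(3/4) : ℝ)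
  have hI : 0 ≤ I := intervalIntegral.integral_nonneg zero_le_one (fun x _ => by positivity)
  let F : ℕ → ℝ → ENNReal := fun m α =>
    ENNReal.ofReal (((m:ℝ) ^ (-(3/2):ℝ)) * |Real.sin (Real.pi * m * (α / M))| ^ (-(3/4) : ℝ))
  have hF : ∀ m, Measurable (F m) := fun m => by fun_prop
  have hle : ∀ m, ∫⁻ α in Set.Ioc (0:ℝ) (M * l), F m α ≤ ENNReal.ofReal ((m:ℝ) ^ (-(3/2):ℝ) * (M * l * I)) := by
    intro m
    rcases eq_or_ne m 0 with rfl | hm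
    · have : ∀ α, F 0 α = 0 := fun α => by
        simp [F, Real.zero_rpow (by norm_num : (-(3/2):ℝ) ≠ 0)]
      simp [this]
    · have h1 := phi_int_scaled M m hM hm (M * l)
      rw [intervalIntegrable_iff_integrableOn_Ioc_of_le (by positivity)] at h1
      have h2 := phi_scaled M l m hM hm
      rw [intervalIntegral.integral_of_le (by positivity)] at h2
      rw [← h2, ← integral_const_mul, ofReal_integral_eq_lintegral_ofReal (h1.const_mul _)
        (Filter.Eventually.of_forall fun x => by positivity)]
  have hsum : ∑' m : ℕ, ENNReal.ofReal ((m:ℝ) ^ (-(3/2):ℝ) * (M * l * I)) ≠ ⊤ := by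
    have : Summable (fun m : ℕ => (m:ℝ) ^ (-(3/2):ℝ) * (M * l * I)) :=
      (Real.summable_nat_rpow.mpr (by norm_num)).mul_right _
    exact this.tsum_ofReal_ne_top
  have hfin : ∫⁻ α in Set.Ioc (0:ℝ) (M * l), ∑' m, F m α ≠ ⊤ := by
    rw [lintegral_tsum (fun m => (hF m).aemeasurable)]
    exact ne_top_of_le_ne_top hsum (ENNReal.tsum_le_tsum hle)
  filter_upwards [ae_lt_top (Measurable.tsum hF) hfin] with α hα
  have := ENNReal.summable_toReal hα.ne
  convert this using 2 with m
  rw [ENNReal.toReal_ofReal (by positivity)]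

lemma summable_upgrade (θ : ℝ) (h : Summable (fun m : ℕ => ((m:ℝ) ^ (-(3/2):ℝ)) * |Real.sin (Real.pi * m * θ)| ^ (-(3/4) : ℝ))) :
    Summable (fun m : ℕ => 1 / (m:ℝ)^2 * (1 / |Real.sin (Real.pi * m * θ)|)) := by
  have h0 := h.tendsto_atTop_zero
  have h1 : ∀ᶠ m : ℕ in Filter.atTop, ((m:ℝ) ^ (-(3/2):ℝ)) * |Real.sin (Real.pi * m * θ)| ^ (-(3/4) : ℝ) < 1 :=
    h0.eventually (gt_mem_nhds one_pos)
  refine Summable.of_norm_bounded_eventually_nat h ?_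
  filter_upwards [h1, Filter.eventually_gt_atTop 0] with m hm hm0
  have hm' : (0:ℝ) < m := by exact_mod_cast hm0
  set x := 1 / (m:ℝ)^2 * (1 / |Real.sin (Real.pi * m * θ)|) with hx
  have hx0 : 0 ≤ x := by positivity
  have e : ((m:ℝ) ^ (-(3/2):ℝ)) * |Real.sin (Real.pi * m * θ)| ^ (-(3/4) : ℝ) = x ^ (3/4 : ℝ) := by
    rw [hx, Real.mul_rpow (by positivity) (by positivity), one_div, one_div, Real.inv_rpow (by positivity),
      Real.inv_rpow (by positivity), ← Real.rpow_natCast, ← Real.rpow_mul hm'.le, Real.rpow_neg (by positivity),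
      Real.rpow_neg (by positivity)]
    norm_num
  rw [e] at hm ⊢
  rw [Real.norm_of_nonneg hx0]
  rcases hx0.eq_or_lt with h | h
  · rw [← h]; positivity
  have hx1 : x < 1 := by
    by_contra hc
    push Not at hc
    exact absurd hm (not_lt.mpr (Real.one_le_rpow hc (by norm_num)))
  calc x = x ^ (1:ℝ) := (Real.rpow_one x).symm
    _ ≤ _ := Real.rpow_le_rpow_of_exponent_ge h hx1.le (by norm_num)

lemma ae_good : ∀ᵐ α : ℝ ∂volume, 0 < α → ∀ M : ℕ, M ≠ 0 →
    ∃ C : ℝ, ∀ (y : ℝ) (N : ℕ), |∑ k ∈ Finset.range N, B2 (y + k * (α / M))| ≤ C := by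
  have h1 : ∀ᵐ α : ℝ ∂volume, ∀ M l : ℕ, M ≠ 0 → α ∈ Set.Ioc (0:ℝ) (M * l) →
      Summable (fun m : ℕ => ((m:ℝ) ^ (-(3/2):ℝ)) * |Real.sin (Real.pi * m * (α / M))| ^ (-(3/4) : ℝ)) := by
    rw [ae_all_iff]; intro M
    rw [ae_all_iff]; intro l
    by_cases hM : M = 0
    · simp [hM]
    have := ae_summable_aux M l hM
    rw [ae_restrict_iff' measurableSet_Ioc] at this
    filter_upwards [this] with α h _ using h
  have h2 : ∀ᵐ α : ℝ ∂volume, Irrational α := by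
    have : {x : ℝ | ¬ Irrational x} = Set.range ((↑) : ℚ → ℝ) := by
      ext x; simp [Irrational]
    rw [ae_iff, this]
    exact (Set.countable_range _).measure_zero _
  filter_upwards [h1, h2] with α h1 h2 hα M hM
  have hM' : (1:ℝ) ≤ M := by exact_mod_cast Nat.one_le_iff_ne_zero.mpr hM
  apply B2_birkhoff
  · intro m hm h
    rw [Real.sin_eq_zero_iff] at h
    obtain ⟨n, hn⟩ := h
    have hm' : (m:ℝ) ≠ 0 := by exact_mod_cast hm
    have : (n:ℝ) = m * (α / M) := by
      have hpi := Real.pi_ne_zero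
      apply mul_right_cancel₀ hpi
      rw [hn]; ring
    apply h2
    refine ⟨(n * M / m : ℚ), ?_⟩
    push_cast
    rw [this]
    field_simp
  · apply summable_upgrade
    obtain ⟨l, hl⟩ := exists_nat_ge α
    refine h1 M l hM ⟨hα, hl.trans ?_⟩
    nlinarith [(Nat.cast_nonneg l : (0:ℝ) ≤ l)]

lemma precon_subset {X : Type*} [TopologicalSpace X] {C D : Set X} (hC : IsPreconnected C)
    (hd : ∀ x ∈ C, x ∉ frontier D) (hne : (C ∩ D).Nonempty) : C ⊆ D := by
  have h1 : C ⊆ interior D ∪ (closure D)ᶜ := by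
    intro x hx
    by_cases h : x ∈ interior D
    · exact Or.inl h
    · exact Or.inr fun hc => hd x hx ⟨hc, h⟩
  obtain ⟨x, hxC, hxD⟩ := hne
  have hx : x ∈ interior D := by
    rcases h1 hxC with h | h
    · exact h
    · exact absurd (subset_closure hxD) h
  refine (hC.subset_left_of_subset_union isOpen_interior isClosed_closure.isOpen_compl ?_ h1
    ⟨x, hxC, hx⟩).trans interior_subset
  exact Set.disjoint_left.mpr fun y hy hy' => hy' (subset_closure (interior_subset hy))

section geo
set_option linter.unusedSectionVars false
variable {ι : Type*} [Fintype ι] [DecidableEq ι]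

noncomputable def mxx (a b : ι → ℝ) (σ : Finset ι) (c : ℝ) : ℝ :=
  if h : σ.Nonempty then σ.sup' h (fun i => a i * c + b i) else 0
noncomputable def mnn (a b : ι → ℝ) (σ : Finset ι) (c : ℝ) : ℝ :=
  if h : (σᶜ).Nonempty then (σᶜ).inf' h (fun i => a i * c + b i) else 0

def cell (a b : ι → ℝ) (σ : Finset ι) : Set (ℝ × ℝ) :=
  {q | (∀ i ∈ σ, a i * q.2 + b i < q.1) ∧ ∀ i ∉ σ, q.1 < a i * q.2 + b i}

lemma cell_convex (a b : ι → ℝ) (σ : Finset ι) : Convex ℝ (cell a b σ) := by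
  intro p hp q hq s t hs ht hst
  have hst' : s = 1 - t := by linarith
  constructor
  · intro i hi
    have h1 := hp.1 i hi
    have h2 := hq.1 i hi
    simp only [Prod.fst_add, Prod.snd_add, Prod.smul_fst, Prod.smul_snd, smul_eq_mul]
    rcases hs.eq_or_lt with h | h
    · subst h
      have : t = 1 := by linarith
      subst this; linarith
    · have := mul_lt_mul_of_pos_left h1 h
      have := mul_le_mul_of_nonneg_left h2.le ht
      have hb : b i = s * b i + t * b i := by rw [← add_mul, hst, one_mul]
      nlinarith
  · intro i hi
    have h1 := hp.2 i hi
    have h2 := hq.2 i hi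
    simp only [Prod.fst_add, Prod.snd_add, Prod.smul_fst, Prod.smul_snd, smul_eq_mul]
    rcases hs.eq_or_lt with h | h
    · subst h
      have : t = 1 := by linarith
      subst this; linarith
    · have := mul_lt_mul_of_pos_left h1 h
      have := mul_le_mul_of_nonneg_left h2.le ht
      have hb : b i = s * b i + t * b i := by rw [← add_mul, hst, one_mul]
      nlinarith

lemma slice_formula (a b : ι → ℝ) (D : Set (ℝ × ℝ)) (R : ℝ) (hR : ∀ q ∈ D, |q.1| ≤ R)
    (hf : ∀ q ∈ frontier D, ∃ i, q.1 = a i * q.2 + b i) :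
    ∃ E : Finset (Finset ι), (∀ σ ∈ E, σ.Nonempty ∧ (σᶜ).Nonempty) ∧
      ∀ c, (volume {t : ℝ | (t, c) ∈ D}).toReal = ∑ σ ∈ E, max (mnn a b σ c - mxx a b σ c) 0 := by
  classical
  have hsub : ∀ σ, (cell a b σ ∩ D).Nonempty → cell a b σ ⊆ D := by
    intro σ hσ
    refine precon_subset (cell_convex a b σ).isPreconnected ?_ hσ
    intro x hx hxf
    obtain ⟨i, hi⟩ := hf x hxf
    by_cases h : i ∈ σ
    · linarith [hx.1 i h]
    · linarith [hx.2 i h]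
  have hne : ∀ σ, (cell a b σ ∩ D).Nonempty → σ.Nonempty ∧ (σᶜ).Nonempty := by
    intro σ hσ
    have hs := hsub σ hσ
    obtain ⟨q, hq, hqD⟩ := hσ
    have hqR := abs_le.mp (hR q hqD)
    constructor
    · by_contra hne
      rw [Finset.not_nonempty_iff_eq_empty] at hne
      have : (q.1 - (2 * R + 1), q.2) ∈ cell a b σ := by
        refine ⟨fun i hi => by simp [hne] at hi, fun i hi => ?_⟩
        have := hq.2 i hi
        simp only
        linarith
      have := abs_le.mp (hR _ (hs this))
      simp only at this
      linarith
    · by_contra hne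
      rw [Finset.not_nonempty_iff_eq_empty, Finset.compl_eq_empty_iff] at hne
      have : (q.1 + (2 * R + 1), q.2) ∈ cell a b σ := by
        refine ⟨fun i hi => ?_, fun i hi => by simp [hne] at hi⟩
        have := hq.1 i hi
        simp only
        linarith
      have := abs_le.mp (hR _ (hs this))
      simp only at this
      linarith
  refine ⟨Finset.univ.filter (fun σ => (cell a b σ ∩ D).Nonempty),
    fun σ hσ => hne σ (Finset.mem_filter.mp hσ).2, ?_⟩
  intro c
  set E := Finset.univ.filter (fun σ => (cell a b σ ∩ D).Nonempty) with hE
  have hslice : ∀ σ ∈ E, ∀ t, t ∈ Set.Ioo (mxx a b σ c) (mnn a b σ c) ↔ (t, c) ∈ cell a b σ := by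
    intro σ hσ t
    obtain ⟨h1, h2⟩ := hne σ (Finset.mem_filter.mp hσ).2
    rw [mxx, mnn, dif_pos h1, dif_pos h2, Set.mem_Ioo, Finset.sup'_lt_iff, Finset.lt_inf'_iff]
    simp [cell]
  have hae : {t : ℝ | (t, c) ∈ D} =ᵐ[volume] ⋃ σ ∈ E, Set.Ioo (mxx a b σ c) (mnn a b σ c) := by
    have hN := (Set.finite_range (fun i => a i * c + b i)).countable.ae_notMem volume
    filter_upwards [hN] with t ht
    apply propext
    change (t, c) ∈ D ↔ t ∈ ⋃ σ ∈ E, Set.Ioo (mxx a b σ c) (mnn a b σ c)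
    simp only [Set.mem_iUnion, exists_prop]
    constructor
    · intro htD
      have hcell : (t, c) ∈ cell a b (Finset.univ.filter (fun i => a i * c + b i < t)) := by
        constructor
        · intro i hi
          simpa using hi
        · intro i hi
          have hi' : t ≤ a i * c + b i := by simpa using hi
          exact lt_of_le_of_ne hi' fun e => ht ⟨i, e.symm⟩
      have hmem : Finset.univ.filter (fun i => a i * c + b i < t) ∈ E :=
        Finset.mem_filter.mpr ⟨Finset.mem_univ _, ⟨(t, c), hcell, htD⟩⟩
      exact ⟨_, hmem, (hslice _ hmem t).mpr hcell⟩
    · rintro ⟨σ, hσ, ht⟩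
      exact hsub σ (Finset.mem_filter.mp hσ).2 ((hslice σ hσ t).mp ht)
  rw [measure_congr hae, measure_biUnion_finset]
  · rw [ENNReal.toReal_sum (by simp)]
    refine Finset.sum_congr rfl fun σ _ => ?_
    rw [Real.volume_Ioo, ENNReal.toReal_ofReal']
  · intro σ hσ τ hτ hst
    refine Set.disjoint_left.mpr fun t h1 h2 => hst ?_
    have h1 := (hslice σ hσ t).mp h1
    have h2 := (hslice τ hτ t).mp h2
    ext i
    constructor
    · intro hi
      by_contra hi'
      have := h1.1 i hi
      have := h2.2 i hi'
      simp only at *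
      linarith
    · intro hi
      by_contra hi'
      have := h2.1 i hi
      have := h1.2 i hi'
      simp only at *
      linarith
  · exact fun _ _ => measurableSet_Ioo

lemma order_const {a b a' b' c d : ℝ} (h : a * c + b ≤ a' * c + b')
    (hk : ∀ x ∈ Set.uIcc c d, x ≠ (b' - b) / (a - a')) : a * d + b ≤ a' * d + b' := by
  by_cases ha : a = a'
  · subst ha; linarith
  by_contra hd
  push Not at hd
  have haa : a - a' ≠ 0 := sub_ne_zero.mpr ha
  have hk0 : (a - a') * ((b' - b) / (a - a')) = b' - b := by field_simp
  set k := (b' - b) / (a - a')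
  refine hk k ?_ rfl
  rw [Set.mem_uIcc]
  have h1 : (a - a') * (c - k) ≤ 0 := by nlinarith
  have h2 : 0 < (a - a') * (d - k) := by nlinarith
  rcases lt_or_gt_of_ne haa with hn | hp
  · right
    constructor <;> by_contra hc <;> push Not at hc <;> nlinarith
  · left
    constructor <;> by_contra hc <;> push Not at hc <;> nlinarith

def AffOn (g : ℝ → ℝ) (J : Set ℝ) : Prop := ∃ p q : ℝ, ∀ c ∈ J, g c = p * c + q

noncomputable def crossings (a b : ι → ℝ) : Finset ℝ :=
  (Finset.univ : Finset (ι × ι)).image (fun ij => (b ij.2 - b ij.1) / (a ij.1 - a ij.2))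

lemma order_J (a b : ι → ℝ) (J : Set ℝ) (hJ : J.OrdConnected) (hK : ∀ x ∈ J, x ∉ crossings a b)
    {c d : ℝ} (hc : c ∈ J) (hd : d ∈ J) (i j : ι) (h : a i * c + b i ≤ a j * c + b j) :
    a i * d + b i ≤ a j * d + b j := by
  refine order_const h ?_
  intro x hx hxe
  refine hK x (hJ.uIcc_subset hc hd hx) ?_
  rw [crossings, Finset.mem_image]
  exact ⟨(i, j), Finset.mem_univ _, hxe.symm⟩

lemma h_aff (a b : ι → ℝ) (σ : Finset ι) (h1 : σ.Nonempty) (h2 : (σᶜ).Nonempty)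
    (J : Set ℝ) (hJ : J.OrdConnected) (hK : ∀ x ∈ J, x ∉ crossings a b) :
    AffOn (fun c => max (mnn a b σ c - mxx a b σ c) 0) J := by
  rcases J.eq_empty_or_nonempty with rfl | ⟨c, hc⟩
  · exact ⟨0, 0, by simp⟩
  obtain ⟨i, hi, hie⟩ := Finset.exists_mem_eq_sup' h1 (fun i => a i * c + b i)
  obtain ⟨j, hj, hje⟩ := Finset.exists_mem_eq_inf' h2 (fun i => a i * c + b i)
  have hmx : ∀ d ∈ J, mxx a b σ d = a i * d + b i := by
    intro d hd
    rw [mxx, dif_pos h1]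
    apply le_antisymm
    · refine Finset.sup'_le _ _ fun k hk => order_J a b J hJ hK hc hd k i ?_
      rw [← hie]
      exact Finset.le_sup' (fun i => a i * c + b i) hk
    · exact Finset.le_sup' (fun i => a i * d + b i) hi
  have hmn : ∀ d ∈ J, mnn a b σ d = a j * d + b j := by
    intro d hd
    rw [mnn, dif_pos h2]
    apply le_antisymm
    · exact Finset.inf'_le (fun i => a i * d + b i) hj
    · refine Finset.le_inf' _ _ fun k hk => order_J a b J hJ hK hc hd j k ?_
      rw [← hje]
      exact Finset.inf'_le (fun i => a i * c + b i) hk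
  rcases le_total (a i * c + b i) (a j * c + b j) with h | h
  · refine ⟨a j - a i, b j - b i, fun d hd => ?_⟩
    have := order_J a b J hJ hK hc hd i j h
    simp only
    rw [hmx d hd, hmn d hd, max_eq_left (by linarith)]; ring
  · refine ⟨0, 0, fun d hd => ?_⟩
    have := order_J a b J hJ hK hc hd j i h
    simp only
    rw [hmx d hd, hmn d hd, max_eq_right (by linarith)]; ring

lemma h_cont (a b : ι → ℝ) (σ : Finset ι) (h1 : σ.Nonempty) (h2 : (σᶜ).Nonempty) :
    Continuous (fun c => max (mnn a b σ c - mxx a b σ c) 0) := by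
  have e1 : Continuous (fun c => mxx a b σ c) := by
    simp only [mxx, dif_pos h1]
    exact Continuous.finset_sup'_apply h1 (fun i _ => by fun_prop)
  have e2 : Continuous (fun c => mnn a b σ c) := by
    simp only [mnn, dif_pos h2]
    exact Continuous.finset_inf'_apply h2 (fun i _ => by fun_prop)
  fun_prop

lemma sum_aff {κ : Type*} (E : Finset κ) (f : κ → ℝ → ℝ) (J : Set ℝ) (h : ∀ σ ∈ E, AffOn (f σ) J) :
    AffOn (fun c => ∑ σ ∈ E, f σ c) J := by
  choose! p q hpq using h
  refine ⟨∑ σ ∈ E, p σ, ∑ σ ∈ E, q σ, fun c hc => ?_⟩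
  rw [Finset.sum_mul, ← Finset.sum_add_distrib]
  exact Finset.sum_congr rfl fun σ hσ => hpq σ hσ c hc

lemma pw_repr (K : Finset ℝ) : ∀ g : ℝ → ℝ, Continuous g →
    (∀ J : Set ℝ, J.OrdConnected → (∀ x ∈ J, x ∉ K) → AffOn g J) →
    ∃ (w : ℝ → ℝ) (p q : ℝ), ∀ c, g c = p * c + q + ∑ k ∈ K, w k * |c - k| := by
  induction K using Finset.induction_on with
  | empty =>
    intro g _ h
    obtain ⟨p, q, hpq⟩ := h Set.univ Set.ordConnected_univ (by simp)
    exact ⟨0, p, q, fun c => by simp [hpq c]⟩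
  | insert k K hk ih =>
    intro g hg h
    set J0 := Set.ordConnectedComponent ((K : Set ℝ)ᶜ) k with hJ0
    have hJ0o : J0.OrdConnected := inferInstance
    have hJ0K : ∀ x ∈ J0, x ∉ K := fun x hx => by
      have := Set.ordConnectedComponent_subset hx
      simpa using this
    have hJ0n : J0 ∈ nhds k := by
      rw [hJ0, Set.ordConnectedComponent_mem_nhds]
      exact K.finite_toSet.isClosed.isOpen_compl.mem_nhds (by simpa using hk)
    obtain ⟨p1, q1, h1⟩ := h (J0 ∩ Set.Iio k) (hJ0o.inter Set.ordConnected_Iio)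
      (fun x hx => by
        rw [Finset.mem_insert, not_or]
        exact ⟨ne_of_lt hx.2, hJ0K x hx.1⟩)
    obtain ⟨p2, q2, h2⟩ := h (J0 ∩ Set.Ioi k) (hJ0o.inter Set.ordConnected_Ioi)
      (fun x hx => by
        rw [Finset.mem_insert, not_or]
        exact ⟨ne_of_gt hx.2, hJ0K x hx.1⟩)
    obtain ⟨ε, hε, hball⟩ := Metric.mem_nhds_iff.mp hJ0n
    rw [Real.ball_eq_Ioo] at hball
    have hk1 : g k = p1 * k + q1 := by
      have he : Set.EqOn g (fun c => p1 * c + q1) (Set.Ioo (k - ε) k) := fun c hc =>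
        h1 c ⟨hball ⟨hc.1, by linarith [hc.2]⟩, hc.2⟩
      have := he.closure hg (by fun_prop)
      rw [closure_Ioo (by linarith)] at this
      exact this ⟨by linarith, le_rfl⟩
    have hk2 : g k = p2 * k + q2 := by
      have he : Set.EqOn g (fun c => p2 * c + q2) (Set.Ioo k (k + ε)) := fun c hc =>
        h2 c ⟨hball ⟨by linarith [hc.1], hc.2⟩, hc.1⟩
      have := he.closure hg (by fun_prop)
      rw [closure_Ioo (by linarith)] at this
      exact this ⟨le_rfl, by linarith⟩
    obtain ⟨w, p, q, hw⟩ := ih (fun c => g c - (p2 - p1) / 2 * |c - k|) (by fun_prop) (by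
      intro J hJ hJK
      by_cases hkJ : k ∈ J
      · have hJJ : J ⊆ J0 := Set.subset_ordConnectedComponent hkJ (fun x hx => by simpa using hJK x hx)
        refine ⟨(p1 + p2) / 2, q1 - (p2 - p1) / 2 * k, fun c hc => ?_⟩
        simp only
        rcases lt_trichotomy c k with hlt | rfl | hgt
        · rw [h1 c ⟨hJJ hc, hlt⟩, abs_of_neg (by linarith)]; ring
        · rw [hk1]; simp; ring
        · rw [h2 c ⟨hJJ hc, hgt⟩, abs_of_pos (by linarith)]
          linear_combination hk1 - hk2
      · obtain ⟨p, q, hpq⟩ := h J hJ (fun x hx => by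
          rw [Finset.mem_insert, not_or]
          exact ⟨fun e => hkJ (e ▸ hx), hJK x hx⟩)
        by_cases hs : ∃ x ∈ J, x < k
        · obtain ⟨x, hx, hxk⟩ := hs
          refine ⟨p + (p2 - p1) / 2, q - (p2 - p1) / 2 * k, fun c hc => ?_⟩
          have hck : c < k := by
            by_contra hcon
            push Not at hcon
            exact hkJ (hJ.out hx hc ⟨hxk.le, hcon⟩)
          simp only
          rw [hpq c hc, abs_of_neg (by linarith)]; ring
        · push Not at hs
          refine ⟨p - (p2 - p1) / 2, q + (p2 - p1) / 2 * k, fun c hc => ?_⟩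
          simp only
          rw [hpq c hc, abs_of_nonneg (by linarith [hs c hc])]; ring)
    refine ⟨Function.update w k ((p2 - p1) / 2), p, q, fun c => ?_⟩
    have := hw c
    rw [Finset.sum_insert hk, Function.update_self]
    have e : ∑ x ∈ K, Function.update w k ((p2 - p1) / 2) x * |c - x| = ∑ x ∈ K, w x * |c - x| := by
      refine Finset.sum_congr rfl fun x hx => ?_
      rw [Function.update_of_ne (by rintro rfl; exact hk hx)]
    rw [e]
    linarith

lemma slice_repr (a b : ι → ℝ) (D : Set (ℝ × ℝ)) (R : ℝ) (hR : ∀ q ∈ D, |q.1| ≤ R)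
    (hf : ∀ q ∈ frontier D, ∃ i, q.1 = a i * q.2 + b i) :
    ∃ (K : Finset ℝ) (w : ℝ → ℝ) (p q : ℝ), ∀ c,
      (volume {t : ℝ | (t, c) ∈ D}).toReal = p * c + q + ∑ k ∈ K, w k * |c - k| := by
  obtain ⟨E, hE, hEf⟩ := slice_formula a b D R hR hf
  refine ⟨crossings a b, ?_⟩
  refine pw_repr (crossings a b) _ ?_ ?_
  · simp_rw [hEf]
    exact continuous_finsetSum _ fun σ hσ => h_cont a b σ (hE σ hσ).1 (hE σ hσ).2
  · intro J hJ hK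
    simp_rw [hEf]
    exact sum_aff E _ J fun σ hσ => h_aff a b σ (hE σ hσ).1 (hE σ hσ).2 J hJ hK
end geo

lemma B2_add_one (x : ℝ) : B2 (x + 1) = B2 x := by simp [B2]

lemma B2_abs (u : ℝ) (hu : |u| ≤ 1) : B2 u = u^2 - |u| + 1/6 := by
  obtain ⟨h1, h2⟩ := abs_le.mp hu
  have key : ∀ x : ℝ, 0 ≤ x → x ≤ 1 → B2 x = x^2 - x + 1/6 := by
    intro x hx0 hx1
    rcases hx1.eq_or_lt with rfl | hlt
    · simp [B2]
    · rw [B2, Int.fract_eq_self.mpr ⟨hx0, hlt⟩]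
  rcases le_total 0 u with h | h
  · rw [abs_of_nonneg h, key u h h2]
  · rw [abs_of_nonpos h, ← B2_add_one, key (u+1) (by linarith) (by linarith)]; ring

lemma B2_meas : Measurable B2 := by
  unfold B2
  have := measurable_fract (R := ℝ)
  fun_prop

lemma B2_le (x : ℝ) : |B2 x| ≤ 2 := by
  have h0 := Int.fract_nonneg x
  have h1 := Int.fract_lt_one x
  rw [B2, abs_le]
  constructor <;> nlinarith

lemma ii_of_bdd (f : ℝ → ℝ) (hf : Measurable f) (C : ℝ) (h : ∀ x, |f x| ≤ C) (a b : ℝ) :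
    IntervalIntegrable f volume a b := by
  refine (intervalIntegrable_const (c := C)).mono_fun hf.aestronglyMeasurable ?_
  refine Filter.Eventually.of_forall fun x => ?_
  exact (h x).trans (le_abs_self C)

lemma B2_int01 : ∫ x in (0:ℝ)..1, B2 x = 0 := by
  have : ∫ x in (0:ℝ)..1, B2 x = ∫ x in (0:ℝ)..1, (x^2 - x + 1/6) := by
    apply intervalIntegral.integral_congr
    intro x hx
    rw [Set.uIcc_of_le zero_le_one] at hx
    simp only
    rw [B2_abs x (by rw [abs_of_nonneg hx.1]; exact hx.2), abs_of_nonneg hx.1]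
  rw [this, intervalIntegral.integral_add (by apply Continuous.intervalIntegrable; fun_prop) (by simp),
    intervalIntegral.integral_sub (by apply Continuous.intervalIntegrable; fun_prop)
      (by apply Continuous.intervalIntegrable; fun_prop)]
  simp [integral_pow]
  norm_num

lemma B2_int_scaled (R : ℝ) (hR : 0 < R) (k : ℝ) : ∫ c in (-R)..R, B2 ((c - k) / (2 * R)) = 0 := by
  have h1 := intervalIntegral.integral_comp_sub_right (a := -R) (b := R) (fun c => B2 (c / (2 * R))) k
  rw [h1, intervalIntegral.integral_comp_div B2 (by positivity : (2 * R) ≠ 0)]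
  have hp : Function.Periodic B2 1 := B2_add_one
  have h2 := hp.intervalIntegral_add_eq ((-R - k) / (2 * R)) 0
  rw [show (-R - k) / (2 * R) + 1 = (R - k) / (2 * R) by field_simp; ring, zero_add, B2_int01] at h2
  rw [h2]; simp

lemma volume_shear (α : ℝ) (U : Set (ℝ × ℝ)) (hU : MeasurableSet U) :
    volume {q : ℝ × ℝ | (q.1, q.2 + α * q.1) ∈ U} = volume U := by
  have hm : Measurable (fun q : ℝ × ℝ => (q.1, q.2 + α * q.1)) := by fun_prop
  have hD : MeasurableSet {q : ℝ × ℝ | (q.1, q.2 + α * q.1) ∈ U} := hm hU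
  rw [Measure.volume_eq_prod, Measure.prod_apply hD, Measure.prod_apply hU]
  congr 1
  funext t
  have : Prod.mk t ⁻¹' {q : ℝ × ℝ | (q.1, q.2 + α * q.1) ∈ U}
      = (fun y => y + α * t) ⁻¹' (Prod.mk t ⁻¹' U) := rfl
  rw [this, measure_preimage_add_right]

/-- data: periodic representation of the slice function -/
lemma slice_periodic {ι : Type*} [Fintype ι] [DecidableEq ι] (α : ℝ) (hα : 0 < α) (U : Set (ℝ × ℝ)) (hU : IsOpen U)
    (hsub : U ⊆ Set.Ico (0:ℝ) 1 ×ˢ Set.Ico (0:ℝ) 1) (a b : ι → ℝ)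
    (hf : ∀ q ∈ frontier U, ∃ i, q.1 = a i * (q.2 - α * q.1) + b i) :
    ∃ (K : Finset ℝ) (w : ℝ → ℝ) (A : ℝ) (R : ℕ), α + 2 ≤ R ∧
      (∀ c : ℝ, |c| ≤ R + 1 → (volume {t : ℝ | (t, c + α * t) ∈ U}).toReal
        = A - (2 * R) * ∑ k ∈ K, w k * B2 ((c - k) / (2 * R))) ∧
      (volume U).toReal = 2 * R * A := by
  set D : Set (ℝ × ℝ) := {q : ℝ × ℝ | (q.1, q.2 + α * q.1) ∈ U} with hD
  set g : ℝ → ℝ := fun c => (volume {t : ℝ | (t, c + α * t) ∈ U}).toReal with hg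
  have hc : Continuous (fun q : ℝ × ℝ => (q.1, q.2 + α * q.1)) := by fun_prop
  have hDm : MeasurableSet D := hc.measurable hU.measurableSet
  obtain ⟨K, w, p, q, hrep⟩ := slice_repr a b D 1 (fun q hq => by
      have := (hsub hq).1
      simp only [Set.mem_Ico] at this
      rw [abs_of_nonneg this.1]; exact this.2.le) (fun q hq => by
      have := hc.frontier_preimage_subset U hq
      obtain ⟨i, hi⟩ := hf _ this
      refine ⟨i, ?_⟩
      simpa using hi)
  have hrep' : ∀ c, g c = p * c + q + ∑ k ∈ K, w k * |c - k| := hrep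
  have hg0 : ∀ c, (1 ≤ c ∨ c < -α) → g c = 0 := by
    intro c hc
    have : {t : ℝ | (t, c + α * t) ∈ U} = ∅ := by
      ext t
      simp only [Set.mem_ofPred_eq, Set.mem_empty_iff_false, iff_false]
      intro ht
      have := hsub ht
      simp only [Set.mem_prod, Set.mem_Ico] at this
      rcases hc with h | h <;> nlinarith
    simp [hg, this]
  obtain ⟨R, hR⟩ := exists_nat_ge (α + 2 + ∑ k ∈ K, |k|)
  have hks : ∀ k ∈ K, |k| ≤ ∑ k ∈ K, |k| := fun k hk =>
    Finset.single_le_sum (f := fun k : ℝ => |k|) (fun _ _ => abs_nonneg _) hk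
  have hs0 : 0 ≤ ∑ k ∈ K, |k| := Finset.sum_nonneg fun _ _ => abs_nonneg _
  have hkR : ∀ k ∈ K, |k| ≤ R - 2 := fun k hk => by linarith [hks k hk]
  set W := ∑ k ∈ K, w k
  set Z := ∑ k ∈ K, w k * k
  set Q := ∑ k ∈ K, w k * k^2
  have hpos : ∀ c : ℝ, R ≤ c → p * c + q + (W * c - Z) = 0 := by
    intro c hc
    have h1 := hg0 c (Or.inl (by linarith))
    rw [hrep'] at h1
    rw [← h1, Finset.sum_mul, ← Finset.sum_sub_distrib]
    congr 1
    refine Finset.sum_congr rfl fun k hk => ?_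
    have := abs_le.mp (hkR k hk)
    rw [abs_of_nonneg (by linarith)]; ring
  have hneg : ∀ c : ℝ, c ≤ -R → p * c + q + (Z - W * c) = 0 := by
    intro c hc
    have h1 := hg0 c (Or.inr (by linarith))
    rw [hrep'] at h1
    rw [← h1, Finset.sum_mul, ← Finset.sum_sub_distrib]
    congr 1
    refine Finset.sum_congr rfl fun k hk => ?_
    have := abs_le.mp (hkR k hk)
    rw [abs_of_nonpos (by linarith)]; ring
  have e1 := hpos R le_rfl
  have e2 := hpos (R + 1) (by linarith)
  have e3 := hneg (-R) le_rfl
  have e4 := hneg (-R - 1) (by linarith)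
  have hp : p = 0 := by linarith
  have hW : W = 0 := by linarith
  subst hp
  rw [hW] at e1 e3
  have hq : q = 0 := by linarith
  have hZ : Z = 0 := by linarith
  subst hq
  have hR0 : (0:ℝ) < R := by linarith
  have hgper : ∀ c : ℝ, |c| ≤ R + 1 → g c = Q / (2 * R) - (2 * R) * ∑ k ∈ K, w k * B2 ((c - k) / (2 * R)) := by
    intro c hc
    have hcc := abs_le.mp hc
    have h1 : ∀ k ∈ K, (2 * R) * (w k * B2 ((c - k) / (2 * R)))
        = (w k * c^2 - 2 * c * (w k * k) + w k * k^2) / (2 * R) - w k * |c - k| + w k * (2 * R / 6) := by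
      intro k hk
      have hkk := abs_le.mp (hkR k hk)
      have hab : |(c - k) / (2 * R)| = |c - k| / (2 * R) := by
        rw [abs_div, abs_of_pos (by positivity : (0:ℝ) < 2 * R)]
      rw [B2_abs _ (by
        rw [hab, div_le_one (by positivity), abs_le]
        constructor <;> linarith), hab]
      field_simp
      ring
    rw [hrep', Finset.mul_sum, Finset.sum_congr rfl h1, Finset.sum_add_distrib, Finset.sum_sub_distrib,
      ← Finset.sum_div, Finset.sum_add_distrib, Finset.sum_sub_distrib, ← Finset.sum_mul, ← Finset.mul_sum,
      ← Finset.sum_mul]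
    change _ = Q / (2 * R) - ((W * c^2 - 2 * c * Z + Q) / (2 * R) - _ + W * _)
    rw [hW, hZ]
    ring
  refine ⟨K, w, Q / (2 * R), R, by linarith, hgper, ?_⟩
  have hvD : volume D = volume U := volume_shear α U hU.measurableSet
  have hfin : ∀ c, volume {t : ℝ | (t, c + α * t) ∈ U} < ⊤ := by
    intro c
    refine lt_of_le_of_lt (measure_mono (t := Set.Ico (0:ℝ) 1) fun t ht => (hsub ht).1) ?_
    simp
  have hvolint : (volume U).toReal = ∫ c, g c := by
    rw [← hvD, Measure.volume_eq_prod, Measure.prod_apply_symm hDm]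
    rw [← integral_toReal (measurable_measure_prodMk_right hDm).aemeasurable
      (Filter.Eventually.of_forall fun c => hfin c)]
    rfl
  have hvolint2 : ∫ c, g c = ∫ c in (-R:ℝ)..R, g c := by
    rw [intervalIntegral.integral_of_le (by linarith)]
    refine (setIntegral_eq_integral_of_forall_compl_eq_zero fun c hc => hg0 c ?_).symm
    by_contra hcon
    push Not at hcon
    exact hc ⟨by linarith, by linarith⟩
  have hii : ∀ k, IntervalIntegrable (fun c : ℝ => w k * B2 ((c - k) / (2 * R))) volume (-R) R := by
    intro k
    refine (ii_of_bdd (fun c : ℝ => B2 ((c - k) / (2 * R))) ?_ 2 (fun _ => B2_le _) _ _).const_mul _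
    exact B2_meas.comp (by fun_prop)
  have hvolint3 : ∫ c in (-R:ℝ)..R, g c
      = ∫ c in (-R:ℝ)..R, (Q / (2 * R) - (2 * R) * ∑ k ∈ K, w k * B2 ((c - k) / (2 * R))) := by
    apply intervalIntegral.integral_congr
    intro c hc
    rw [Set.uIcc_of_le (by linarith)] at hc
    exact hgper c (abs_le.mpr ⟨by linarith [hc.1], by linarith [hc.2]⟩)
  have hsumii : IntervalIntegrable (fun c : ℝ => ∑ k ∈ K, w k * B2 ((c - k) / (2 * R))) volume (-R) R := by
    have := IntervalIntegrable.sum K (f := fun k (c : ℝ) => w k * B2 ((c - k) / (2 * R))) (fun k _ => hii k)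
    have e : (fun c : ℝ => ∑ k ∈ K, w k * B2 ((c - k) / (2 * R)))
        = ∑ k ∈ K, fun c : ℝ => w k * B2 ((c - k) / (2 * R)) := by
      funext c
      rw [Finset.sum_apply]
    rw [e]
    exact this
  rw [hvolint, hvolint2, hvolint3, intervalIntegral.integral_sub (by simp) (hsumii.const_mul _),
    intervalIntegral.integral_const_mul, intervalIntegral.integral_finsetSum (fun k _ => hii k)]
  simp only [intervalIntegral.integral_const_mul, B2_int_scaled _ hR0]
  simp
  ring

lemma main_open {ι : Type*} [Fintype ι] [DecidableEq ι] (α : ℝ) (hα : 0 < α)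
    (hgood : ∀ M : ℕ, M ≠ 0 →
      ∃ C : ℝ, ∀ (y : ℝ) (N : ℕ), |∑ k ∈ Finset.range N, B2 (y + k * (α / M))| ≤ C)
    (U : Set (ℝ × ℝ)) (hU : IsOpen U)
    (hsub : U ⊆ Set.Ico (0:ℝ) 1 ×ˢ Set.Ico (0:ℝ) 1) (a b : ι → ℝ)
    (hf : ∀ q ∈ frontier U, ∃ i, q.1 = a i * (q.2 - α * q.1) + b i)
    (x₁ x₂ : ℝ) (hx₁ : x₁ ∈ Set.Ico (0:ℝ) 1) : IsBoundedRemainderSet U α x₁ x₂ := by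
  obtain ⟨K, w, A, R, hR, hgper, hvol⟩ := slice_periodic α hα U hU hsub a b hf
  have hR0 : (0:ℝ) < R := by linarith
  have hRn : R ≠ 0 := by rintro rfl; simp at hR0
  obtain ⟨C, hC⟩ := hgood (2 * R) (by omega)
  push_cast at hC
  set χ : ℝ × ℝ → ℝ := U.indicator (fun _ => (1:ℝ)) with hχ
  have hχm : Measurable χ := measurable_const.indicator hU.measurableSet
  have hχb : ∀ p, |χ p| ≤ 1 := by
    intro p
    classical
    rw [hχ, Set.indicator_apply]
    split_ifs <;> simp
  have hfr := measurable_fract (R := ℝ)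
  set Φ : ℝ → ℝ := fun c => A - (2 * R) * ∑ k ∈ K, w k * B2 ((c - k) / (2 * R)) with hΦ
  have hΦper : ∀ c, Φ (c + 2 * R) = Φ c := by
    intro c
    simp only [hΦ]
    congr 2
    refine Finset.sum_congr rfl fun k _ => ?_
    rw [← B2_add_one ((c - k) / (2 * R))]
    congr 2
    field_simp
    ring
  set F : ℝ → ℝ := fun y => ∑ j ∈ Finset.range (2 * R), Φ (y + R - j) with hF
  have hFper : Function.Periodic F 1 := by
    intro y
    have h1 := Finset.sum_range_succ (fun j : ℕ => Φ (y + 1 + R - j)) (2 * R)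
    have h2 := Finset.sum_range_succ' (fun j : ℕ => Φ (y + 1 + R - j)) (2 * R)
    have h3 : Φ (y + 1 + R - ((2 * R : ℕ) : ℝ)) = Φ (y + 1 + R - ((0:ℕ) : ℝ)) := by
      rw [← hΦper]; congr 1; push_cast; ring
    simp only [hF]
    have h4 : ∀ j : ℕ, Φ (y + 1 + R - ((j + 1 : ℕ) : ℝ)) = Φ (y + R - j) := by
      intro j; congr 1; push_cast; ring
    simp only [h4] at h2
    linarith
  set f : ℝ → ℝ := fun y => ∫ s in (0:ℝ)..1, χ (Int.fract s, Int.fract (y + α * s)) with hfdef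
  have hfper : Function.Periodic f 1 := by
    intro y
    simp only [hfdef]
    congr 1
    funext s
    rw [show y + 1 + α * s = (y + α * s) + 1 by ring, Int.fract_add_one]
  -- slices
  have hslice_int : ∀ c : ℝ, Integrable (fun s : ℝ => χ (s, c + α * s)) ∧
      (∫ s in Set.Ico (0:ℝ) 1, χ (s, c + α * s)) = (volume {t : ℝ | (t, c + α * t) ∈ U}).toReal := by
    intro c
    have hm : MeasurableSet {t : ℝ | (t, c + α * t) ∈ U} :=
      (by fun_prop : Measurable (fun t : ℝ => (t, c + α * t))) hU.measurableSet
    have he : (fun s : ℝ => χ (s, c + α * s)) = {t : ℝ | (t, c + α * t) ∈ U}.indicator (fun _ => (1:ℝ)) := by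
      funext s
      classical
      simp only [hχ, Set.indicator_apply]
      rfl
    have hfin : volume {t : ℝ | (t, c + α * t) ∈ U} < ⊤ := by
      refine lt_of_le_of_lt (measure_mono (t := Set.Ico (0:ℝ) 1) fun t ht => (hsub ht).1) ?_
      simp
    constructor
    · rw [he]
      exact (integrable_indicator_iff hm).mpr (integrableOn_const hfin.ne)
    · rw [setIntegral_eq_integral_of_forall_compl_eq_zero, he, integral_indicator hm]
      · simp [Measure.real]
      · intro s hs
        rw [hχ, Set.indicator_of_notMem]
        exact fun h => hs (hsub h).1
  have hfF0 : ∀ y ∈ Set.Ico (0:ℝ) 1, f y = F y := by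
    intro y hy
    have h1 : F y = ∑ j ∈ Finset.range (2 * R), ∫ s in Set.Ico (0:ℝ) 1, χ (s, (y + R - j) + α * s) := by
      refine Finset.sum_congr rfl fun j hj => ?_
      rw [(hslice_int _).2, hgper]
      rw [Finset.mem_range] at hj
      have hj' : (j:ℝ) + 1 ≤ 2 * R := by exact_mod_cast hj
      have := (Nat.cast_nonneg j : (0:ℝ) ≤ j)
      rw [abs_le]
      constructor <;> linarith [hy.1, hy.2]
    rw [h1, ← integral_finsetSum _ (fun j _ => (hslice_int _).1.integrableOn)]
    simp only [hfdef]
    rw [intervalIntegral.integral_of_le zero_le_one, ← integral_Ico_eq_integral_Ioc]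
    refine setIntegral_congr_fun measurableSet_Ico fun s hs => ?_
    rw [Int.fract_eq_self.mpr hs]
    have hz0 : 0 ≤ y + α * s := add_nonneg hy.1 (mul_nonneg hα.le hs.1)
    have hfl0 : 0 ≤ ⌊y + α * s⌋ := Int.floor_nonneg.mpr hz0
    have hflr : (⌊y + α * s⌋ : ℝ) ≤ y + α * s := Int.floor_le _
    obtain ⟨l, hl⟩ := Int.eq_ofNat_of_zero_le hfl0
    have hlR : l < R := by
      have : (l : ℝ) < R := by
        have e : (⌊y + α * s⌋ : ℝ) = l := by rw [hl]; simp
        rw [e] at hflr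
        nlinarith [hs.2, hy.2]
      exact_mod_cast this
    rw [Finset.sum_eq_single (R + l)]
    · congr 2
      rw [Int.fract, hl]
      push_cast
      ring
    · intro j _ hjl
      rw [hχ, Set.indicator_of_notMem]
      intro hmem
      have h2 := (hsub hmem).2
      simp only [Set.mem_Ico] at h2
      apply hjl
      have : ⌊y + α * s⌋ = (j:ℤ) - R := by
        rw [Int.floor_eq_iff]
        push_cast
        constructor <;> linarith [h2.1, h2.2]
      rw [hl] at this
      have h3 : (l : ℤ) = j - R := this
      omega
    · intro hn
      exact absurd (Finset.mem_range.mpr (by omega)) hn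
  have hfF : ∀ y, f y = F y := by
    intro y
    have h1 : f (Int.fract y) = f y := by
      have := hfper.sub_int_mul_eq (x := y) ⌊y⌋
      rw [mul_one] at this; exact this
    have h2 : F (Int.fract y) = F y := by
      have := hFper.sub_int_mul_eq (x := y) ⌊y⌋
      rw [mul_one] at this; exact this
    rw [← h1, ← h2]
    exact hfF0 _ ⟨Int.fract_nonneg _, Int.fract_lt_one _⟩
  set β := x₂ - α * x₁ with hβ
  set G : ℝ → ℝ := fun u => χ (Int.fract u, Int.fract (β + α * u)) with hG
  have hGm : Measurable G := by
    refine hχm.comp (Measurable.prodMk hfr (hfr.comp ?_))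
    fun_prop
  have hGi : ∀ s t, IntervalIntegrable G volume s t := fun s t => ii_of_bdd G hGm 1 (fun _ => hχb _) s t
  have hGb : ∀ s t : ℝ, |∫ u in s..t, G u| ≤ |t - s| := by
    intro s t
    have := intervalIntegral.norm_integral_le_of_norm_le_const (f := G) (C := 1) (a := s) (b := t)
      (fun u _ => hχb _)
    simpa using this
  have hGsum : ∀ N : ℕ, ∫ u in (0:ℝ)..N, G u = ∑ k ∈ Finset.range N, F (β + α * k) := by
    intro N
    have h1 := intervalIntegral.sum_integral_adjacent_intervals (f := G) (μ := volume)
      (a := fun k : ℕ => (k:ℝ)) (n := N) (fun k _ => hGi _ _)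
    simp only [Nat.cast_zero] at h1
    rw [← h1]
    refine Finset.sum_congr rfl fun k _ => ?_
    rw [← hfF]
    have h2 := intervalIntegral.integral_comp_add_right (a := 0) (b := 1) G (k:ℝ)
    rw [show (0:ℝ) + k = k by ring, show (1:ℝ) + k = ((k + 1 : ℕ) : ℝ) by push_cast; ring] at h2
    rw [← h2]
    simp only [hfdef, hG]
    congr 1
    funext s
    rw [Int.fract_add_natCast]
    congr 3
    ring
  have hbirk : ∀ N : ℕ, |(∑ k ∈ Finset.range N, F (β + α * k)) - N * (2 * R * A)|
      ≤ 2 * R * ∑ j ∈ Finset.range (2 * R), ∑ κ ∈ K, |w κ| * C := by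
    intro N
    have e : (∑ k ∈ Finset.range N, F (β + α * k)) - N * (2 * R * A)
        = - (2 * R * ∑ j ∈ Finset.range (2 * R), ∑ κ ∈ K, w κ *
          ∑ k ∈ Finset.range N, B2 ((β + R - j - κ) / (2 * R) + k * (α / (2 * R)))) := by
      have e1 : ∀ k : ℕ, F (β + α * k) = 2 * R * A - 2 * R * ∑ j ∈ Finset.range (2 * R), ∑ κ ∈ K, w κ *
          B2 ((β + R - j - κ) / (2 * R) + k * (α / (2 * R))) := by
        intro k
        simp only [hF, hΦ]
        rw [Finset.sum_sub_distrib, Finset.sum_const, Finset.card_range, nsmul_eq_mul, ← Finset.mul_sum]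
        push_cast
        congr 2
        refine Finset.sum_congr rfl fun j _ => Finset.sum_congr rfl fun κ _ => ?_
        congr 2
        field_simp
        ring
      simp only [e1]
      rw [Finset.sum_sub_distrib, Finset.sum_const, Finset.card_range, nsmul_eq_mul, ← Finset.mul_sum,
        Finset.sum_comm]
      have e2 : ∀ j ∈ Finset.range (2 * R), ∑ k ∈ Finset.range N, ∑ κ ∈ K, w κ *
          B2 ((β + R - j - κ) / (2 * R) + k * (α / (2 * R))) = ∑ κ ∈ K, w κ *
          ∑ k ∈ Finset.range N, B2 ((β + R - j - κ) / (2 * R) + k * (α / (2 * R))) := by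
        intro j _
        rw [Finset.sum_comm]
        exact Finset.sum_congr rfl fun κ _ => (Finset.mul_sum _ _ _).symm
      rw [Finset.sum_congr rfl e2]
      ring
    rw [e, abs_neg, abs_mul, abs_of_pos (by positivity : (0:ℝ) < 2 * R)]
    gcongr
    refine (Finset.abs_sum_le_sum_abs _ _).trans (Finset.sum_le_sum fun j _ => ?_)
    refine (Finset.abs_sum_le_sum_abs _ _).trans (Finset.sum_le_sum fun κ _ => ?_)
    rw [abs_mul]
    exact mul_le_mul_of_nonneg_left (hC _ N) (abs_nonneg _)
  set B := 2 * R * ∑ j ∈ Finset.range (2 * R), ∑ κ ∈ K, |w κ| * C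
  set L := (volume U).toReal with hL
  have hL0 : 0 ≤ L := ENNReal.toReal_nonneg
  refine ⟨B + 3 + L, fun T hT => ?_⟩
  set N := ⌊T⌋₊
  have hN1 : (N:ℝ) ≤ T := Nat.floor_le hT.le
  have hN2 : T < N + 1 := Nat.lt_floor_add_one T
  have hI : rotDelta U α x₁ x₂ T = (∫ u in x₁..(x₁ + T), G u) - T * L := by
    rw [rotDelta]
    congr 1
    have h2 := intervalIntegral.integral_comp_add_left (a := 0) (b := T) G x₁
    rw [add_zero] at h2
    rw [← h2]
    congr 1
    funext t
    simp only [hG]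
    congr 3
    rw [hβ]; ring
  have hsplit : ∫ u in x₁..(x₁ + T), G u = (∫ u in (0:ℝ)..N, G u) + (∫ u in (N:ℝ)..(x₁ + T), G u)
      - ∫ u in (0:ℝ)..x₁, G u := by
    rw [intervalIntegral.integral_add_adjacent_intervals (hGi _ _) (hGi _ _),
      intervalIntegral.integral_interval_sub_left (hGi _ _) (hGi _ _)]
  have b1 := hbirk N
  rw [← hGsum, ← hvol] at b1
  have b2 := hGb N (x₁ + T)
  have b3 := hGb 0 x₁
  obtain ⟨hx0, hx1⟩ := hx₁
  rw [abs_of_nonneg (by linarith : (0:ℝ) ≤ x₁ + T - N)] at b2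
  rw [sub_zero, abs_of_nonneg hx0] at b3
  rw [hI, hsplit]
  rw [abs_le] at b1 b2 b3 ⊢
  have b4 : T * L ≤ N * L + L := by nlinarith
  have b5 : N * L ≤ T * L := by nlinarith
  constructor <;> linarith [b1.1, b1.2, b2.1, b2.2, b3.1, b3.2]

lemma line_null (α a b : ℝ) : volume {q : ℝ × ℝ | q.1 = a * (q.2 - α * q.1) + b} = 0 := by
  have hm : MeasurableSet {q : ℝ × ℝ | q.1 = a * (q.2 - α * q.1) + b} :=
    measurableSet_eq_fun (by fun_prop) (by fun_prop)
  rw [Measure.volume_eq_prod, Measure.measure_prod_null hm]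
  by_cases ha : a = 0
  · have h1 : ∀ᵐ t : ℝ ∂volume, t ≠ b := by simp [ae_iff]
    filter_upwards [h1] with t ht
    have : Prod.mk t ⁻¹' {q : ℝ × ℝ | q.1 = a * (q.2 - α * q.1) + b} = ∅ := by
      ext y; simp [ha, ht]
    rw [this]; simp
  · refine Filter.Eventually.of_forall fun t => ?_
    have : Prod.mk t ⁻¹' {q : ℝ × ℝ | q.1 = a * (q.2 - α * q.1) + b} ⊆ {(t - b) / a + α * t} := by
      intro y hy
      have hy' : t = a * (y - α * t) + b := hy
      rw [Set.mem_singleton_iff]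
      field_simp
      linarith
    exact measure_mono_null this (by simp)

lemma reduce_open {ι : Type*} [Fintype ι] (α : ℝ)
    (S : Set (ℝ × ℝ)) (a b : ι → ℝ)
    (hf : ∀ q ∈ frontier S, ∃ i, q.1 = a i * (q.2 - α * q.1) + b i)
    (x₁ x₂ T : ℝ) : rotDelta S α x₁ x₂ T = rotDelta (interior S) α x₁ x₂ T := by
  have hv : volume S = volume (interior S) := by
    apply le_antisymm
    · have h0 : volume (⋃ i, {q : ℝ × ℝ | q.1 = a i * (q.2 - α * q.1) + b i}) = 0 :=
        measure_iUnion_null fun i => line_null α (a i) (b i)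
      have : S ⊆ interior S ∪ ⋃ i, {q : ℝ × ℝ | q.1 = a i * (q.2 - α * q.1) + b i} := by
        intro q hq
        by_cases h : q ∈ interior S
        · exact Or.inl h
        · right
          obtain ⟨i, hi⟩ := hf q ⟨subset_closure hq, h⟩
          exact Set.mem_iUnion.mpr ⟨i, hi⟩
      calc volume S ≤ _ := measure_mono this
        _ ≤ volume (interior S) + _ := measure_union_le _ _
        _ = volume (interior S) := by rw [h0, add_zero]
    · exact measure_mono interior_subset
  rw [rotDelta, rotDelta, hv]
  congr 1
  apply intervalIntegral.integral_congr_ae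
  have hcount : (Set.range (fun z : ι × ℤ × ℤ =>
      a z.1 * (x₂ - z.2.2 - α * (x₁ - z.2.1)) + b z.1 + z.2.1 - x₁)).Countable := Set.countable_range _
  filter_upwards [hcount.ae_notMem volume] with t ht _
  set p : ℝ × ℝ := (Int.fract (x₁ + t), Int.fract (x₂ + α * t)) with hp
  have hiff : p ∈ S ↔ p ∈ interior S := by
    refine ⟨fun h => ?_, fun h => interior_subset h⟩
    by_contra hc
    obtain ⟨i, hi⟩ := hf p ⟨subset_closure h, hc⟩
    refine ht ⟨(i, ⌊x₁ + t⌋, ⌊x₂ + α * t⌋), ?_⟩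
    simp only [hp, Int.fract] at hi ⊢
    linear_combination -hi
  by_cases h : p ∈ S
  · rw [Set.indicator_of_mem h, Set.indicator_of_mem (hiff.mp h)]
  · rw [Set.indicator_of_notMem h, Set.indicator_of_notMem (fun h' => h (hiff.mpr h'))]

theorem statement0 :
    ∀ᵐ α : ℝ ∂volume, 0 < α →
      ∀ x₁ x₂ : ℝ, x₁ ∈ Set.Ico (0:ℝ) 1 → x₂ ∈ Set.Ico (0:ℝ) 1 →
      ∀ S : Set (ℝ × ℝ), S ⊆ Set.Ico (0:ℝ) 1 ×ˢ Set.Ico (0:ℝ) 1 →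
      ∀ n : ℕ, 3 ≤ n → ∀ v : ZMod n → ℝ × ℝ,
        -- `S` is a polygon whose boundary consists of the edges from `v i` to `v (i+1)`
        frontier S = ⋃ i : ZMod n, segment ℝ (v i) (v (i + 1)) →
        -- no edge of `S` has slope `α`
        (∀ i : ZMod n, (v (i + 1)).2 - (v i).2 ≠ α * ((v (i + 1)).1 - (v i).1)) →
        IsBoundedRemainderSet S α x₁ x₂ := by
  filter_upwards [ae_good] with α hgood hα x₁ x₂ hx₁ hx₂ S hS n hn v hv hslope
  have : NeZero n := ⟨by omega⟩
  let c : ZMod n → ℝ := fun i => (v i).2 - α * (v i).1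
  let a : ZMod n → ℝ := fun i => ((v (i+1)).1 - (v i).1) / (c (i+1) - c i)
  let b : ZMod n → ℝ := fun i => (v i).1 - a i * c i
  have hf : ∀ q ∈ frontier S, ∃ i, q.1 = a i * (q.2 - α * q.1) + b i := by
    intro q hq
    rw [hv] at hq
    obtain ⟨i, hi⟩ := Set.mem_iUnion.mp hq
    refine ⟨i, ?_⟩
    rw [segment_eq_image] at hi
    obtain ⟨s, _, rfl⟩ := hi
    have hne : c (i+1) - c i ≠ 0 := by
      intro h
      apply hslope i
      simp only [c] at h
      linarith
    have ha : a i * (c (i+1) - c i) = (v (i+1)).1 - (v i).1 := div_mul_cancel₀ _ hne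
    simp only [Prod.fst_add, Prod.snd_add, Prod.smul_fst, Prod.smul_snd, smul_eq_mul, b]
    simp only [c] at ha ⊢
    linear_combination -s * ha
  obtain ⟨C, hC⟩ := main_open α hα (hgood hα) (interior S) isOpen_interior (interior_subset.trans hS) a b
    (fun q hq => hf q (frontier_interior_subset hq)) x₁ x₂ hx₁
  refine ⟨C, fun T hT => ?_⟩
  rw [reduce_open α S a b hf]
  exact hC T hT
end

section
/- For almost every α > 0 (with respect to Lebesgue measure) and every starting point x = (x₁, x₂) ∈ [0,1)², every triangle S ⊆ [0,1)² none of whose edges has slope α is a bounded remainder set for the continuous irrational rotation with slope α and starting point x. -/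
open MeasureTheory

open scoped ENNReal FourierTransform
set_option linter.all false

lemma lint_circle : ∫⁻ x : UnitAddCircle, ENNReal.ofReal (‖x‖ ^ (-(3/4):ℝ)) < ∞ := by
  rw [← UnitAddCircle.lintegral_preimage (-(1/2))]
  have h0 : IntegrableOn (fun x : ℝ => |x| ^ (-(3/4):ℝ)) (Set.Ioc (-(1/2)) (-(1/2)+1)) := by
    have h1 : IntervalIntegrable (fun x : ℝ => |x| ^ (-(3/4):ℝ)) volume 0 (1/2) := by
      have := intervalIntegral.intervalIntegrable_rpow' (a := 0) (b := 1/2) (r := -(3/4)) (by norm_num)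
      refine this.congr ?_
      intro x hx
      rw [Set.uIoc_of_le (by norm_num)] at hx
      simp [abs_of_pos hx.1]
    have h2 : IntervalIntegrable (fun x : ℝ => |x| ^ (-(3/4):ℝ)) volume (-(1/2)) 0 := by
      have := ((IntervalIntegrable.iff_comp_neg).1 h1).symm
      simpa using this
    have h3 := h2.trans h1
    rw [intervalIntegrable_iff_integrableOn_Ioc_of_le (by norm_num)] at h3
    rwa [show (-(1/2):ℝ)+1 = 1/2 by norm_num]
  have h1 := h0.hasFiniteIntegral
  rw [hasFiniteIntegral_iff_norm] at h1
  refine lt_of_le_of_lt (le_of_eq ?_) h1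
  refine setLIntegral_congr_fun measurableSet_Ioc ?_
  intro x hx
  have : ‖(x : UnitAddCircle)‖ = |x| := by
    refine (AddCircle.norm_coe_eq_abs_iff 1 one_ne_zero).2 ?_
    rw [abs_one, abs_le]
    constructor <;> linarith [hx.1, hx.2]
  simp only [this]
  rw [Real.norm_of_nonneg (by positivity)]

lemma ae_circle : ∀ᵐ x : UnitAddCircle,
    Summable (fun k : ℤ => |(k:ℝ)| ^ (-(3/2):ℝ) * ‖k • x‖ ^ (-(3/4):ℝ)) := by
  have hm : ∀ k : ℤ, Measurable (fun x : UnitAddCircle => ENNReal.ofReal (|(k:ℝ)| ^ (-(3/2):ℝ) * ‖k • x‖ ^ (-(3/4):ℝ))) := by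
    intro k
    refine ENNReal.measurable_ofReal.comp ?_
    refine Measurable.const_mul ?_ _
    refine Measurable.pow_const ?_ _
    exact (measurable_norm.comp (measurable_const_smul k))
  have key : ∫⁻ x : UnitAddCircle, ∑' k : ℤ, ENNReal.ofReal (|(k:ℝ)| ^ (-(3/2):ℝ) * ‖k • x‖ ^ (-(3/4):ℝ)) ≠ ∞ := by
    rw [lintegral_tsum (fun k => (hm k).aemeasurable)]
    have h1 : ∀ k : ℤ, ∫⁻ x : UnitAddCircle, ENNReal.ofReal (|(k:ℝ)| ^ (-(3/2):ℝ) * ‖k • x‖ ^ (-(3/4):ℝ)) =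
       ENNReal.ofReal (|(k:ℝ)| ^ (-(3/2):ℝ)) * ∫⁻ x : UnitAddCircle, ENNReal.ofReal (‖x‖ ^ (-(3/4):ℝ)) := by
      intro k
      by_cases hk : k = 0
      · subst hk
        rw [Int.cast_zero, abs_zero, Real.zero_rpow (by norm_num)]
        simp
      have hmp := Measure.measurePreserving_zsmul (volume : Measure UnitAddCircle) hk
      rw [← hmp.lintegral_comp (f := fun x : UnitAddCircle => ENNReal.ofReal (‖x‖ ^ (-(3/4):ℝ))) (by fun_prop)]
      rw [← lintegral_const_mul]
      · refine lintegral_congr fun x => ?_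
        rw [ENNReal.ofReal_mul (by positivity)]
      · exact ENNReal.measurable_ofReal.comp (Measurable.pow_const (measurable_norm.comp (measurable_const_smul k)) _)
    simp_rw [h1]
    rw [ENNReal.tsum_mul_right]
    refine ENNReal.mul_ne_top ?_ lint_circle.ne
    have := Real.summable_abs_int_rpow (b := 3/2) (by norm_num)
    exact this.tsum_ofReal_ne_top
  have hae := ae_lt_top (Measurable.tsum hm) key
  filter_upwards [hae] with x hx
  have := ENNReal.summable_toReal hx.ne
  refine this.congr fun k => ?_
  rw [ENNReal.toReal_ofReal (by positivity)]

lemma summable_pow43 {u : ℤ → ℝ} (h0 : ∀ k, 0 ≤ u k) (h : Summable u) :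
    Summable (fun k => u k ^ (4/3:ℝ)) := by
  have h1 : ∀ᶠ k in Filter.cofinite, u k < 1 := h.tendsto_cofinite_zero.eventually_lt_const (by norm_num)
  refine Summable.of_norm_bounded_eventually h ?_
  filter_upwards [h1] with k hk
  rw [Real.norm_of_nonneg (Real.rpow_nonneg (h0 k) _)]
  calc u k ^ (4/3:ℝ) ≤ u k ^ (1:ℝ) := Real.rpow_le_rpow_of_exponent_ge' (h0 k) hk.le (by norm_num) (by norm_num)
    _ = _ := Real.rpow_one _

lemma norm_ge (x : ℝ) : 4 * ‖(x : UnitAddCircle)‖ ≤ ‖Complex.exp (2 * Real.pi * Complex.I * x) - 1‖ := by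
  have h1 : Complex.exp (2 * Real.pi * Complex.I * x) = Complex.exp (Complex.I * ((2 * Real.pi * (x - round x) : ℝ))) := by
    rw [Complex.exp_eq_exp_iff_exists_int]
    refine ⟨round x, ?_⟩
    push_cast; ring
  rw [h1, Complex.norm_exp_I_mul_ofReal_sub_one, UnitAddCircle.norm_eq]
  set y := x - round x
  have hy : |y| ≤ 1/2 := abs_sub_round x
  have hp := Real.pi_pos
  have := Real.mul_abs_le_abs_sin (x := Real.pi * y) (by
    rw [abs_mul, abs_of_pos hp]; nlinarith)
  rw [abs_mul, abs_of_pos hp] at this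
  have h2 : 2 / Real.pi * (Real.pi * |y|) = 2 * |y| := by field_simp
  rw [norm_mul, Real.norm_eq_abs, Real.norm_eq_abs, show 2 * Real.pi * y / 2 = Real.pi * y by ring]
  norm_num
  linarith

lemma ae_real : ∀ᵐ α : ℝ, Irrational α ∧
    Summable (fun k : ℤ => 1 / ((k:ℝ)^2 * ‖Complex.exp (2 * Real.pi * Complex.I * ((k * α : ℝ))) - 1‖)) := by
  have hirr : ∀ᵐ α : ℝ, Irrational α := by
    have : (Set.range ((↑) : ℚ → ℝ)).Countable := Set.countable_range _
    exact this.ae_notMem volume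
  have h1 : ∀ᵐ α : ℝ, Summable (fun k : ℤ => |(k:ℝ)| ^ (-(3/2):ℝ) * ‖k • (α : UnitAddCircle)‖ ^ (-(3/4):ℝ)) := by
    have : ∀ n : ℤ, ∀ᵐ α : ℝ ∂(volume.restrict (Set.Ioc (n:ℝ) (n+1))),
        Summable (fun k : ℤ => |(k:ℝ)| ^ (-(3/2):ℝ) * ‖k • (α : UnitAddCircle)‖ ^ (-(3/4):ℝ)) := fun n =>
      (UnitAddCircle.measurePreserving_mk n).quasiMeasurePreserving.ae ae_circle
    have h2 := (ae_restrict_iUnion_iff (μ := volume) (fun n : ℤ => Set.Ioc (n:ℝ) (n+1)) _).2 this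
    rwa [iUnion_Ioc_intCast, Measure.restrict_univ] at h2
  filter_upwards [hirr, h1] with α hα h
  refine ⟨hα, ?_⟩
  have h2 := summable_pow43 (fun k => by positivity) h
  refine Summable.of_nonneg_of_le (fun k => by positivity) ?_ h2
  intro k
  by_cases hk : k = 0
  · simp only [hk]; norm_num
  have hz : ((k * α : ℝ) : UnitAddCircle) = k • (α : UnitAddCircle) := by
    rw [← zsmul_eq_mul]; rfl
  have h3 := norm_ge (k * α)
  rw [hz] at h3
  have hpos : 0 < ‖k • (α : UnitAddCircle)‖ := by
    rw [norm_pos_iff, ← hz]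
    intro h0
    rw [AddCircle.coe_eq_zero_iff] at h0
    obtain ⟨n, hn⟩ := h0
    have := (hα.intCast_mul hk)
    apply this
    exact ⟨n, by rw [← hn]; simp⟩
  set d := ‖k • (α : UnitAddCircle)‖
  rw [Real.mul_rpow (by positivity) (by positivity), ← Real.rpow_mul (by positivity), ← Real.rpow_mul (by positivity)]
  norm_num
  rw [Real.rpow_neg_one, mul_comm]
  gcongr
  push_cast at h3
  linarith


def stdS : Set (ℝ × ℝ) := {p | 0 ≤ p.1 ∧ 0 ≤ p.2 ∧ p.1 + p.2 ≤ 1}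

def tmap (v₀ v₁ v₂ : ℝ × ℝ) (p : ℝ × ℝ) : ℝ × ℝ := v₀ + (p.1 • (v₁ - v₀) + p.2 • (v₂ - v₀))

lemma stdS_meas : MeasurableSet stdS := by
  unfold stdS
  refine (measurableSet_le measurable_const measurable_fst).inter
    ((measurableSet_le measurable_const measurable_snd).inter
      (measurableSet_le (measurable_fst.add measurable_snd) measurable_const))

lemma hull_eq (v₀ v₁ v₂ : ℝ × ℝ) : convexHull ℝ ({v₀, v₁, v₂} : Set (ℝ × ℝ)) = tmap v₀ v₁ v₂ '' stdS := by
  apply Set.Subset.antisymm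
  · apply convexHull_min
    · rintro x (rfl | rfl | rfl)
      · exact ⟨(0, 0), by simp [stdS], by simp [tmap]⟩
      · exact ⟨(1, 0), by simp [stdS], by simp [tmap]⟩
      · exact ⟨(0, 1), by simp [stdS], by simp [tmap]⟩
    · rintro _ ⟨p, ⟨hp1, hp2, hp3⟩, rfl⟩ _ ⟨q, ⟨hq1, hq2, hq3⟩, rfl⟩ a b ha hb hab
      refine ⟨a • p + b • q, ⟨?_, ?_, ?_⟩, ?_⟩
      · simp only [Prod.fst_add, Prod.smul_fst, smul_eq_mul]; positivity
      · simp only [Prod.snd_add, Prod.smul_snd, smul_eq_mul]; positivity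
      · simp only [Prod.fst_add, Prod.smul_fst, smul_eq_mul, Prod.snd_add, Prod.smul_snd]
        nlinarith
      · obtain rfl : b = 1 - a := by linarith
        ext <;> simp [tmap] <;> ring
  · rintro _ ⟨p, ⟨hp1, hp2, hp3⟩, rfl⟩
    have hc := convex_convexHull ℝ ({v₀, v₁, v₂} : Set (ℝ × ℝ))
    have h := hc.sum_mem (t := Finset.univ) (w := ![1 - p.1 - p.2, p.1, p.2]) (z := ![v₀, v₁, v₂]) (by
      intro i _; fin_cases i <;> simp <;> linarith) (by simp [Fin.sum_univ_three]; ring) (by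
      intro i _; apply subset_convexHull; fin_cases i <;> simp)
    convert! h using 1
    simp only [Fin.sum_univ_three, tmap]
    ext <;> simp <;> ring

lemma mem_tri (v₀ v₁ v₂ : ℝ × ℝ) (hd : (v₁.1 - v₀.1) * (v₂.2 - v₀.2) - (v₁.2 - v₀.2) * (v₂.1 - v₀.1) ≠ 0)
    (p : ℝ × ℝ) : p ∈ tmap v₀ v₁ v₂ '' stdS ↔
      (((p.1 - v₀.1) * (v₂.2 - v₀.2) - (p.2 - v₀.2) * (v₂.1 - v₀.1)) / ((v₁.1 - v₀.1) * (v₂.2 - v₀.2) - (v₁.2 - v₀.2) * (v₂.1 - v₀.1)),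
       ((v₁.1 - v₀.1) * (p.2 - v₀.2) - (v₁.2 - v₀.2) * (p.1 - v₀.1)) / ((v₁.1 - v₀.1) * (v₂.2 - v₀.2) - (v₁.2 - v₀.2) * (v₂.1 - v₀.1))) ∈ stdS := by
  constructor
  · rintro ⟨q, hq, rfl⟩
    convert! hq using 1
    ext
    · simp only [tmap, Prod.fst_add, Prod.snd_add, Prod.smul_fst, Prod.smul_snd, smul_eq_mul, Prod.fst_sub, Prod.snd_sub]
      rw [div_eq_iff hd]; ring
    · simp only [tmap, Prod.fst_add, Prod.snd_add, Prod.smul_fst, Prod.smul_snd, smul_eq_mul, Prod.fst_sub, Prod.snd_sub]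
      rw [div_eq_iff hd]; ring
  · intro h
    refine ⟨_, h, ?_⟩
    ext
    · simp only [tmap, Prod.fst_add, Prod.snd_add, Prod.smul_fst, Prod.smul_snd, smul_eq_mul, Prod.fst_sub, Prod.snd_sub]
      generalize hD : (v₁.1 - v₀.1) * (v₂.2 - v₀.2) - (v₁.2 - v₀.2) * (v₂.1 - v₀.1) = D at *
      field_simp
      rw [← hD]; ring
    · simp only [tmap, Prod.fst_add, Prod.snd_add, Prod.smul_fst, Prod.smul_snd, smul_eq_mul, Prod.fst_sub, Prod.snd_sub]
      generalize hD : (v₁.1 - v₀.1) * (v₂.2 - v₀.2) - (v₁.2 - v₀.2) * (v₂.1 - v₀.1) = D at *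
      field_simp
      rw [← hD]; ring

lemma tmap_inj (v₀ v₁ v₂ : ℝ × ℝ) (hd : (v₁.1 - v₀.1) * (v₂.2 - v₀.2) - (v₁.2 - v₀.2) * (v₂.1 - v₀.1) ≠ 0) :
    Function.Injective (tmap v₀ v₁ v₂) := by
  intro p q h
  rw [Prod.ext_iff] at h
  simp only [tmap, Prod.fst_add, Prod.snd_add, Prod.smul_fst, Prod.smul_snd, smul_eq_mul, Prod.fst_sub, Prod.snd_sub] at h
  obtain ⟨h1, h2⟩ := h
  ext
  · apply mul_right_cancel₀ hd
    linear_combination (v₂.2 - v₀.2) * h1 - (v₂.1 - v₀.1) * h2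
  · apply mul_right_cancel₀ hd
    linear_combination (v₁.1 - v₀.1) * h2 - (v₁.2 - v₀.2) * h1

lemma tri_integral (v₀ v₁ v₂ : ℝ × ℝ) (hd : (v₁.1 - v₀.1) * (v₂.2 - v₀.2) - (v₁.2 - v₀.2) * (v₂.1 - v₀.1) ≠ 0) :
    ∃ D : ℝ, 0 ≤ D ∧ ∀ g : ℝ × ℝ → ℂ, ∫ p in tmap v₀ v₁ v₂ '' stdS, g p = D • ∫ p in stdS, g (tmap v₀ v₁ v₂ p) := by
  let L : (ℝ × ℝ) →L[ℝ] (ℝ × ℝ) :=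
    (ContinuousLinearMap.fst ℝ ℝ ℝ).smulRight (v₁ - v₀) + (ContinuousLinearMap.snd ℝ ℝ ℝ).smulRight (v₂ - v₀)
  refine ⟨|L.det|, abs_nonneg _, fun g => ?_⟩
  rw [integral_image_eq_integral_abs_det_fderiv_smul volume stdS_meas (f' := fun _ => L) _ (tmap_inj _ _ _ hd).injOn]
  · rw [integral_smul]
  · intro x _
    have : HasFDerivAt (fun p => v₀ + L p) L x := L.hasFDerivAt.const_add v₀
    exact this.hasFDerivWithinAt

lemma std_integral (g : ℝ × ℝ → ℂ) (hg : Continuous g) (hb : ∀ p, ‖g p‖ ≤ 1) :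
    ∫ p in stdS, g p = ∫ a in (0:ℝ)..1, ∫ b in (0:ℝ)..(1 - a), g (a, b) := by
  have hsub : stdS ⊆ Set.Icc 0 1 ×ˢ Set.Icc 0 1 := by
    rintro p ⟨h1, h2, h3⟩
    exact ⟨⟨h1, by linarith⟩, ⟨h2, by linarith⟩⟩
  rw [← integral_indicator stdS_meas]
  have hint : Integrable (stdS.indicator g) := by
    rw [integrable_indicator_iff stdS_meas]
    have : IntegrableOn g (Set.Icc 0 1 ×ˢ Set.Icc 0 1) :=
      hg.continuousOn.integrableOn_compact (isCompact_Icc.prod isCompact_Icc)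
    exact this.mono_set hsub
  rw [Measure.volume_eq_prod] at hint ⊢
  rw [integral_prod _ hint, intervalIntegral.integral_of_le zero_le_one, ← integral_Icc_eq_integral_Ioc,
    ← integral_indicator measurableSet_Icc]
  congr 1
  ext a
  by_cases ha : a ∈ Set.Icc (0:ℝ) 1
  · rw [Set.indicator_of_mem ha, intervalIntegral.integral_of_le (by linarith [ha.2]), ← integral_Icc_eq_integral_Ioc,
      ← integral_indicator measurableSet_Icc]
    congr 1
    ext b
    by_cases hb : b ∈ Set.Icc (0:ℝ) (1 - a)
    · rw [Set.indicator_of_mem hb, Set.indicator_of_mem]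
      exact ⟨ha.1, hb.1, by linarith [hb.2]⟩
    · rw [Set.indicator_of_notMem hb, Set.indicator_of_notMem]
      rintro ⟨h1, h2, h3⟩
      exact hb ⟨h2, by simp only at h3; linarith⟩
  · rw [Set.indicator_of_notMem ha]
    convert integral_zero ℝ ℂ with b
    rw [Set.indicator_of_notMem]
    intro h
    exact ha (hsub h).1

lemma exp_int_bound (w : ℝ) (hw : w ≠ 0) : ‖∫ a in (0:ℝ)..1, Complex.exp (Complex.I * w * a)‖ ≤ 2 / |w| := by
  have hc : Complex.I * w ≠ 0 := by simp [hw]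
  rw [integral_exp_mul_complex hc, norm_div]
  have h2 : ‖Complex.I * (w:ℂ)‖ = |w| := by simp
  rw [h2]
  gcongr
  refine (norm_sub_le _ _).trans ?_
  have (x : ℝ) : ‖Complex.exp (Complex.I * w * x)‖ = 1 := by
    rw [show Complex.I * w * x = ((w * x : ℝ) : ℂ) * Complex.I by push_cast; ring]
    exact Complex.norm_exp_ofReal_mul_I _
  rw [this, this]; norm_num

lemma std_exp_bound (κ c0 c1 c2 : ℝ) (hκ : κ ≠ 0) (h1 : c1 ≠ 0) (h2 : c2 ≠ 0) (h12 : c1 - c2 ≠ 0) :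
    ‖∫ p in stdS, Complex.exp (((κ * (c0 + (p.1 * c1 + p.2 * c2)) : ℝ) : ℂ) * Complex.I)‖ ≤
      ((2 / |c1 - c2| + 2 / |c1|) / |c2|) / κ ^ 2 := by
  rw [std_integral (fun p => Complex.exp (((κ * (c0 + (p.1 * c1 + p.2 * c2)) : ℝ) : ℂ) * Complex.I)) (by fun_prop) (fun p => (Complex.norm_exp_ofReal_mul_I _).le)]
  have hc : Complex.I * ((κ * c2 : ℝ) : ℂ) ≠ 0 := by
    simp only [ne_eq, mul_eq_zero, Complex.I_ne_zero, Complex.ofReal_eq_zero, false_or, not_or]; exact ⟨hκ, h2⟩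
  have inner : ∀ a : ℝ, ∫ b in (0:ℝ)..(1-a), Complex.exp (((κ * (c0 + (a * c1 + b * c2)) : ℝ) : ℂ) * Complex.I) =
     (Complex.exp (((κ * (c0 + c2) : ℝ) : ℂ) * Complex.I) * Complex.exp (Complex.I * ((κ * (c1 - c2) : ℝ) : ℂ) * a)
      - Complex.exp (((κ * c0 : ℝ) : ℂ) * Complex.I) * Complex.exp (Complex.I * ((κ * c1 : ℝ) : ℂ) * a)) / (Complex.I * ((κ * c2 : ℝ) : ℂ)) := by
    intro a
    have : ∀ b : ℝ, Complex.exp (((κ * (c0 + (a * c1 + b * c2)) : ℝ) : ℂ) * Complex.I) =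
       Complex.exp (((κ * (c0 + a * c1) : ℝ) : ℂ) * Complex.I) * Complex.exp (Complex.I * ((κ * c2 : ℝ) : ℂ) * b) := by
      intro b
      rw [← Complex.exp_add]; congr 1; push_cast; ring
    simp_rw [this]
    rw [intervalIntegral.integral_const_mul, integral_exp_mul_complex hc, ← mul_div_assoc, mul_sub]
    simp_rw [← Complex.exp_add]
    congr 3
    · push_cast; ring
    · push_cast; ring_nf
  simp only [inner]
  rw [intervalIntegral.integral_div, intervalIntegral.integral_sub, intervalIntegral.integral_const_mul,
    intervalIntegral.integral_const_mul, norm_div]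
  · have hn : ‖Complex.I * ((κ * c2 : ℝ) : ℂ)‖ = |κ| * |c2| := by
      rw [norm_mul, Complex.norm_I, Complex.norm_real, one_mul, Real.norm_eq_abs, abs_mul]
    have b1 := exp_int_bound (κ * (c1 - c2)) (mul_ne_zero hκ h12)
    have b2 := exp_int_bound (κ * c1) (mul_ne_zero hκ h1)
    rw [hn]
    have hk : 0 < |κ| := abs_pos.2 hκ
    have e : ((2 / |c1 - c2| + 2 / |c1|) / |c2|) / κ ^ 2 = (2 / |κ * (c1 - c2)| + 2 / |κ * c1|) / (|κ| * |c2|) := by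
      rw [abs_mul, abs_mul, ← sq_abs κ]
      have := abs_pos.2 h12
      have := abs_pos.2 h1
      have := abs_pos.2 h2
      field_simp
    rw [e]
    gcongr
    refine (norm_sub_le _ _).trans ?_
    rw [norm_mul, norm_mul, Complex.norm_exp_ofReal_mul_I, Complex.norm_exp_ofReal_mul_I, one_mul, one_mul]
    exact add_le_add b1 b2
  · exact Continuous.intervalIntegrable (by fun_prop) _ _
  · exact Continuous.intervalIntegrable (by fun_prop) _ _

lemma tri_fourier (v₀ v₁ v₂ : ℝ × ℝ) (α : ℝ) (hd : (v₁.1 - v₀.1) * (v₂.2 - v₀.2) - (v₁.2 - v₀.2) * (v₂.1 - v₀.1) ≠ 0)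
    (h1 : v₁.2 - v₀.2 ≠ α * (v₁.1 - v₀.1)) (h2 : v₂.2 - v₁.2 ≠ α * (v₂.1 - v₁.1))
    (h3 : v₀.2 - v₂.2 ≠ α * (v₀.1 - v₂.1)) :
    ∃ C : ℝ, ∀ k : ℤ, k ≠ 0 → ‖∫ p in tmap v₀ v₁ v₂ '' stdS, Complex.exp (((-2 * Real.pi * (p.2 - α * p.1) * k : ℝ) : ℂ) * Complex.I)‖ ≤ C / (k:ℝ)^2 := by
  obtain ⟨D, hD, h⟩ := tri_integral v₀ v₁ v₂ hd
  set c0 := v₀.2 - α * v₀.1 with hc0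
  set c1 := (v₁.2 - v₀.2) - α * (v₁.1 - v₀.1) with hc1
  set c2 := (v₂.2 - v₀.2) - α * (v₂.1 - v₀.1) with hc2
  have n1 : c1 ≠ 0 := sub_ne_zero.2 h1
  have n2 : c2 ≠ 0 := fun h => h3 (by rw [hc2] at h; linarith)
  have n3 : c1 - c2 ≠ 0 := fun h => h2 (by rw [hc1, hc2] at h; linarith)
  refine ⟨D * (((2 / |c1 - c2| + 2 / |c1|) / |c2|) / (-2 * Real.pi) ^ 2), fun k hk => ?_⟩
  have hκ : (-2 * Real.pi * k) ≠ 0 := by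
    have := Real.pi_ne_zero
    have : (k:ℝ) ≠ 0 := by exact_mod_cast hk
    positivity
  have b := std_exp_bound (-2 * Real.pi * k) c0 c1 c2 hκ n1 n2 n3
  rw [h, norm_smul, Real.norm_of_nonneg hD, mul_div_assoc, div_div, ← mul_pow]
  gcongr
  refine le_of_eq_of_le (congrArg norm (setIntegral_congr_fun stdS_meas fun p _ => ?_)) b
  refine congrArg (fun z : ℝ => Complex.exp ((z : ℂ) * Complex.I)) ?_
  simp only [tmap, Prod.fst_add, Prod.snd_add, Prod.smul_fst, Prod.smul_snd, smul_eq_mul, Prod.fst_sub, Prod.snd_sub]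
  rw [hc0, hc1, hc2]; ring


noncomputable def hfun (S : Set (ℝ × ℝ)) (α y : ℝ) : ℝ :=
  ∫ t : ℝ, S.indicator (fun _ => (1:ℝ)) (t, y + α * t)

lemma ind_meas {S : Set (ℝ × ℝ)} (hS : MeasurableSet S) : Measurable (S.indicator (fun _ => (1:ℝ))) :=
  measurable_const.indicator hS

lemma ind_le (S : Set (ℝ × ℝ)) (p : ℝ × ℝ) : ‖S.indicator (fun _ => (1:ℝ)) p‖ ≤ 1 := by
  by_cases h : p ∈ S <;> simp [h]

lemma hfun_cont {S : Set (ℝ × ℝ)} (hS : MeasurableSet S) (hsub : S ⊆ Set.Ico (0:ℝ) 1 ×ˢ Set.Ico (0:ℝ) 1)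
    {α : ℝ} (A B : ℝ × ℝ → ℝ) (hA : Continuous A) (hB : Continuous B)
    (hmem : ∀ p, p ∈ S ↔ 0 ≤ A p ∧ 0 ≤ B p ∧ A p + B p ≤ 1)
    (h1 : ∀ y, {t : ℝ | A (t, y + α * t) = 0}.Subsingleton)
    (h2 : ∀ y, {t : ℝ | B (t, y + α * t) = 0}.Subsingleton)
    (h3 : ∀ y, {t : ℝ | A (t, y + α * t) + B (t, y + α * t) = 1}.Subsingleton) :
    Continuous (hfun S α) := by
  rw [continuous_iff_continuousAt]
  intro y
  unfold hfun
  refine continuousAt_of_dominated (bound := (Set.Icc (0:ℝ) 1).indicator (fun _ => (1:ℝ))) ?_ ?_ ?_ ?_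
  · exact Filter.Eventually.of_forall fun y => ((ind_meas hS).comp (by fun_prop)).aestronglyMeasurable
  · refine Filter.Eventually.of_forall fun y => Filter.Eventually.of_forall fun t => ?_
    by_cases h : (t, y + α * t) ∈ S
    · have := (hsub h).1
      rw [Set.indicator_of_mem h, Set.indicator_of_mem (show t ∈ Set.Icc (0:ℝ) 1 from ⟨this.1, this.2.le⟩)]; simp
    · rw [Set.indicator_of_notMem h, norm_zero]
      exact Set.indicator_nonneg (fun _ _ => zero_le_one) _
  · rw [integrable_indicator_iff measurableSet_Icc]
    exact continuousOn_const.integrableOn_compact isCompact_Icc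
  · have e1 := (h1 y).countable.ae_notMem volume
    have e2 := (h2 y).countable.ae_notMem volume
    have e3 := (h3 y).countable.ae_notMem volume
    filter_upwards [e1, e2, e3] with t t1 t2 t3
    replace t1 : A (t, y + α * t) ≠ 0 := t1
    replace t2 : B (t, y + α * t) ≠ 0 := t2
    replace t3 : A (t, y + α * t) + B (t, y + α * t) ≠ 1 := t3
    have cA : ContinuousAt (fun y => A (t, y + α * t)) y := by fun_prop
    have cB : ContinuousAt (fun y => B (t, y + α * t)) y := by fun_prop
    have cAB : ContinuousAt (fun y => A (t, y + α * t) + B (t, y + α * t)) y := by fun_prop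
    by_cases h : (t, y + α * t) ∈ S
    · obtain ⟨i1, i2, i3⟩ := (hmem _).1 h
      have i1 := lt_of_le_of_ne i1 (Ne.symm t1)
      have i2 := lt_of_le_of_ne i2 (Ne.symm t2)
      have i3 := lt_of_le_of_ne i3 t3
      refine (continuousAt_const (y := (1:ℝ))).congr ?_
      filter_upwards [cA.eventually (lt_mem_nhds i1), cB.eventually (lt_mem_nhds i2), cAB.eventually (gt_mem_nhds i3)] with z z1 z2 z3
      rw [Set.indicator_of_mem]
      exact (hmem _).2 ⟨z1.le, z2.le, z3.le⟩
    · refine (continuousAt_const (y := (0:ℝ))).congr ?_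
      rw [hmem] at h
      have : A (t, y + α * t) < 0 ∨ B (t, y + α * t) < 0 ∨ 1 < A (t, y + α * t) + B (t, y + α * t) := by
        by_contra hcon
        push Not at hcon
        exact h hcon
      rcases this with i | i | i
      · filter_upwards [cA.eventually (gt_mem_nhds i)] with z hz
        rw [Set.indicator_of_notMem]
        intro hh; linarith [((hmem _).1 hh).1]
      · filter_upwards [cB.eventually (gt_mem_nhds i)] with z hz
        rw [Set.indicator_of_notMem]
        intro hh; linarith [((hmem _).1 hh).2.1]
      · filter_upwards [cAB.eventually (lt_mem_nhds i)] with z hz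
        rw [Set.indicator_of_notMem]
        intro hh; linarith [((hmem _).1 hh).2.2]

lemma bnd_of_mem {S : Set (ℝ × ℝ)} (hsub : S ⊆ Set.Ico (0:ℝ) 1 ×ˢ Set.Ico (0:ℝ) 1)
    {α y t : ℝ} (h : (t, y + α * t) ∈ S) : (0 ≤ t ∧ t ≤ 1) ∧ |y| ≤ 1 + |α| := by
  obtain ⟨⟨a1, a2⟩, ⟨b1, b2⟩⟩ := hsub h
  simp only at a1 a2 b1 b2
  refine ⟨⟨a1, a2.le⟩, ?_⟩
  have : |α * t| ≤ |α| := by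
    rw [abs_mul, abs_of_nonneg a1]; exact mul_le_of_le_one_right (abs_nonneg _) a2.le
  have := abs_le.1 this
  rw [abs_le]; constructor <;> linarith [this.1, this.2]

lemma hfun_zero {S : Set (ℝ × ℝ)} (hsub : S ⊆ Set.Ico (0:ℝ) 1 ×ˢ Set.Ico (0:ℝ) 1)
    {α y : ℝ} (h : 1 + |α| < |y|) : hfun S α y = 0 := by
  unfold hfun
  convert integral_zero ℝ ℝ with t
  rw [Set.indicator_of_notMem]
  intro hm
  linarith [(bnd_of_mem hsub hm).2]

lemma hfun_fourier {S : Set (ℝ × ℝ)} (hS : MeasurableSet S) (hsub : S ⊆ Set.Ico (0:ℝ) 1 ×ˢ Set.Ico (0:ℝ) 1)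
    (α w : ℝ) : 𝓕 (fun y => ((hfun S α y : ℝ) : ℂ)) w =
      ∫ p in S, Complex.exp (((-2 * Real.pi * (p.2 - α * p.1) * w : ℝ) : ℂ) * Complex.I) := by
  rw [Real.fourier_real_eq_integral_exp_smul]
  have e : ∀ v : ℝ, Complex.exp (((-2 * Real.pi * v * w : ℝ) : ℂ) * Complex.I) • ((hfun S α v : ℝ) : ℂ) =
      ∫ t : ℝ, Complex.exp (((-2 * Real.pi * v * w : ℝ) : ℂ) * Complex.I) * S.indicator (fun _ => (1:ℂ)) (t, v + α * t) := by
    intro v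
    rw [hfun, ← integral_complex_ofReal, smul_eq_mul, ← integral_const_mul]
    congr 1; ext t
    by_cases h : (t, v + α * t) ∈ S <;> simp [h]
  simp_rw [e]
  have hmeas : Measurable (S.indicator (fun _ => (1:ℂ))) := measurable_const.indicator hS
  rw [integral_integral_swap]
  · have e2 : ∀ t : ℝ, ∫ v : ℝ, Complex.exp (((-2 * Real.pi * v * w : ℝ) : ℂ) * Complex.I) * S.indicator (fun _ => (1:ℂ)) (t, v + α * t)
       = ∫ z : ℝ, S.indicator (fun p : ℝ × ℝ => Complex.exp (((-2 * Real.pi * (p.2 - α * p.1) * w : ℝ) : ℂ) * Complex.I)) (t, z) := by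
      intro t
      rw [← integral_add_right_eq_self (fun z : ℝ => S.indicator (fun p : ℝ × ℝ => Complex.exp (((-2 * Real.pi * (p.2 - α * p.1) * w : ℝ) : ℂ) * Complex.I)) (t, z)) (α * t)]
      congr 1; ext v
      by_cases h : (t, v + α * t) ∈ S <;> simp [h]
    simp_rw [e2]
    rw [← integral_indicator hS, Measure.volume_eq_prod, integral_prod]
    rw [integrable_indicator_iff hS]
    have : IntegrableOn (fun p : ℝ × ℝ => Complex.exp (((-2 * Real.pi * (p.2 - α * p.1) * w : ℝ) : ℂ) * Complex.I)) (Set.Icc (0:ℝ) 1 ×ˢ Set.Icc (0:ℝ) 1) (volume.prod volume) :=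
      (Continuous.continuousOn (by fun_prop)).integrableOn_compact (isCompact_Icc.prod isCompact_Icc)
    exact this.mono_set (hsub.trans (Set.prod_mono Set.Ico_subset_Icc_self Set.Ico_subset_Icc_self))
  · have hb : Integrable ((Set.Icc (-(1+|α|)) (1 + |α|) ×ˢ Set.Icc (0:ℝ) 1).indicator (fun _ : ℝ × ℝ => (1:ℝ))) (volume.prod volume) := by
      rw [integrable_indicator_iff (measurableSet_Icc.prod measurableSet_Icc)]
      exact continuousOn_const.integrableOn_compact (isCompact_Icc.prod isCompact_Icc)
    refine hb.mono' ?_ ?_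
    · refine Measurable.aestronglyMeasurable ?_
      refine Measurable.mul (Continuous.measurable (by fun_prop)) ?_
      exact hmeas.comp (by fun_prop)
    · refine Filter.Eventually.of_forall fun p => ?_
      simp only [Function.uncurry]
      by_cases h : (p.2, p.1 + α * p.2) ∈ S
      · have := bnd_of_mem hsub h
        rw [Set.indicator_of_mem h, Set.indicator_of_mem, mul_one, Complex.norm_exp_ofReal_mul_I]
        exact ⟨abs_le.1 this.2, this.1⟩
      · rw [Set.indicator_of_notMem h, mul_zero, norm_zero]
        exact Set.indicator_nonneg (fun _ _ => zero_le_one) _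

lemma hfun_unfold {S : Set (ℝ × ℝ)} (hS : MeasurableSet S) (hsub : S ⊆ Set.Ico (0:ℝ) 1 ×ˢ Set.Ico (0:ℝ) 1)
    (α y : ℝ) : ∫ t in Set.Ioo (0:ℝ) 1, S.indicator (fun _ => (1:ℝ)) (t, Int.fract (y + α * t)) =
      ∑' m : ℤ, hfun S α (y + m) := by
  obtain ⟨M, hM⟩ := exists_nat_ge (|y| + |α| + 2)
  have hz : ∀ m : ℤ, m ∉ Finset.Icc (-(M:ℤ)) M → hfun S α (y + m) = 0 := by
    intro m hm
    apply hfun_zero hsub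
    have : (M:ℝ) < |(m:ℝ)| := by
      by_contra hcon
      push Not at hcon
      rw [abs_le] at hcon
      apply hm
      rw [Finset.mem_Icc]
      exact_mod_cast hcon
    have h2 : |(m:ℝ)| ≤ |y + m| + |y| := by
      have := abs_sub (y + m) y
      rwa [add_sub_cancel_left] at this
    linarith
  rw [tsum_eq_sum (s := Finset.Icc (-(M:ℤ)) M) (fun m hm => hz m hm)]
  have e : ∀ m : ℤ, hfun S α (y + m) = ∫ t in Set.Ico (0:ℝ) 1, S.indicator (fun _ => (1:ℝ)) (t, y + m + α * t) := by
    intro m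
    rw [hfun, setIntegral_eq_integral_of_forall_compl_eq_zero]
    intro t ht
    rw [Set.indicator_of_notMem]
    intro h
    exact ht (hsub h).1
  simp_rw [e]
  rw [← integral_finset_sum]
  · rw [← integral_Ico_eq_integral_Ioo]
    refine setIntegral_congr_fun measurableSet_Ico fun t ht => ?_
    have hfl : -⌊y + α * t⌋ ∈ Finset.Icc (-(M:ℤ)) M := by
      have : |α * t| ≤ |α| := by
        rw [abs_mul, abs_of_nonneg ht.1]; exact mul_le_of_le_one_right (abs_nonneg _) ht.2.le
      have := abs_le.1 this
      have h3 := abs_le.1 (le_refl |y|)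
      have h1 := Int.floor_le (y + α * t)
      have h2 := Int.lt_floor_add_one (y + α * t)
      rw [Finset.mem_Icc]
      have a1 : (⌊y + α * t⌋ : ℝ) ≤ M := by linarith
      have a2 : (-(M:ℝ)) ≤ ⌊y + α * t⌋ := by linarith
      have a1 : ⌊y + α * t⌋ ≤ (M:ℤ) := by exact_mod_cast a1
      have a2 : -(M:ℤ) ≤ ⌊y + α * t⌋ := by exact_mod_cast a2
      omega
    rw [Finset.sum_eq_single_of_mem _ hfl]
    · congr 2
      rw [Int.fract]; push_cast; ring
    · intro m _ hm
      rw [Set.indicator_of_notMem]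
      intro h
      have := (hsub h).2
      apply hm
      have h5 : ⌊y + α * t⌋ = -m := by
        rw [Int.floor_eq_iff]
        push_cast
        constructor <;> linarith [this.1, this.2]
      omega
  · intro m _
    refine (integrable_const (1:ℝ)).mono' ((ind_meas hS).comp (by fun_prop)).aestronglyMeasurable ?_
    exact Filter.Eventually.of_forall fun t => ind_le _ _


lemma geom_bound (z : ℂ) (hz : ‖z‖ = 1) (hz1 : z ≠ 1) (N : ℕ) : ‖∑ n ∈ Finset.range N, z ^ n‖ ≤ 2 / ‖z - 1‖ := by
  rw [geom_sum_eq hz1, norm_div]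
  gcongr
  refine (norm_sub_le _ _).trans ?_
  rw [norm_pow, hz]; norm_num

lemma sum_bound {S : Set (ℝ × ℝ)} (hS : MeasurableSet S) (hsub : S ⊆ Set.Ico (0:ℝ) 1 ×ˢ Set.Ico (0:ℝ) 1)
    {α : ℝ} (hc : Continuous (hfun S α)) (C : ℝ)
    (hF : ∀ k : ℤ, k ≠ 0 → ‖∫ p in S, Complex.exp (((-2 * Real.pi * (p.2 - α * p.1) * k : ℝ) : ℂ) * Complex.I)‖ ≤ C / (k:ℝ)^2)
    (hα : Irrational α)
    (hsum : Summable (fun k : ℤ => 1 / ((k:ℝ)^2 * ‖Complex.exp (2 * Real.pi * Complex.I * ((k * α : ℝ))) - 1‖))) :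
    ∃ K : ℝ, ∀ y : ℝ, ∀ N : ℕ, |∑ n ∈ Finset.range N, (∑' m : ℤ, hfun S α (y + n * α + m)) - N * (volume S).toReal| ≤ K := by
  set f : ℝ → ℂ := fun y => ((hfun S α y : ℝ) : ℂ) with hf
  have hF' : ∀ k : ℤ, k ≠ 0 → ‖𝓕 f k‖ ≤ C / (k:ℝ)^2 := by
    intro k hk
    rw [hfun_fourier hS hsub]; exact hF k hk
  have hF0 : 𝓕 f ((0:ℤ):ℝ) = ((volume S).toReal : ℂ) := by
    rw [hfun_fourier hS hsub]
    simp [Measure.real]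
  have hFs : Summable (fun k : ℤ => 𝓕 f k) := by
    have : Summable (fun k : ℤ => C * (1 / (k:ℝ)^2)) :=
      (Real.summable_one_div_int_pow.2 one_lt_two).mul_left C
    refine Summable.of_norm_bounded_eventually this ?_
    have h0 : ∀ᶠ k : ℤ in Filter.cofinite, k ≠ 0 := by
      rw [Filter.eventually_cofinite]; simp
    filter_upwards [h0] with k hk
    rw [mul_one_div]; exact hF' k hk
  have hbig : f =O[Filter.cocompact ℝ] fun x : ℝ => |x| ^ (-(2:ℝ)) := by
    have : f =ᶠ[Filter.cocompact ℝ] 0 := by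
      have ht := tendsto_norm_cocompact_atTop (E := ℝ)
      filter_upwards [ht.eventually_gt_atTop (1 + |α|)] with x hx
      simp only [hf, Pi.zero_apply, Complex.ofReal_eq_zero]
      exact hfun_zero hsub hx
    exact this.trans_isBigO (Asymptotics.isBigO_zero _ _)
  have hP := Real.tsum_eq_tsum_fourier_of_rpow_decay_of_summable (f := f) (by fun_prop) one_lt_two hbig hFs
  set z : ℤ → ℂ := fun k => Complex.exp (2 * Real.pi * Complex.I * ((k * α : ℝ))) with hzdef
  have hz : ∀ k, ‖z k‖ = 1 := by
    intro k
    simp only [hzdef]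
    rw [show (2 * Real.pi * Complex.I * ((k * α : ℝ)) : ℂ) = ((2 * Real.pi * (k * α) : ℝ) : ℂ) * Complex.I by push_cast; ring]
    exact Complex.norm_exp_ofReal_mul_I _
  have hz1 : ∀ k, k ≠ 0 → z k ≠ 1 := by
    intro k hk h
    simp only [hzdef] at h
    rw [Complex.exp_eq_one_iff] at h
    obtain ⟨n, hn⟩ := h
    have hI : (2 * Real.pi * Complex.I : ℂ) ≠ 0 := Complex.two_pi_I_ne_zero
    rw [mul_comm (n:ℂ)] at hn
    have := mul_left_cancel₀ hI hn
    have h4 : (k * α : ℝ) = n := by exact_mod_cast this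
    exact (hα.intCast_mul hk) ⟨n, by rw [h4]; simp⟩
  have hz0 : z 0 = 1 := by simp [hzdef]
  refine ⟨∑' k : ℤ, (2 * C) * (1 / ((k:ℝ)^2 * ‖z k - 1‖)), fun y N => ?_⟩
  have hE : ∀ (k : ℤ) (n : ℕ), fourier k (((y + n * α : ℝ)) : UnitAddCircle) = fourier k (y : UnitAddCircle) * z k ^ n := by
    intro k n
    rw [fourier_coe_apply, fourier_coe_apply, hzdef, ← Complex.exp_nat_mul, ← Complex.exp_add]
    congr 1; push_cast; ring
  have hE1 : ∀ k : ℤ, ‖fourier k (y : UnitAddCircle)‖ = 1 := fun k => by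
    rw [fourier_apply]; exact Circle.norm_coe _
  have hsm : ∀ n : ℕ, Summable (fun k : ℤ => 𝓕 f k * (fourier k (y : UnitAddCircle) * z k ^ n)) := by
    intro n
    refine Summable.of_norm ?_
    refine hFs.norm.congr fun k => ?_
    rw [norm_mul, norm_mul, hE1, norm_pow, hz]; simp
  have hmain : ((∑ n ∈ Finset.range N, (∑' m : ℤ, hfun S α (y + n * α + m)) - N * (volume S).toReal : ℝ) : ℂ) =
      ∑' k : ℤ, if k = 0 then 0 else 𝓕 f k * (fourier k (y : UnitAddCircle) * ∑ n ∈ Finset.range N, z k ^ n) := by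
    push_cast
    have : ∀ n : ℕ, ∑' m : ℤ, ((hfun S α (y + n * α + m) : ℝ) : ℂ) = ∑' k : ℤ, 𝓕 f k * (fourier k (y : UnitAddCircle) * z k ^ n) := by
      intro n
      have := hP (y + n * α)
      simp_rw [hE] at this
      exact this
    simp_rw [this]
    rw [← Summable.tsum_finsetSum (fun n _ => hsm n)]
    have hs2 : Summable (fun k : ℤ => ∑ n ∈ Finset.range N, 𝓕 f k * (fourier k (y : UnitAddCircle) * z k ^ n)) :=
      summable_sum (fun n _ => hsm n)
    rw [hs2.tsum_eq_add_tsum_ite 0, hF0, hz0]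
    simp only [fourier_zero, one_pow, mul_one, Finset.sum_const, Finset.card_range, nsmul_eq_mul, add_sub_cancel_left]
    refine tsum_congr fun k => ?_
    split_ifs
    · rfl
    · rw [Finset.mul_sum, Finset.mul_sum]
  rw [← Real.norm_eq_abs, ← Complex.norm_real, hmain]
  refine tsum_of_norm_bounded (hsum.mul_left (2 * C)).hasSum fun k => ?_
  split_ifs with hk
  · simp [hk]
  · rw [norm_mul, norm_mul, hE1, one_mul]
    calc _ ≤ C / (k:ℝ)^2 * (2 / ‖z k - 1‖) := by
          gcongr
          · exact (norm_nonneg _).trans (hF' k hk)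
          · exact hF' k hk
          · exact geom_bound _ (hz k) (hz1 k hk) N
      _ = _ := by rw [div_mul_div_comm, mul_one_div]; ring

lemma core {S : Set (ℝ × ℝ)} (hS : MeasurableSet S) (hsub : S ⊆ Set.Ico (0:ℝ) 1 ×ˢ Set.Ico (0:ℝ) 1)
    {α : ℝ} (x₁ x₂ : ℝ) (hx : x₁ ∈ Set.Ico (0:ℝ) 1)
    (hK : ∃ K : ℝ, ∀ y : ℝ, ∀ N : ℕ, |∑ n ∈ Finset.range N, (∑' m : ℤ, hfun S α (y + n * α + m)) - N * (volume S).toReal| ≤ K) :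
    IsBoundedRemainderSet S α x₁ x₂ := by
  obtain ⟨K, hK⟩ := hK
  set V := (volume S).toReal with hV
  have hV0 : 0 ≤ V := ENNReal.toReal_nonneg
  set y := x₂ - α * x₁ with hy
  set g : ℝ → ℝ := fun s => S.indicator (fun _ => (1:ℝ)) (Int.fract s, Int.fract (y + α * s)) with hg
  have hgm : Measurable g := (ind_meas hS).comp (by fun_prop)
  have hgb : ∀ s, ‖g s‖ ≤ 1 := fun s => ind_le _ _
  have hgi : ∀ a b, IntervalIntegrable g volume a b := by
    intro a b
    exact (intervalIntegrable_const (c := (1:ℝ))).mono_fun' hgm.aestronglyMeasurable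
      (Filter.Eventually.of_forall fun s => hgb s)
  have hunit : ∀ n : ℕ, ∫ s in (n:ℝ)..((n+1 : ℕ):ℝ), g s = ∑' m : ℤ, hfun S α (y + n * α + m) := by
    intro n
    have h1 := intervalIntegral.integral_comp_add_right (a := 0) (b := 1) g (n:ℝ)
    rw [zero_add, add_comm (1:ℝ)] at h1
    push_cast
    rw [← h1, ← hfun_unfold hS hsub, intervalIntegral.integral_of_le zero_le_one, integral_Ioc_eq_integral_Ioo]
    refine setIntegral_congr_fun measurableSet_Ioo fun t ht => ?_
    simp only [hg]
    have f1 : Int.fract (t + n) = t := by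
      rw [Int.fract_add_natCast, Int.fract_eq_self]; exact ⟨ht.1.le, ht.2⟩
    rw [f1, show y + α * (t + n) = y + n * α + α * t by ring]
  refine ⟨K + 3 + V, fun T hT => ?_⟩
  set N := ⌊T⌋₊
  have hN1 : (N:ℝ) ≤ T := Nat.floor_le hT.le
  have hN2 : T < N + 1 := Nat.lt_floor_add_one T
  have e1 : ∫ t in (0:ℝ)..T, S.indicator (fun _ => (1:ℝ)) (Int.fract (x₁ + t), Int.fract (x₂ + α * t)) = ∫ s in x₁..(x₁ + T), g s := by
    have h1 := intervalIntegral.integral_comp_add_left (a := 0) (b := T) g x₁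
    rw [add_zero] at h1
    rw [← h1]
    congr 1; ext t
    simp only [hg]
    rw [show y + α * (x₁ + t) = x₂ + α * t by rw [hy]; ring]
  have e2 : ∫ s in (0:ℝ)..N, g s = ∑ n ∈ Finset.range N, (∑' m : ℤ, hfun S α (y + n * α + m)) := by
    have := intervalIntegral.sum_integral_adjacent_intervals (f := g) (μ := volume) (a := fun n : ℕ => (n:ℝ)) (n := N)
      (fun k _ => hgi _ _)
    rw [Nat.cast_zero] at this
    rw [← this]
    exact Finset.sum_congr rfl fun n _ => hunit n
  have e3 : ∫ s in x₁..(x₁ + T), g s = (∫ s in (0:ℝ)..N, g s) + (∫ s in (N:ℝ)..(x₁ + T), g s) - ∫ s in (0:ℝ)..x₁, g s := by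
    rw [intervalIntegral.integral_add_adjacent_intervals (hgi _ _) (hgi _ _),
      ← intervalIntegral.integral_add_adjacent_intervals (hgi 0 x₁) (hgi x₁ (x₁ + T))]
    ring
  have b1 : |∫ s in (N:ℝ)..(x₁ + T), g s| ≤ 2 := by
    have := intervalIntegral.norm_integral_le_of_norm_le_const (a := (N:ℝ)) (b := x₁ + T) (C := 1) (f := g) (fun s _ => hgb s)
    rw [Real.norm_eq_abs, one_mul, abs_of_nonneg (by linarith [hx.1] : 0 ≤ x₁ + T - N)] at this
    linarith [hx.2]
  have b2 : |∫ s in (0:ℝ)..x₁, g s| ≤ 1 := by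
    have := intervalIntegral.norm_integral_le_of_norm_le_const (a := (0:ℝ)) (b := x₁) (C := 1) (f := g) (fun s _ => hgb s)
    rw [Real.norm_eq_abs, one_mul, sub_zero, abs_of_nonneg hx.1] at this
    linarith [hx.2]
  have b3 := hK y N
  rw [← e2] at b3
  rw [rotDelta, e1, e3]
  rw [abs_le] at *
  have b4 : N * V ≤ T * V := by gcongr
  have b5 : T * V ≤ N * V + V := by nlinarith
  constructor <;> linarith [b1.1, b1.2, b2.1, b2.2, b3.1, b3.2]

lemma cont_tri (v₀ v₁ v₂ : ℝ × ℝ) (α : ℝ) (hd : (v₁.1 - v₀.1) * (v₂.2 - v₀.2) - (v₁.2 - v₀.2) * (v₂.1 - v₀.1) ≠ 0)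
    (h1 : v₁.2 - v₀.2 ≠ α * (v₁.1 - v₀.1)) (h2 : v₂.2 - v₁.2 ≠ α * (v₂.1 - v₁.1))
    (h3 : v₀.2 - v₂.2 ≠ α * (v₀.1 - v₂.1)) (hS : MeasurableSet (tmap v₀ v₁ v₂ '' stdS))
    (hsub : tmap v₀ v₁ v₂ '' stdS ⊆ Set.Ico (0:ℝ) 1 ×ˢ Set.Ico (0:ℝ) 1) :
    Continuous (hfun (tmap v₀ v₁ v₂ '' stdS) α) := by
  refine hfun_cont hS hsub _ _ ?_ ?_ (fun p => mem_tri v₀ v₁ v₂ hd p) ?_ ?_ ?_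
  · fun_prop
  · fun_prop
  · intro y t ht s hs
    simp only [Set.mem_setOf_eq, div_eq_zero_iff, hd, or_false] at ht hs
    have : v₂.2 - v₀.2 - α * (v₂.1 - v₀.1) ≠ 0 := fun h => h3 (by linarith)
    apply mul_right_cancel₀ this
    linear_combination ht - hs
  · intro y t ht s hs
    simp only [Set.mem_setOf_eq, div_eq_zero_iff, hd, or_false] at ht hs
    have : v₁.2 - v₀.2 - α * (v₁.1 - v₀.1) ≠ 0 := fun h => h1 (by linarith)
    apply mul_right_cancel₀ this
    linear_combination hs - ht
  · intro y t ht s hs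
    simp only [Set.mem_setOf_eq, ← add_div, div_eq_one_iff_eq hd] at ht hs
    have : v₂.2 - v₁.2 - α * (v₂.1 - v₁.1) ≠ 0 := fun h => h2 (by linarith)
    apply mul_right_cancel₀ this
    linear_combination ht - hs

theorem statement1 :
    ∀ᵐ α : ℝ ∂volume, 0 < α →
      ∀ x₁ x₂ : ℝ, x₁ ∈ Set.Ico (0:ℝ) 1 → x₂ ∈ Set.Ico (0:ℝ) 1 →
      ∀ v₀ v₁ v₂ : ℝ × ℝ, ¬ Collinear ℝ ({v₀, v₁, v₂} : Set (ℝ × ℝ)) →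
        (convexHull ℝ ({v₀, v₁, v₂} : Set (ℝ × ℝ))) ⊆
          Set.Ico (0:ℝ) 1 ×ˢ Set.Ico (0:ℝ) 1 →
        -- no edge of the triangle has slope `α`
        v₁.2 - v₀.2 ≠ α * (v₁.1 - v₀.1) →
        v₂.2 - v₁.2 ≠ α * (v₂.1 - v₁.1) →
        v₀.2 - v₂.2 ≠ α * (v₀.1 - v₂.1) →
        IsBoundedRemainderSet (convexHull ℝ ({v₀, v₁, v₂} : Set (ℝ × ℝ))) α x₁ x₂ := by
  filter_upwards [ae_real] with α hα _ x₁ x₂ hx₁ hx₂ v₀ v₁ v₂ hcol hsub h1 h2 h3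
  have hd : (v₁.1 - v₀.1) * (v₂.2 - v₀.2) - (v₁.2 - v₀.2) * (v₂.1 - v₀.1) ≠ 0 := by
    intro hd
    apply hcol
    rw [collinear_iff_of_mem (p₀ := v₀) (by simp)]
    refine ⟨v₁ - v₀, ?_⟩
    have n1 : v₁.2 - v₀.2 - α * (v₁.1 - v₀.1) ≠ 0 := sub_ne_zero.2 h1
    rintro p (rfl | rfl | rfl)
    · exact ⟨0, by simp⟩
    · exact ⟨1, by simp⟩
    · refine ⟨(p.2 - v₀.2 - α * (p.1 - v₀.1)) / (v₁.2 - v₀.2 - α * (v₁.1 - v₀.1)), ?_⟩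
      ext
      · simp only [vadd_eq_add, Prod.fst_add, Prod.smul_fst, Prod.fst_sub, smul_eq_mul]
        rw [div_mul_eq_mul_div, ← sub_eq_iff_eq_add, eq_div_iff n1]
        linear_combination -hd
      · simp only [vadd_eq_add, Prod.snd_add, Prod.smul_snd, Prod.snd_sub, smul_eq_mul]
        rw [div_mul_eq_mul_div, ← sub_eq_iff_eq_add, eq_div_iff n1]
        linear_combination -α * hd
  have hS : MeasurableSet (convexHull ℝ ({v₀, v₁, v₂} : Set (ℝ × ℝ))) :=
    (Set.Finite.isCompact_convexHull ℝ (Set.toFinite _)).isClosed.measurableSet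
  rw [hull_eq] at hS hsub ⊢
  obtain ⟨C, hC⟩ := tri_fourier v₀ v₁ v₂ α hd h1 h2 h3
  exact core hS hsub x₁ x₂ hx₁ (sum_bound hS hsub (cont_tri v₀ v₁ v₂ α hd h1 h2 h3 hS hsub) C hC hα.1 hα.2)
end

section
/- For almost every α > 0 (with respect to Lebesgue measure) and every starting point x = (x₁, x₂) ∈ [0,1)², every convex set S ⊆ [0,1)² whose boundary ∂S is a twice continuously differentiable curve with strictly positive curvature at every point is a bounded remainder set for the continuous irrational rotation with slope α and starting point x. -/
open MeasureTheory

/-- The boundary of `S` is a closed twice continuously differentiable curve,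
parametrized by arc length (`|C'(s)| = 1` in the Euclidean norm), whose
curvature `κ(s) = |C''(s)|` is strictly positive at every point. -/
def HasC2PosCurvBoundary (S : Set (ℝ × ℝ)) : Prop :=
  ∃ (L : ℝ) (c₁ c₂ : ℝ → ℝ), 0 < L ∧
    ContDiff ℝ 2 c₁ ∧ ContDiff ℝ 2 c₂ ∧
    Function.Periodic c₁ L ∧ Function.Periodic c₂ L ∧
    (∀ s : ℝ, (deriv c₁ s) ^ 2 + (deriv c₂ s) ^ 2 = 1) ∧
    (∀ s : ℝ, 0 < (deriv (deriv c₁) s) ^ 2 + (deriv (deriv c₂) s) ^ 2) ∧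
    frontier S = Set.range (fun s => (c₁ s, c₂ s))


structure EdgeConcave (g : ℝ → ℝ) (a b C : ℝ) : Prop where
  conc : ConcaveOn ℝ (Set.Ioo a b) g
  nonneg : ∀ y, 0 ≤ g y
  zero : ∀ y, y ∉ Set.Ioo a b → g y = 0
  left : ∀ y ∈ Set.Ioo a b, g y ≤ C * √(y - a)
  right : ∀ y ∈ Set.Ioo a b, g y ≤ C * √(b - y)
  C_nonneg : 0 ≤ C

namespace EdgeConcave
variable {g : ℝ → ℝ} {a b C : ℝ}

lemma continuous (hg : EdgeConcave g a b C) : Continuous g := by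
  have key : ∀ e : ℝ, g e = 0 → (∀ y, g y ≤ C * √|y - e|) → ContinuousAt g e := by
    intro e he h
    rw [ContinuousAt, he]
    refine tendsto_of_tendsto_of_tendsto_of_le_of_le tendsto_const_nhds ?_ hg.nonneg h
    have : Continuous (fun y => C * √|y - e|) := by fun_prop
    simpa using this.tendsto e
  rw [continuous_iff_continuousAt]
  intro y
  by_cases hy : y ∈ Set.Ioo a b
  · exact (hg.conc.continuousOn isOpen_Ioo).continuousAt (isOpen_Ioo.mem_nhds hy)
  by_cases hya : y = a
  · subst hya
    refine key _ (hg.zero _ hy) fun z => ?_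
    by_cases hz : z ∈ Set.Ioo y b
    · rw [abs_of_pos (sub_pos.2 hz.1)]; exact hg.left z hz
    · rw [hg.zero _ hz]; have := hg.C_nonneg; positivity
  by_cases hyb : y = b
  · subst hyb
    refine key _ (hg.zero _ hy) fun z => ?_
    by_cases hz : z ∈ Set.Ioo a y
    · rw [abs_sub_comm, abs_of_pos (sub_pos.2 hz.2)]; exact hg.right z hz
    · rw [hg.zero _ hz]; have := hg.C_nonneg; positivity
  have : y ∉ Set.Icc a b := fun h =>
    hy ⟨lt_of_le_of_ne h.1 (Ne.symm hya), lt_of_le_of_ne h.2 hyb⟩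
  have h2 : g =ᶠ[nhds y] fun _ => 0 := by
    filter_upwards [isClosed_Icc.isOpen_compl.mem_nhds this] with z hz
    exact hg.zero z fun h => hz ⟨h.1.le, h.2.le⟩
  exact continuousAt_const.congr h2.symm

lemma compactSupport (hg : EdgeConcave g a b C) : HasCompactSupport g := by
  refine HasCompactSupport.intro (isCompact_Icc (a := a) (b := b)) fun y hy => ?_
  exact hg.zero y fun h => hy ⟨h.1.le, h.2.le⟩

lemma integrable (hg : EdgeConcave g a b C) : Integrable g :=
  hg.continuous.integrable_of_hasCompactSupport hg.compactSupport

lemma second_diff_le (hg : EdgeConcave g a b C) {h : ℝ} (hh : 0 < h) (y : ℝ) :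
    g (y + h) + g (y - h) - 2 * g y ≤
      (Set.Icc (a - h) (a + h)).indicator (fun _ => C * √(2 * h)) y +
      (Set.Icc (b - h) (b + h)).indicator (fun _ => C * √(2 * h)) y := by
  have hC := hg.C_nonneg
  have hM : 0 ≤ C * √(2 * h) := by positivity
  have i1 : 0 ≤ (Set.Icc (a - h) (a + h)).indicator (fun _ => C * √(2 * h)) y :=
    Set.indicator_nonneg (fun _ _ => hM) _
  have i2 : 0 ≤ (Set.Icc (b - h) (b + h)).indicator (fun _ => C * √(2 * h)) y :=
    Set.indicator_nonneg (fun _ _ => hM) _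
  have h0 := hg.nonneg y
  by_cases hm : y - h ∈ Set.Ioo a b <;> by_cases hp : y + h ∈ Set.Ioo a b
  · have := hg.conc.2 hm hp (show (0:ℝ) ≤ 1/2 by norm_num) (show (0:ℝ) ≤ 1/2 by norm_num) (by norm_num)
    simp only [smul_eq_mul] at this
    have e : 1 / 2 * (y - h) + 1 / 2 * (y + h) = y := by ring
    rw [e] at this
    linarith
  · have hb : b ≤ y + h := by
      by_contra hc
      exact hp ⟨by linarith [hm.1], not_le.1 hc⟩
    have hmem : y ∈ Set.Icc (b - h) (b + h) := ⟨by linarith, by linarith [hm.2]⟩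
    rw [Set.indicator_of_mem hmem, hg.zero _ hp]
    have h1 := hg.right _ hm
    have h2 : √(b - (y - h)) ≤ √(2 * h) := Real.sqrt_le_sqrt (by linarith)
    have := mul_le_mul_of_nonneg_left h2 hC
    linarith
  · have hb : y - h ≤ a := by
      by_contra hc
      exact hm ⟨not_le.1 hc, by linarith [hp.2]⟩
    have hmem : y ∈ Set.Icc (a - h) (a + h) := ⟨by linarith [hp.1], by linarith⟩
    rw [Set.indicator_of_mem hmem, hg.zero _ hm]
    have h1 := hg.left _ hp
    have h2 : √(y + h - a) ≤ √(2 * h) := Real.sqrt_le_sqrt (by linarith)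
    have := mul_le_mul_of_nonneg_left h2 hC
    linarith
  · rw [hg.zero _ hm, hg.zero _ hp]; linarith

lemma integral_abs_second_diff (hg : EdgeConcave g a b C) {h : ℝ} (hh : 0 < h) :
    ∫ y, |g (y + h) + g (y - h) - 2 * g y| ≤ 8 * h * (C * √(2 * h)) := by
  have hi := hg.integrable
  have hi1 : Integrable (fun y => g (y + h)) := hi.comp_add_right h
  have hi2 : Integrable (fun y => g (y - h)) := hi.comp_sub_right h
  have hD : Integrable (fun y => g (y + h) + g (y - h) - 2 * g y) :=
    (hi1.add hi2).sub (hi.const_mul 2)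
  have hD0 : ∫ y, (g (y + h) + g (y - h) - 2 * g y) = 0 := by
    have hi12 : Integrable (fun y => g (y + h) + g (y - h)) := hi1.add hi2
    rw [integral_sub hi12 (hi.const_mul 2), integral_add hi1 hi2,
      integral_add_right_eq_self g h, integral_sub_right_eq_self g h, integral_const_mul]
    ring
  have hC := hg.C_nonneg
  have hM : 0 ≤ C * √(2 * h) := by positivity
  set M := C * √(2 * h) with hMdef
  have hI : ∀ e : ℝ, Integrable ((Set.Icc (e - h) (e + h)).indicator (fun _ => M)) := fun e =>
    (integrable_indicator_iff measurableSet_Icc).2 (by simp)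
  have hIv : ∀ e : ℝ, ∫ y, (Set.Icc (e - h) (e + h)).indicator (fun _ => M) y = 2 * h * M := by
    intro e
    rw [integral_indicator measurableSet_Icc, setIntegral_const]
    rw [measureReal_def, Real.volume_Icc, ENNReal.toReal_ofReal (by linarith)]
    simp; left; ring
  calc ∫ y, |g (y + h) + g (y - h) - 2 * g y|
      ≤ ∫ y, (2 * ((Set.Icc (a - h) (a + h)).indicator (fun _ => M) y +
          (Set.Icc (b - h) (b + h)).indicator (fun _ => M) y) -
            (g (y + h) + g (y - h) - 2 * g y)) := by
        refine integral_mono hD.abs ((((hI a).add (hI b)).const_mul 2).sub hD) fun y => ?_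
        have h1 := hg.second_diff_le hh y
        have i1 : 0 ≤ (Set.Icc (a - h) (a + h)).indicator (fun _ => M) y :=
          Set.indicator_nonneg (fun _ _ => hM) _
        have i2 : 0 ≤ (Set.Icc (b - h) (b + h)).indicator (fun _ => M) y :=
          Set.indicator_nonneg (fun _ _ => hM) _
        simp only
        rw [abs_le]
        constructor <;> linarith
    _ = 8 * h * M := by
        have hab : Integrable (fun y => (Set.Icc (a - h) (a + h)).indicator (fun _ => M) y +
          (Set.Icc (b - h) (b + h)).indicator (fun _ => M) y) := (hI a).add (hI b)
        rw [integral_sub (hab.const_mul 2) hD, hD0, integral_const_mul,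
          integral_add (hI a) (hI b), hIv, hIv]
        ring

open FourierTransform in
lemma fourier_bound (hg : EdgeConcave g a b C) {m : ℤ} (hm : m ≠ 0) :
    ‖𝓕 (fun y => (g y : ℂ)) (m : ℝ)‖ ≤ C * |(m:ℝ)| ^ (-(3/2) : ℝ) := by
  have hm' : (m:ℝ) ≠ 0 := by exact_mod_cast hm
  have hmp : 0 < |(m:ℝ)| := abs_pos.2 hm'
  set h : ℝ := 1 / (2 * |(m:ℝ)|) with hh
  have hhp : 0 < h := by positivity
  set E : ℝ → ℂ := fun v => (Real.fourierChar (-(v * m)) : ℂ) with hE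
  have hEn : ∀ v, ‖E v‖ = 1 := fun v => Circle.norm_coe _
  have hEc : Continuous E := by simp only [hE]; fun_prop
  have hF : 𝓕 (fun y => (g y : ℂ)) (m : ℝ) = ∫ v, E v * g v := by
    rw [Real.fourier_real_eq]
    rfl
  have hEadd : ∀ v w, E (v + w) = E v * E w := by
    intro v w
    simp only [hE]
    rw [← Circle.coe_mul, ← AddChar.map_add_eq_mul]
    congr 2; ring
  have hhm : h * m = 1/2 ∨ h * m = -(1/2) := by
    rcases lt_or_gt_of_ne hm' with h1 | h1
    · right; rw [hh, abs_of_neg h1]; field_simp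
    · left; rw [hh, abs_of_pos h1]; field_simp
  have hEh : E h = -1 ∧ E (-h) = -1 := by
    have e1 : (Real.fourierChar (1/2) : ℂ) = -1 := by
      rw [Real.fourierChar_apply]
      push_cast
      rw [← Complex.exp_pi_mul_I]; congr 1; ring
    have e2 : (Real.fourierChar (-(1/2)) : ℂ) = -1 := by
      rw [AddChar.map_neg_eq_inv, Circle.coe_inv, e1]; norm_num
    simp only [hE, neg_mul, neg_neg]
    rcases hhm with h1 | h1 <;> rw [h1]
    · exact ⟨e2, e1⟩
    · rw [neg_neg]; exact ⟨e1, e2⟩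
  have hi : Integrable (fun v => (g v : ℂ)) := hg.integrable.ofReal
  have hEi : ∀ f : ℝ → ℂ, Integrable f → Integrable (fun v => E v * f v) := fun f hf =>
    hf.bdd_mul (c := 1) hEc.aestronglyMeasurable (Filter.Eventually.of_forall fun v => (hEn v).le)
  have s1 : ∫ v, E v * g (v + h) = - ∫ v, E v * g v := by
    rw [← integral_sub_right_eq_self _ h, ← integral_neg]
    congr 1; ext v
    rw [sub_eq_add_neg, hEadd, hEh.2]; simp
  have s2 : ∫ v, E v * g (v - h) = - ∫ v, E v * g v := by
    rw [← integral_add_right_eq_self _ h, ← integral_neg]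
    congr 1; ext v
    rw [hEadd, hEh.1]; simp
  have s3 : ∫ v, E v * ((g (v + h) + g (v - h) - 2 * g v : ℝ) : ℂ) = -4 * ∫ v, E v * g v := by
    have e : ∀ v, E v * ((g (v + h) + g (v - h) - 2 * g v : ℝ) : ℂ) =
        E v * g (v + h) + E v * g (v - h) - 2 * (E v * g v) := fun v => by push_cast; ring
    simp_rw [e]
    have j1 := hEi _ (hi.comp_add_right h)
    have j2 := hEi _ (hi.comp_sub_right h)
    have j3 := (hEi _ hi).const_mul 2
    have j12 : Integrable (fun v => E v * (g (v + h) : ℂ) + E v * (g (v - h) : ℂ)) := j1.add j2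
    rw [integral_sub j12 j3, integral_add j1 j2, integral_const_mul, s1, s2]
    ring
  have s4 : 4 * ‖∫ v, E v * g v‖ ≤ 8 * h * (C * √(2 * h)) := by
    calc 4 * ‖∫ v, E v * g v‖ = ‖∫ v, E v * ((g (v + h) + g (v - h) - 2 * g v : ℝ) : ℂ)‖ := by
          rw [s3, norm_mul]; norm_num
      _ ≤ ∫ v, ‖E v * ((g (v + h) + g (v - h) - 2 * g v : ℝ) : ℂ)‖ := norm_integral_le_integral_norm _
      _ = ∫ v, |g (v + h) + g (v - h) - 2 * g v| := by
          congr 1; ext v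
          rw [norm_mul, hEn, one_mul, Complex.norm_real, Real.norm_eq_abs]
      _ ≤ _ := hg.integral_abs_second_diff hhp
  rw [hF]
  have e1 : 2 * h = |(m:ℝ)|⁻¹ := by rw [hh]; field_simp
  have e2 : 8 * h * (C * √(2 * h)) = 4 * (C * (|(m:ℝ)|⁻¹ * √(|(m:ℝ)|⁻¹))) := by
    rw [← e1]; ring
  have e3 : |(m:ℝ)|⁻¹ * √(|(m:ℝ)|⁻¹) = |(m:ℝ)| ^ (-(3/2) : ℝ) := by
    rw [Real.sqrt_eq_rpow, Real.inv_rpow hmp.le, ← Real.rpow_neg hmp.le, ← Real.rpow_neg_one,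
      ← Real.rpow_add hmp]
    norm_num
  rw [e2, e3] at s4
  linarith

end EdgeConcave

lemma lintegral_norm_circle :
    ∫⁻ θ : UnitAddCircle, ENNReal.ofReal (‖θ‖ ^ (-(4/5) : ℝ)) < ⊤ := by
  have hmp := UnitAddCircle.measurePreserving_mk (-(1/2))
  have hm : Measurable (fun θ : UnitAddCircle => ENNReal.ofReal (‖θ‖ ^ (-(4/5) : ℝ))) := by
    fun_prop
  rw [← hmp.lintegral_comp hm]
  have h1 : IntegrableOn (fun x : ℝ => |x| ^ (-(4/5) : ℝ)) (Set.Ioc (-(1/2)) (-(1/2)+1)) := by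
    have e : (-(1/2) + 1 : ℝ) = 1/2 := by norm_num
    rw [e, ← Set.Ioc_union_Ioc_eq_Ioc (b := 0) (by norm_num) (by norm_num)]
    have h2 : IntervalIntegrable (fun x : ℝ => |x| ^ (-(4/5) : ℝ)) volume 0 (1/2) := by
      refine (intervalIntegral.intervalIntegrable_rpow' (r := (-(4/5))) (by norm_num)).congr ?_
      intro x hx
      rw [Set.uIoc_of_le (by norm_num)] at hx
      simp only [abs_of_pos hx.1]
    have h3 : IntervalIntegrable (fun x : ℝ => |x| ^ (-(4/5) : ℝ)) volume (-(1/2)) 0 := by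
      have := (IntervalIntegrable.iff_comp_neg (f := fun x : ℝ => |x| ^ (-(4/5) : ℝ))).1 h2
      simpa using this.symm
    rw [intervalIntegrable_iff_integrableOn_Ioc_of_le (by norm_num)] at h2 h3
    exact h3.union h2
  refine lt_of_le_of_lt (le_of_eq ?_) h1.lintegral_lt_top
  refine setLIntegral_congr_fun measurableSet_Ioc ?_
  intro x hx
  simp only
  have : ‖(x : UnitAddCircle)‖ = |x| := by
    rw [AddCircle.norm_coe_eq_abs_iff (p := (1:ℝ)) one_ne_zero, abs_one, abs_le]
    constructor
    · have := hx.1; norm_num at *; linarith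
    · have := hx.2; norm_num at *; linarith
  rw [this]

lemma dioph_circle : ∀ᵐ θ : UnitAddCircle,
    Summable (fun m : ℤ => |(m:ℝ)| ^ (-(6/5) : ℝ) * ‖m • θ‖ ^ (-(4/5) : ℝ)) := by
  have hm : Measurable (fun θ : UnitAddCircle => ENNReal.ofReal (‖θ‖ ^ (-(4/5) : ℝ))) := by
    fun_prop
  have key : ∫⁻ θ : UnitAddCircle, ∑' m : ℤ,
      ENNReal.ofReal (|(m:ℝ)| ^ (-(6/5) : ℝ) * ‖m • θ‖ ^ (-(4/5) : ℝ)) < ⊤ := by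
    rw [lintegral_tsum (fun m => by fun_prop)]
    have : ∀ m : ℤ, ∫⁻ θ : UnitAddCircle,
        ENNReal.ofReal (|(m:ℝ)| ^ (-(6/5) : ℝ) * ‖m • θ‖ ^ (-(4/5) : ℝ)) =
        ENNReal.ofReal (|(m:ℝ)| ^ (-(6/5) : ℝ)) *
          ∫⁻ θ : UnitAddCircle, ENNReal.ofReal (‖θ‖ ^ (-(4/5) : ℝ)) := by
      intro m
      rcases eq_or_ne m 0 with rfl | h
      · simp [Real.zero_rpow]
      · simp_rw [ENNReal.ofReal_mul (Real.rpow_nonneg (abs_nonneg (m:ℝ)) _)]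
        rw [lintegral_const_mul _ (by fun_prop)]
        congr 1
        exact (Measure.measurePreserving_zsmul (volume : Measure UnitAddCircle) h).lintegral_comp hm
    simp_rw [this]
    rw [ENNReal.tsum_mul_right]
    refine ENNReal.mul_lt_top ?_ lintegral_norm_circle
    exact (Real.summable_abs_int_rpow (by norm_num)).tsum_ofReal_lt_top
  filter_upwards [ae_lt_top (by fun_prop) key.ne] with θ hθ
  have := ENNReal.summable_toReal hθ.ne
  refine this.congr fun m => ?_
  rw [ENNReal.toReal_ofReal (by positivity)]

lemma dioph_circle' {θ : UnitAddCircle}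
    (h : Summable (fun m : ℤ => |(m:ℝ)| ^ (-(6/5) : ℝ) * ‖m • θ‖ ^ (-(4/5) : ℝ))) :
    Summable (fun m : ℤ => |(m:ℝ)| ^ (-(3/2) : ℝ) * ‖m • θ‖⁻¹) := by
  refine Summable.of_norm_bounded_eventually h ?_
  filter_upwards [h.tendsto_cofinite_zero.eventually_le_const (zero_lt_one)] with m hm
  set a := |(m:ℝ)| ^ (-(6/5) : ℝ) * ‖m • θ‖ ^ (-(4/5) : ℝ) with ha
  have ha0 : 0 ≤ a := by positivity
  have : |(m:ℝ)| ^ (-(3/2) : ℝ) * ‖m • θ‖⁻¹ = a ^ (5/4 : ℝ) := by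
    rw [ha, Real.mul_rpow (by positivity) (by positivity), ← Real.rpow_mul (by positivity),
      ← Real.rpow_mul (by positivity), ← Real.rpow_neg_one]
    norm_num
  rw [this, Real.norm_of_nonneg (by positivity)]
  calc a ^ (5/4 : ℝ) ≤ a ^ (1:ℝ) :=
        Real.rpow_le_rpow_of_exponent_ge_of_imp ha0 hm (by norm_num) (by norm_num)
    _ = a := Real.rpow_one a

lemma ae_real_of_ae_circle {P : UnitAddCircle → Prop} (h : ∀ᵐ θ, P θ) :
    ∀ᵐ α : ℝ, P (α : UnitAddCircle) := by
  have h1 : ∀ n : ℤ, ∀ᵐ α : ℝ ∂(volume.restrict (Set.Ioc (n:ℝ) (n+1))), P (α : UnitAddCircle) :=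
    fun n => (UnitAddCircle.measurePreserving_mk n).quasiMeasurePreserving.ae h
  have h2 := (ae_restrict_iUnion_iff (μ := (volume : Measure ℝ))
    (fun n : ℤ => Set.Ioc (n:ℝ) (n+1)) (fun α => P (α : UnitAddCircle))).2 h1
  rwa [iUnion_Ioc_intCast, Measure.restrict_univ] at h2

lemma norm_fourier_sub_one (θ : UnitAddCircle) (m : ℤ) :
    4 * ‖m • θ‖ ≤ ‖fourier m θ - 1‖ := by
  rw [fourier_apply]
  generalize m • θ = φ
  obtain ⟨x, hx, rfl⟩ : ∃ x : ℝ, |x| ≤ 1/2 ∧ (x : UnitAddCircle) = φ := by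
    obtain ⟨y, rfl⟩ := QuotientAddGroup.mk_surjective φ
    refine ⟨y - round y, by simpa using abs_sub_round y, ?_⟩
    rw [AddCircle.coe_sub]
    have : ((round y : ℝ) : UnitAddCircle) = 0 := by
      rw [AddCircle.coe_eq_zero_iff]; exact ⟨round y, by simp⟩
    rw [this, sub_zero]
  rw [(AddCircle.norm_coe_eq_abs_iff (p := (1:ℝ)) one_ne_zero).2 (by simpa using hx)]
  rw [AddCircle.toCircle_apply_mk, Circle.coe_exp, mul_comm _ Complex.I, Complex.norm_exp_I_mul_ofReal_sub_one]
  have e : 2 * Real.pi / 1 * x / 2 = Real.pi * x := by ring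
  rw [e, norm_mul, Real.norm_eq_abs, Real.norm_eq_abs, abs_two]
  have hpi := Real.pi_pos
  have h := Real.mul_abs_le_abs_sin (x := Real.pi * x) (by
    rw [abs_mul, abs_of_pos hpi]; nlinarith)
  rw [abs_mul Real.pi, abs_of_pos hpi, ← mul_assoc, div_mul_cancel₀ _ hpi.ne'] at h
  linarith

open FourierTransform in
lemma birkhoff_bound {g : ℝ → ℝ} {a b C α : ℝ} (hg : EdgeConcave g a b C)
    (hirr : ∀ m : ℤ, m ≠ 0 → m • (α : UnitAddCircle) ≠ 0)
    (hs : Summable (fun m : ℤ => |(m:ℝ)| ^ (-(3/2) : ℝ) * ‖m • (α : UnitAddCircle)‖⁻¹)) :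
    ∃ K : ℝ, ∀ (y : ℝ) (N : ℕ),
      |∑ n ∈ Finset.range N, ∑' k : ℤ, g (y + n * α + k) - N * ∫ v, g v| ≤ K := by
  set G : ℝ → ℂ := fun v => (g v : ℂ) with hG
  set c : ℤ → ℂ := fun m => 𝓕 G (m : ℝ) with hc
  have hC := hg.C_nonneg
  have hcs : Summable c := by
    refine Summable.of_norm_bounded_eventually
      ((Real.summable_abs_int_rpow (b := 3/2) (by norm_num)).mul_left C) ?_
    filter_upwards [(Set.finite_singleton (0:ℤ)).compl_mem_cofinite] with m hm
    exact hg.fourier_bound hm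
  have hc0 : c 0 = ((∫ v, g v : ℝ) : ℂ) := by
    simp only [hc, Int.cast_zero]
    rw [Real.fourier_real_eq, ← integral_complex_ofReal]
    congr 1; ext v; simp [hG]
  have hGc : Continuous G := Complex.continuous_ofReal.comp hg.continuous
  have hGO : G =O[Filter.cocompact ℝ] fun x : ℝ => |x| ^ (-(2:ℝ)) := by
    have h1 := hasCompactSupport_iff_eventuallyEq.1 hg.compactSupport
    rw [Filter.coclosedCompact_eq_cocompact] at h1
    have h2 : G =ᶠ[Filter.cocompact ℝ] fun _ => 0 := by
      filter_upwards [h1] with x hx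
      simp only [hG, hx]; simp
    exact h2.trans_isBigO (Asymptotics.isBigO_zero _ _)
  have poisson : ∀ y : ℝ, ((∑' k : ℤ, g (y + k) : ℝ) : ℂ) =
      ∑' m : ℤ, c m * fourier m (y : UnitAddCircle) := by
    intro y
    rw [← Real.tsum_eq_tsum_fourier_of_rpow_decay_of_summable hGc one_lt_two hGO hcs y,
      Complex.ofReal_tsum]
  have hfn : ∀ (m : ℤ) (θ : UnitAddCircle), ‖fourier m θ‖ = 1 := fun m θ => Circle.norm_coe _
  set d : ℤ → ℂ := fun m => if m = 0 then 0 else c m / (fourier m (α : UnitAddCircle) - 1) with hd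
  have hds : Summable (fun m => ‖d m‖) := by
    refine Summable.of_nonneg_of_le (fun _ => norm_nonneg _) ?_ (hs.mul_left C)
    intro m
    rcases eq_or_ne m 0 with rfl | hm
    · simp [hd]
    · simp only [hd, if_neg hm, norm_div]
      have h1 := norm_fourier_sub_one (α : UnitAddCircle) m
      have h2 : 0 < ‖m • (α : UnitAddCircle)‖ := norm_pos_iff.2 (hirr m hm)
      have h3 := hg.fourier_bound hm
      rw [div_eq_mul_inv, ← mul_assoc]
      refine mul_le_mul h3 ?_ (by positivity) (by positivity)
      exact inv_anti₀ h2 (by linarith)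
  set B : ℝ → ℂ := fun y => ∑' m : ℤ, d m * fourier m (y : UnitAddCircle) with hB
  have hBn : ∀ y : ℝ, Summable (fun m : ℤ => ‖d m * fourier m (y : UnitAddCircle)‖) := by
    intro y
    refine hds.congr fun m => ?_
    rw [norm_mul, hfn, mul_one]
  have hBb : ∀ y, ‖B y‖ ≤ ∑' m, ‖d m‖ := by
    intro y
    refine (norm_tsum_le_tsum_norm (hBn y)).trans (le_of_eq ?_)
    refine tsum_congr fun m => ?_
    rw [norm_mul, hfn, mul_one]
  have hcob : ∀ y : ℝ, ((∑' k : ℤ, g (y + k) : ℝ) : ℂ) - ((∫ v, g v : ℝ) : ℂ) =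
      B (y + α) - B y := by
    intro y
    have hsum : Summable (fun m : ℤ => c m * fourier m (y : UnitAddCircle)) := by
      refine Summable.of_norm (hcs.norm.congr fun m => ?_)
      rw [norm_mul, hfn, mul_one]
    rw [poisson, ← hc0]
    have e0 : c 0 = ∑' m : ℤ, (if m = 0 then c 0 else 0) := by simp
    rw [e0, ← hsum.tsum_sub (summable_of_hasFiniteSupport
      ((Set.finite_singleton (0:ℤ)).subset (by intro m; simp; tauto)))]
    simp only [hB]
    rw [← (hBn (y + α)).of_norm.tsum_sub (hBn y).of_norm]
    refine tsum_congr fun m => ?_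
    rcases eq_or_ne m 0 with rfl | hm
    · simp [hd]
    · have h2 : fourier m (α : UnitAddCircle) - 1 ≠ 0 := by
        have h1 := norm_fourier_sub_one (α : UnitAddCircle) m
        have h2 : 0 < ‖m • (α : UnitAddCircle)‖ := norm_pos_iff.2 (hirr m hm)
        exact norm_pos_iff.1 (by linarith)
      simp only [hd, if_neg hm]
      have h3 : fourier m ((y + α : ℝ) : UnitAddCircle) =
          fourier m (y : UnitAddCircle) * fourier m (α : UnitAddCircle) := by
        rw [AddCircle.coe_add]
        simp only [fourier_apply, smul_add, AddCircle.toCircle_add, Circle.coe_mul]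
      rw [h3]
      field_simp
      ring
  refine ⟨2 * ∑' m, ‖d m‖, fun y N => ?_⟩
  have htel : ((∑ n ∈ Finset.range N, ∑' k : ℤ, g (y + n * α + k) - N * ∫ v, g v : ℝ) : ℂ) =
      B (y + N * α) - B y := by
    induction N with
    | zero => simp
    | succ N ih =>
      have h1 := hcob (y + N * α)
      have e : y + ((N + 1 : ℕ) : ℝ) * α = y + N * α + α := by push_cast; ring
      rw [Finset.sum_range_succ, e]
      rw [← sub_add_sub_cancel _ (B (y + N * α)), ← ih, ← h1]
      push_cast
      ring
  rw [← Real.norm_eq_abs, ← Complex.norm_real, htel]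
  have := norm_sub_le (B (y + N * α)) (B y)
  linarith [hBb (y + N * α), hBb y]

lemma line_exit {S : Set (ℝ × ℝ)} {q w : ℝ × ℝ} (hq : q ∈ interior S) :
    ∃ r : ℝ, 0 < r ∧ q + r • w ∈ S := by
  have hc : Continuous (fun r : ℝ => q + r • w) := by fun_prop
  have h1 : ∀ᶠ r in nhds (0:ℝ), q + r • w ∈ interior S := by
    refine hc.continuousAt.eventually_mem ?_
    simpa using isOpen_interior.mem_nhds hq
  have h2 : ∀ᶠ r in nhdsWithin (0:ℝ) (Set.Ioi 0), q + r • w ∈ interior S :=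
    h1.filter_mono nhdsWithin_le_nhds
  obtain ⟨r, hr, hr'⟩ := (h2.and self_mem_nhdsWithin).exists
  exact ⟨r, hr', interior_subset hr⟩

lemma local_quad {φ : ℝ → ℝ} (hφ : ContDiff ℝ 2 φ) {s₀ : ℝ} (h0 : φ s₀ = 0)
    (hnn : ∀ s, 0 ≤ φ s) (h2 : deriv (deriv φ) s₀ ≠ 0) :
    ∃ k > 0, ∀ᶠ s in nhds s₀, k * (s - s₀) ^ 2 ≤ φ s := by
  have hd : Differentiable ℝ φ := hφ.differentiable (by norm_num)
  have hd2 : Differentiable ℝ (deriv φ) := by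
    have : ContDiff ℝ (1 + 1) φ := by simpa [one_add_one_eq_two] using hφ
    exact ((contDiff_succ_iff_deriv.1 this).2.2).differentiable (by norm_num)
  have hmin : IsLocalMin φ s₀ := Filter.Eventually.of_forall fun s => by rw [h0]; exact hnn s
  have hd0 := hmin.deriv_eq_zero
  set K := deriv (deriv φ) s₀ with hK
  set ψ : ℝ → ℝ := fun s => φ s - K / 4 * (s - s₀) ^ 2 with hψ
  have hψ1 : deriv ψ = fun s => deriv φ s - K / 2 * (s - s₀) := by
    ext s
    have h : HasDerivAt ψ (deriv φ s - K / 4 * ((2:ℕ) * (s - s₀) ^ (2 - 1) * 1)) s :=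
      (hd s).hasDerivAt.sub ((((hasDerivAt_id s).sub_const s₀).pow 2).const_mul (K / 4))
    rw [h.deriv]; norm_num; ring
  have hψ2 : deriv (deriv ψ) s₀ = K / 2 := by
    rw [hψ1]
    have h : HasDerivAt (fun s => deriv φ s - K / 2 * (s - s₀)) (K - K / 2 * 1) s₀ :=
      (hd2 s₀).hasDerivAt.sub (((hasDerivAt_id s₀).sub_const s₀).const_mul (K / 2))
    rw [h.deriv]; ring
  have hψd : deriv ψ s₀ = 0 := by rw [hψ1]; simp [hd0]
  have hψc : ContinuousAt ψ s₀ := by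
    have : Continuous φ := hd.continuous
    have : Continuous ψ := by fun_prop
    exact this.continuousAt
  have hψ0 : ψ s₀ = 0 := by simp [hψ, h0]
  rcases lt_or_gt_of_ne h2 with hneg | hpos
  · exfalso
    have := isLocalMax_of_deriv_deriv_neg (f := ψ) (by rw [hψ2]; linarith) hψd hψc
    have h3 : ∀ᶠ s in nhdsWithin s₀ {s₀}ᶜ, ψ s ≤ ψ s₀ := this.filter_mono nhdsWithin_le_nhds
    obtain ⟨s, hs, hs'⟩ := (h3.and self_mem_nhdsWithin).exists
    rw [hψ0] at hs
    have h4 : 0 < (s - s₀) ^ 2 := by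
      have : s - s₀ ≠ 0 := sub_ne_zero.2 hs'
      positivity
    have h5 := hnn s
    simp only [hψ] at hs
    nlinarith
  · have := isLocalMin_of_deriv_deriv_pos (f := ψ) (by rw [hψ2]; linarith) hψd hψc
    refine ⟨K / 4, by linarith, ?_⟩
    filter_upwards [this] with s hs
    rw [hψ0] at hs
    simp only [hψ] at hs
    linarith

lemma edge_bound {S : Set (ℝ × ℝ)} (hbd : Bornology.IsBounded S) (hconv : Convex ℝ S)
    (hC : HasC2PosCurvBoundary S) (A B a : ℝ) (hB : B ≠ 0)
    (ha : IsGLB ((fun p : ℝ × ℝ => A * p.1 + B * p.2) '' S) a) :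
    ∃ p₀ C : ℝ, 0 ≤ C ∧ ∀ p ∈ S, |p.1 - p₀| ≤ C * √(A * p.1 + B * p.2 - a) := by
  obtain ⟨L, c₁, c₂, hL, hc₁, hc₂, hp₁, hp₂, hunit, hcurv, hfr⟩ := hC
  have hlc : Continuous (fun p : ℝ × ℝ => A * p.1 + B * p.2) := by fun_prop
  have hKc : IsCompact (closure S) := hbd.isCompact_closure
  have hKa : ∀ p ∈ closure S, a ≤ A * p.1 + B * p.2 := by
    have : closure S ⊆ {p : ℝ × ℝ | a ≤ A * p.1 + B * p.2} :=
      closure_minimal (fun p hp => ha.1 ⟨p, hp, rfl⟩) (isClosed_le continuous_const hlc)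
    exact fun p hp => this hp
  have hFK : ∀ s, (c₁ s, c₂ s) ∈ closure S := fun s =>
    frontier_subset_closure (hfr ▸ ⟨s, rfl⟩)
  -- frontier points come from the parameter interval
  have hpar : ∀ p ∈ frontier S, ∃ s ∈ Set.Icc 0 L, c₁ s = p.1 ∧ c₂ s = p.2 := by
    intro p hp
    rw [hfr] at hp
    obtain ⟨s, rfl⟩ := hp
    have hper : Function.Periodic (fun s => (c₁ s, c₂ s)) L := fun s => by
      simp only [hp₁ s, hp₂ s]
    obtain ⟨s', hs', he⟩ := hper.exists_mem_Ico₀ hL s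
    have h1 := congrArg Prod.fst he
    have h2 := congrArg Prod.snd he
    exact ⟨s', ⟨hs'.1, hs'.2.le⟩, h1.symm, h2.symm⟩
  -- minimal points are on the frontier
  have hminfr : ∀ p ∈ closure S, A * p.1 + B * p.2 = a → p ∈ frontier S := by
    intro p hp hpa
    refine ⟨hp, fun hpint => ?_⟩
    obtain ⟨r, hr, hmem⟩ := line_exit (w := (-A, -B)) hpint
    have h1 := hKa _ (subset_closure hmem)
    simp at h1
    have : 0 < r * (A ^ 2 + B ^ 2) := by positivity
    nlinarith
  set φ : ℝ → ℝ := fun s => A * c₁ s + B * c₂ s - a with hφ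
  have hφnn : ∀ s, 0 ≤ φ s := fun s => sub_nonneg.2 (hKa _ (hFK s))
  have hφC : ContDiff ℝ 2 φ := by simp only [hφ]; fun_prop
  have hd₁ : Differentiable ℝ c₁ := hc₁.differentiable (by norm_num)
  have hd₂ : Differentiable ℝ c₂ := hc₂.differentiable (by norm_num)
  have hdd : ∀ c : ℝ → ℝ, ContDiff ℝ 2 c → Differentiable ℝ (deriv c) := by
    intro c hc
    have : ContDiff ℝ (1 + 1) c := by simpa [one_add_one_eq_two] using hc
    exact ((contDiff_succ_iff_deriv.1 this).2.2).differentiable (by norm_num)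
  have hdd₁ := hdd c₁ hc₁
  have hdd₂ := hdd c₂ hc₂
  have hφ1 : deriv φ = fun s => A * deriv c₁ s + B * deriv c₂ s := by
    ext s
    exact ((((hd₁ s).hasDerivAt.const_mul A).add ((hd₂ s).hasDerivAt.const_mul B)).sub_const a).deriv
  have hφ2 : ∀ s, deriv (deriv φ) s = A * deriv (deriv c₁) s + B * deriv (deriv c₂) s := by
    intro s
    rw [hφ1]
    exact (((hdd₁ s).hasDerivAt.const_mul A).add ((hdd₂ s).hasDerivAt.const_mul B)).deriv
  have horth : ∀ s, deriv c₁ s * deriv (deriv c₁) s + deriv c₂ s * deriv (deriv c₂) s = 0 := by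
    intro s
    have h1 : HasDerivAt (fun s => (deriv c₁ s) ^ 2 + (deriv c₂ s) ^ 2)
        ((2:ℕ) * deriv c₁ s ^ (2 - 1) * deriv (deriv c₁) s +
          (2:ℕ) * deriv c₂ s ^ (2 - 1) * deriv (deriv c₂) s) s :=
      ((hdd₁ s).hasDerivAt.pow 2).add ((hdd₂ s).hasDerivAt.pow 2)
    have h2 : (fun s => (deriv c₁ s) ^ 2 + (deriv c₂ s) ^ 2) = fun _ => (1:ℝ) := funext hunit
    rw [h2] at h1
    have := h1.unique (hasDerivAt_const s (1:ℝ))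
    norm_num at this
    linarith
  have hloc : ∀ s₀, φ s₀ = 0 → ∃ k > 0, ∀ᶠ s in nhds s₀, k * (s - s₀) ^ 2 ≤ φ s := by
    intro s₀ h0
    refine local_quad hφC h0 hφnn ?_
    have hmin : IsLocalMin φ s₀ := Filter.Eventually.of_forall fun s => by rw [h0]; exact hφnn s
    have hd0 := hmin.deriv_eq_zero
    rw [hφ1] at hd0
    simp only at hd0
    rw [hφ2]
    intro hbad
    have o := horth s₀
    have u := hunit s₀
    have k := hcurv s₀
    generalize deriv c₁ s₀ = x at *
    generalize deriv c₂ s₀ = y at *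
    generalize deriv (deriv c₁) s₀ = X at *
    generalize deriv (deriv c₂) s₀ = Y at *
    have hdet : B * (x * Y - y * X) = 0 := by linear_combination x * hbad - X * hd0
    have hdet' : x * Y - y * X = 0 := (mul_eq_zero.1 hdet).resolve_left hB
    have : X ^ 2 + Y ^ 2 = 0 := by
      linear_combination (x * X + y * Y) * o + (x * Y - y * X) * hdet' - (X ^ 2 + Y ^ 2) * u
    linarith
  have hφc : Continuous φ := hφC.continuous
  -- the zero set is finite
  set Z : Set ℝ := {s | s ∈ Set.Icc 0 L ∧ φ s = 0} with hZ
  have hZfin : Z.Finite := by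
    by_contra hinf
    obtain ⟨s₀, _, hacc⟩ := Set.Infinite.exists_accPt_of_subset_isCompact hinf
      (isCompact_Icc (a := (0:ℝ)) (b := L)) (fun s hs => hs.1)
    have hfreq := accPt_iff_frequently_nhdsNE.1 hacc
    have hz : φ s₀ = 0 := by
      have hcl : IsClosed {s | φ s = 0} := isClosed_eq hφc continuous_const
      have : s₀ ∈ closure {s | φ s = 0} := by
        rw [mem_closure_iff_frequently]
        exact (hfreq.filter_mono nhdsWithin_le_nhds).mono fun s hs => hs.2
      rwa [hcl.closure_eq] at this
    obtain ⟨k, hk, hev⟩ := hloc s₀ hz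
    have hev' : ∀ᶠ s in nhdsWithin s₀ {s₀}ᶜ, k * (s - s₀) ^ 2 ≤ φ s :=
      hev.filter_mono nhdsWithin_le_nhds
    obtain ⟨s, hsZ, hs1, hs2⟩ := (hfreq.and_eventually (hev'.and self_mem_nhdsWithin)).exists
    rw [hsZ.2] at hs1
    have : s - s₀ ≠ 0 := sub_ne_zero.2 hs2
    have : 0 < k * (s - s₀) ^ 2 := by positivity
    linarith
  -- all minimal points have the same first coordinate
  have huniq : ∀ s s', φ s = 0 → φ s' = 0 → c₁ s = c₁ s' := by
    intro s s' hs hs'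
    by_contra hne
    have hinf : (c₁ '' Z).Infinite := by
      refine Set.infinite_of_injOn_mapsTo (s := Set.Icc (0:ℝ) 1)
        (f := fun t => c₁ s + t * (c₁ s' - c₁ s)) ?_ ?_ (Set.Icc_infinite zero_lt_one)
      · intro t _ t' _ h
        simp only at h
        have h3 : (t - t') * (c₁ s' - c₁ s) = 0 := by linarith
        rcases mul_eq_zero.1 h3 with h4 | h4
        · linarith
        · exact absurd (by linarith) hne
      · intro t ht
        have hmem := hconv.closure.add_smul_sub_mem (hFK s) (hFK s') ht
        obtain ⟨s'', hs'', e1, e2⟩ := hpar _ (hminfr _ hmem (by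
          simp [hφ] at hs hs' ⊢
          linear_combination (1 - t) * hs + t * hs'))
        refine ⟨s'', ⟨hs'', ?_⟩, ?_⟩
        · simp [hφ] at hs hs' e1 e2 ⊢
          rw [e1, e2]
          linear_combination (1 - t) * hs + t * hs'
        · simpa using e1
    exact hinf (hZfin.image _)
  -- a minimal point exists
  obtain ⟨s₀, hs₀⟩ : ∃ s, φ s = 0 := by
    have hne : (closure S).Nonempty := ⟨_, hFK 0⟩
    obtain ⟨q, hq, hqm⟩ := hKc.exists_isMinOn hne hlc.continuousOn
    have hqa : A * q.1 + B * q.2 = a := by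
      refine le_antisymm ?_ (hKa q hq)
      refine ha.2 ?_
      rintro _ ⟨p, hp, rfl⟩
      exact hqm (subset_closure hp)
    obtain ⟨s, _, e1, e2⟩ := hpar q (hminfr q hq hqa)
    exact ⟨s, by simp only [hφ]; rw [e1, e2, hqa, sub_self]⟩
  set p₀ := c₁ s₀ with hp₀
  have hlip : ∀ s s', |c₁ s - c₁ s'| ≤ |s - s'| := by
    intro s s'
    have := Convex.norm_image_sub_le_of_norm_deriv_le (f := c₁) (C := 1) (s := Set.univ)
      (x := s') (y := s) (fun x _ => hd₁ x) (fun x _ => by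
        rw [Real.norm_eq_abs, abs_le_one_iff_mul_self_le_one]
        nlinarith [hunit x, sq_nonneg (deriv c₂ x)]) convex_univ trivial trivial
    simpa using this
  obtain ⟨k, hk, hquad⟩ : ∃ k > 0, ∀ s ∈ Set.Icc 0 L, k * (c₁ s - p₀) ^ 2 ≤ φ s := by
    refine (isCompact_Icc (a := (0:ℝ)) (b := L)).induction_on
      (p := fun U => ∃ k > 0, ∀ s ∈ U, k * (c₁ s - p₀) ^ 2 ≤ φ s) ⟨1, one_pos, by simp⟩ ?_ ?_ ?_
    · rintro U V hUV ⟨k, hk, h⟩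
      exact ⟨k, hk, fun s hs => h s (hUV hs)⟩
    · rintro U V ⟨k, hk, h⟩ ⟨k', hk', h'⟩
      refine ⟨min k k', lt_min hk hk', ?_⟩
      rintro s (hs | hs)
      · exact (mul_le_mul_of_nonneg_right (min_le_left _ _) (sq_nonneg _)).trans (h s hs)
      · exact (mul_le_mul_of_nonneg_right (min_le_right _ _) (sq_nonneg _)).trans (h' s hs)
    · intro s₁ _
      by_cases hz : φ s₁ = 0
      · obtain ⟨k, hk, hev⟩ := hloc s₁ hz
        refine ⟨_, mem_nhdsWithin_of_mem_nhds hev, k, hk, fun s hs => ?_⟩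
        refine le_trans ?_ hs
        rw [hp₀, huniq s₀ s₁ hs₀ hz]
        exact mul_le_mul_of_nonneg_left (sq_le_sq.2 (hlip s s₁)) hk.le
      · have hpos : 0 < φ s₁ := lt_of_le_of_ne (hφnn s₁) (Ne.symm hz)
        have hc : Continuous (fun s => (c₁ s - p₀) ^ 2) := by
          have := hd₁.continuous
          fun_prop
        set M := (c₁ s₁ - p₀) ^ 2 + 1 with hM
        have hMp : 0 < M := by positivity
        have e1 : ∀ᶠ s in nhds s₁, (c₁ s - p₀) ^ 2 < M :=
          hc.continuousAt.eventually_lt_const (by simp [hM])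
        have e2 : ∀ᶠ s in nhds s₁, φ s₁ / 2 < φ s :=
          hφc.continuousAt.eventually_const_lt (by linarith)
        refine ⟨_, mem_nhdsWithin_of_mem_nhds (e1.and e2), φ s₁ / 2 / M, by positivity,
          fun s hs => ?_⟩
        have h1 : φ s₁ / 2 / M * (c₁ s - p₀) ^ 2 ≤ φ s₁ / 2 / M * M :=
          mul_le_mul_of_nonneg_left hs.1.le (by positivity)
        rw [div_mul_cancel₀ _ hMp.ne'] at h1
        linarith [hs.2]
  have hfrb : ∀ q ∈ frontier S, |q.1 - p₀| ≤ √(1 / k) * √(A * q.1 + B * q.2 - a) := by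
    intro q hq
    obtain ⟨s, hs, e1, e2⟩ := hpar q hq
    have := hquad s hs
    simp only [hφ] at this
    rw [e1, e2] at this
    rw [← Real.sqrt_mul (by positivity)]
    refine Real.abs_le_sqrt ?_
    rw [one_div, inv_mul_eq_div, le_div_iff₀ hk]
    linarith
  refine ⟨p₀, √(1 / k), by positivity, fun p hp => ?_⟩
  -- chord through `p`
  have hw : ∀ r : ℝ, A * (p + r • (B, -A)).1 + B * (p + r • (B, -A)).2 = A * p.1 + B * p.2 := by
    intro r; simp; ring
  set R : Set ℝ := {r : ℝ | p + r • ((B, -A) : ℝ × ℝ) ∈ closure S} with hR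
  have hRclosed : IsClosed R := isClosed_closure.preimage (by fun_prop)
  have h0R : (0:ℝ) ∈ R := by
    change p + (0:ℝ) • ((B, -A) : ℝ × ℝ) ∈ closure S
    rw [zero_smul, add_zero]
    exact subset_closure hp
  have hRb : Bornology.IsBounded R := by
    obtain ⟨D, hD⟩ := hKc.isBounded.exists_norm_le
    rw [isBounded_iff_forall_norm_le]
    refine ⟨(D + ‖p.1‖) / ‖B‖, fun r hr => ?_⟩
    have h1 := hD _ hr
    have h2 : ‖p.1 + r * B‖ ≤ D := by
      refine le_trans ?_ h1
      have := norm_fst_le (p + r • ((B, -A) : ℝ × ℝ))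
      simpa using this
    have h3 : ‖r * B‖ ≤ D + ‖p.1‖ := by
      have := norm_sub_le (p.1 + r * B) p.1
      rw [add_sub_cancel_left] at this
      linarith
    rw [norm_mul] at h3
    rwa [le_div_iff₀ (norm_pos_iff.2 hB)]
  have hRc : IsCompact R := Metric.isCompact_of_isClosed_isBounded hRclosed hRb
  obtain ⟨r₂, hr₂, hmax⟩ := hRc.exists_isMaxOn ⟨0, h0R⟩ continuousOn_id
  obtain ⟨r₁, hr₁, hmin⟩ := hRc.exists_isMinOn ⟨0, h0R⟩ continuousOn_id
  have hf₂ : p + r₂ • ((B, -A) : ℝ × ℝ) ∈ frontier S := by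
    refine ⟨hr₂, fun hpint => ?_⟩
    obtain ⟨r, hr, hm⟩ := line_exit (w := (B, -A)) hpint
    have : r₂ + r ∈ R := by
      simp only [hR, Set.mem_ofPred_eq, add_smul, ← add_assoc]
      exact subset_closure hm
    have := hmax this
    simp at this
    linarith
  have hf₁ : p + r₁ • ((B, -A) : ℝ × ℝ) ∈ frontier S := by
    refine ⟨hr₁, fun hpint => ?_⟩
    obtain ⟨r, hr, hm⟩ := line_exit (w := -(B, -A)) hpint
    have : r₁ + -r ∈ R := by
      simp only [hR, Set.mem_ofPred_eq, add_smul, ← add_assoc]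
      refine subset_closure ?_
      simpa using hm
    have := hmin this
    simp at this
    linarith
  have h1 : r₁ ≤ 0 := hmin h0R
  have h2 : 0 ≤ r₂ := hmax h0R
  have b1 := hfrb _ hf₁
  have b2 := hfrb _ hf₂
  rw [hw] at b1 b2
  generalize √(1 / k) * √(A * p.1 + B * p.2 - a) = W at b1 b2 ⊢
  rw [abs_le] at b1 b2 ⊢
  simp only [Prod.fst_add, Prod.smul_fst, smul_eq_mul] at b1 b2
  rcases lt_or_gt_of_ne hB with hB' | hB'
  · constructor <;> nlinarith
  · constructor <;> nlinarith

/-- The set of times at which the line with slope `α` and intercept `y` is in `S`. -/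
def chordSet (S : Set (ℝ × ℝ)) (α y : ℝ) : Set ℝ := {t | (t, y + α * t) ∈ S}

/-- The duration of the chord cut out of `S` by the line with slope `α` and intercept `y`. -/
noncomputable def chordLen (S : Set (ℝ × ℝ)) (α y : ℝ) : ℝ := (volume (chordSet S α y)).toReal

lemma volume_convex_real {A : Set ℝ} (hA : Convex ℝ A) (hne : A.Nonempty)
    (hb : A ⊆ Set.Ico 0 1) : (volume A).toReal = sSup A - sInf A := by
  have hba : BddAbove A := ⟨1, fun x hx => (hb hx).2.le⟩
  have hbb : BddBelow A := ⟨0, fun x hx => (hb hx).1⟩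
  have h1 : Set.Ioo (sInf A) (sSup A) ⊆ A := by
    intro x hx
    obtain ⟨u, hu, hu'⟩ := exists_lt_of_csInf_lt hne hx.1
    obtain ⟨v, hv, hv'⟩ := exists_lt_of_lt_csSup hne hx.2
    exact hA.ordConnected.out hu hv ⟨hu'.le, hv'.le⟩
  have h2 : A ⊆ Set.Icc (sInf A) (sSup A) := fun x hx => ⟨csInf_le hbb hx, le_csSup hba hx⟩
  have h3 : volume A = ENNReal.ofReal (sSup A - sInf A) := by
    refine le_antisymm ?_ ?_
    · rw [← Real.volume_Icc]; exact measure_mono h2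
    · rw [← Real.volume_Ioo]; exact measure_mono h1
  rw [h3, ENNReal.toReal_ofReal (sub_nonneg.2 (hne.elim fun x hx => (csInf_le hbb hx).trans (le_csSup hba hx)))]

lemma brunn_real {A B T : Set ℝ} (hA : Convex ℝ A) (hB : Convex ℝ B) (hT : Convex ℝ T)
    (hAne : A.Nonempty) (hBne : B.Nonempty) (hAb : A ⊆ Set.Ico 0 1) (hBb : B ⊆ Set.Ico 0 1)
    (hTb : T ⊆ Set.Ico 0 1) {u v : ℝ} (hu : 0 ≤ u) (hv : 0 ≤ v)
    (hsub : ∀ x ∈ A, ∀ y ∈ B, u * x + v * y ∈ T) :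
    u * (volume A).toReal + v * (volume B).toReal ≤ (volume T).toReal := by
  have bA : BddAbove A := ⟨1, fun x hx => (hAb hx).2.le⟩
  have bA' : BddBelow A := ⟨0, fun x hx => (hAb hx).1⟩
  have bB : BddAbove B := ⟨1, fun x hx => (hBb hx).2.le⟩
  have bB' : BddBelow B := ⟨0, fun x hx => (hBb hx).1⟩
  have bT : BddAbove T := ⟨1, fun x hx => (hTb hx).2.le⟩
  have bT' : BddBelow T := ⟨0, fun x hx => (hTb hx).1⟩
  have hTne : T.Nonempty := by
    obtain ⟨x, hx⟩ := hAne
    obtain ⟨y, hy⟩ := hBne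
    exact ⟨_, hsub x hx y hy⟩
  rw [volume_convex_real hA hAne hAb, volume_convex_real hB hBne hBb,
    volume_convex_real hT hTne hTb]
  open Pointwise in
  have hs : u • A + v • B ⊆ T := by
    rintro _ ⟨_, ⟨x, hx, rfl⟩, _, ⟨y, hy, rfl⟩, rfl⟩
    exact hsub x hx y hy
  open Pointwise in
  have h1 : u * sSup A + v * sSup B ≤ sSup T := by
    have := csSup_le_csSup bT (hAne.smul_set.add hBne.smul_set) hs
    rw [csSup_add hAne.smul_set (bA.smul_of_nonneg hu) hBne.smul_set (bB.smul_of_nonneg hv),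
      Real.sSup_smul_of_nonneg hu, Real.sSup_smul_of_nonneg hv] at this
    simpa using this
  open Pointwise in
  have h2 : sInf T ≤ u * sInf A + v * sInf B := by
    have := csInf_le_csInf bT' (hAne.smul_set.add hBne.smul_set) hs
    rw [csInf_add hAne.smul_set (bA'.smul_of_nonneg hu) hBne.smul_set (bB'.smul_of_nonneg hv),
      Real.sInf_smul_of_nonneg hu, Real.sInf_smul_of_nonneg hv] at this
    simpa using this
  linarith

section chords
variable {S : Set (ℝ × ℝ)} {α : ℝ}

lemma chordSet_comb (hS : Convex ℝ S) {y y' t t' u v : ℝ} (hu : 0 ≤ u) (hv : 0 ≤ v)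
    (huv : u + v = 1) (ht : t ∈ chordSet S α y) (ht' : t' ∈ chordSet S α y') :
    u * t + v * t' ∈ chordSet S α (u * y + v * y') := by
  have := hS ht ht' hu hv huv
  simp only [chordSet, Set.mem_ofPred_eq]
  convert this using 1
  ext <;> simp
  ring

lemma chordSet_convex (hS : Convex ℝ S) (y : ℝ) : Convex ℝ (chordSet S α y) := by
  intro t ht t' ht' u v hu hv huv
  have := chordSet_comb hS hu hv huv ht ht'
  rwa [← add_mul, huv, one_mul] at this

lemma chordSet_subset (hsub : S ⊆ Set.Ico (0:ℝ) 1 ×ˢ Set.Ico (0:ℝ) 1) (y : ℝ) :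
    chordSet S α y ⊆ Set.Ico 0 1 := fun _ ht => (hsub ht).1

lemma chordSet_measurable (hS : Convex ℝ S) (y : ℝ) : MeasurableSet (chordSet S α y) :=
  (chordSet_convex hS y).ordConnected.measurableSet

lemma chordSet_volume_ne_top (hsub : S ⊆ Set.Ico (0:ℝ) 1 ×ˢ Set.Ico (0:ℝ) 1) (y : ℝ) :
    volume (chordSet S α y) ≠ ⊤ :=
  ((measure_mono (chordSet_subset hsub y)).trans_lt (by simp)).ne

lemma chordLen_edgeConcave (hsub : S ⊆ Set.Ico (0:ℝ) 1 ×ˢ Set.Ico (0:ℝ) 1)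
    (hS : Convex ℝ S) (hC : HasC2PosCurvBoundary S) :
    ∃ a b C, EdgeConcave (chordLen S α) a b C := by
  have hbd : Bornology.IsBounded S :=
    ((Metric.isBounded_Ico 0 1).prod (Metric.isBounded_Ico 0 1)).subset hsub
  have hne : S.Nonempty := by
    obtain ⟨L, c₁, c₂, -, -, -, -, -, -, -, hfr⟩ := hC
    by_contra h
    rw [Set.not_nonempty_iff_eq_empty] at h
    rw [h, frontier_empty] at hfr
    have : (c₁ 0, c₂ 0) ∈ (∅ : Set (ℝ × ℝ)) := hfr ▸ ⟨0, rfl⟩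
    exact this
  set J : Set ℝ := (fun p : ℝ × ℝ => -α * p.1 + 1 * p.2) '' S with hJ
  have hJmem : ∀ y, y ∈ J ↔ (chordSet S α y).Nonempty := by
    intro y
    constructor
    · rintro ⟨p, hp, rfl⟩
      refine ⟨p.1, ?_⟩
      simp only [chordSet, Set.mem_ofPred_eq]
      convert hp using 1
      ext <;> simp
    · rintro ⟨t, ht⟩
      exact ⟨_, ht, by simp⟩
  have hJne : J.Nonempty := hne.image _
  have hJc : Convex ℝ J := by
    intro y hy y' hy' u v hu hv huv
    rw [hJmem] at *
    obtain ⟨t, ht⟩ := hy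
    obtain ⟨t', ht'⟩ := hy'
    exact ⟨_, chordSet_comb hS hu hv huv ht ht'⟩
  have hJb : BddBelow J ∧ BddAbove J := by
    have hc : Continuous (fun p : ℝ × ℝ => -α * p.1 + 1 * p.2) := by fun_prop
    have h1 : IsCompact ((fun p : ℝ × ℝ => -α * p.1 + 1 * p.2) '' closure S) :=
      hbd.isCompact_closure.image hc
    have h2 : J ⊆ (fun p : ℝ × ℝ => -α * p.1 + 1 * p.2) '' closure S :=
      Set.image_mono subset_closure
    exact ⟨h1.bddBelow.mono h2, h1.bddAbove.mono h2⟩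
  set a := sInf J with ha
  set b := sSup J with hb
  have hglb : IsGLB J a := isGLB_csInf hJne hJb.1
  have hlub : IsLUB J b := isLUB_csSup hJne hJb.2
  have hglb' : IsGLB ((fun p : ℝ × ℝ => α * p.1 + (-1) * p.2) '' S) (-b) := by
    have e : (fun p : ℝ × ℝ => α * p.1 + (-1) * p.2) '' S = -J := by
      rw [hJ, ← Set.image_neg_eq_neg, Set.image_image]
      congr 1; ext p; ring
    rw [e]
    exact isGLB_neg'.2 hlub |> fun h => by simpa using h
  obtain ⟨p₁, C₁, hC₁, hb₁⟩ := edge_bound hbd hS hC (-α) 1 a one_ne_zero hglb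
  obtain ⟨p₂, C₂, hC₂, hb₂⟩ := edge_bound hbd hS hC α (-1) (-b) (by norm_num) hglb'
  have hlen : ∀ (y p W : ℝ), 0 ≤ W → (∀ t ∈ chordSet S α y, |t - p| ≤ W) →
      chordLen S α y ≤ 2 * W := by
    intro y p W hW h
    have h1 : chordSet S α y ⊆ Set.Icc (p - W) (p + W) := by
      intro t ht
      have := abs_le.1 (h t ht)
      exact ⟨by linarith, by linarith⟩
    have h2 := ENNReal.toReal_mono (by simp) (measure_mono (μ := volume) h1)
    rw [Real.volume_Icc, ENNReal.toReal_ofReal (by linarith)] at h2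
    unfold chordLen
    linarith
  have hleft : ∀ y, chordLen S α y ≤ 2 * (C₁ * √(y - a)) := by
    intro y
    refine hlen y p₁ _ (by positivity) fun t ht => ?_
    have := hb₁ _ ht
    have e : -α * t + 1 * (y + α * t) - a = y - a := by ring
    simpa only [e] using this
  have hright : ∀ y, chordLen S α y ≤ 2 * (C₂ * √(b - y)) := by
    intro y
    refine hlen y p₂ _ (by positivity) fun t ht => ?_
    have := hb₂ _ ht
    have e : α * t + -1 * (y + α * t) - -b = b - y := by ring
    simpa only [e] using this
  have hnn : ∀ y, 0 ≤ chordLen S α y := fun y => ENNReal.toReal_nonneg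
  have hIoo : ∀ y ∈ Set.Ioo a b, (chordSet S α y).Nonempty := by
    intro y hy
    rw [← hJmem]
    obtain ⟨u, hu, hu'⟩ := exists_lt_of_csInf_lt hJne hy.1
    obtain ⟨v, hv, hv'⟩ := exists_lt_of_lt_csSup hJne hy.2
    exact hJc.ordConnected.out hu hv ⟨hu'.le, hv'.le⟩
  refine ⟨a, b, 2 * C₁ + 2 * C₂, ⟨convex_Ioo a b, ?_⟩, hnn, ?_, ?_, ?_, by positivity⟩
  · intro y hy y' hy' u v hu hv huv
    exact brunn_real (chordSet_convex hS y) (chordSet_convex hS y') (chordSet_convex hS _)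
      (hIoo y hy) (hIoo y' hy') (chordSet_subset hsub y) (chordSet_subset hsub y')
      (chordSet_subset hsub _) hu hv (fun t ht t' ht' => chordSet_comb hS hu hv huv ht ht')
  · intro y hy
    rcases Set.eq_empty_or_nonempty (chordSet S α y) with he | hne'
    · simp [chordLen, he]
    · rw [← hJmem] at hne'
      have h1 : a ≤ y := hglb.1 hne'
      have h2 : y ≤ b := hlub.1 hne'
      refine le_antisymm ?_ (hnn y)
      by_cases h3 : y = a
      · simpa [h3] using hleft y
      · by_cases h4 : y = b
        · simpa [h4] using hright y
        · exact absurd ⟨lt_of_le_of_ne h1 (Ne.symm h3), lt_of_le_of_ne h2 h4⟩ hy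
  · intro y _
    have := hleft y
    have : 0 ≤ C₂ * √(y - a) := by positivity
    linarith
  · intro y _
    have := hright y
    have : 0 ≤ C₁ * √(b - y) := by positivity
    linarith

lemma integral_chordLen (hsub : S ⊆ Set.Ico (0:ℝ) 1 ×ˢ Set.Ico (0:ℝ) 1)
    (hS : Convex ℝ S) (hm : Measurable (chordLen S α)) :
    ∫ y, chordLen S α y = (volume S).toReal := by
  have hΦ : MeasurePreserving (fun p : ℝ × ℝ => (p.1, p.2 + α * p.1)) volume volume := by
    refine MeasurePreserving.skew_product (f := id) (g := fun t y => y + α * t)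
      (MeasurePreserving.id volume) (by unfold Function.uncurry; fun_prop) ?_
    refine Filter.Eventually.of_forall fun t => ?_
    exact (measurePreserving_add_right volume (α * t)).map_eq
  have hSn : NullMeasurableSet S volume := by
    rw [Measure.volume_eq_prod]; exact hS.nullMeasurableSet _
  set X : Set (ℝ × ℝ) := (fun p : ℝ × ℝ => (p.1, p.2 + α * p.1)) ⁻¹' S with hX
  have hXn : NullMeasurableSet X volume := hSn.preimage hΦ.quasiMeasurePreserving
  have h1 : volume S = ∫⁻ y, volume (chordSet S α y) := by
    rw [← hΦ.measure_preimage hSn, ← lintegral_indicator_one₀ hXn, Measure.volume_eq_prod,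
      lintegral_prod_symm _ (by
        exact (aemeasurable_indicator_const_iff (1 : ENNReal)).2 hXn)]
    refine lintegral_congr fun y => ?_
    rw [← lintegral_indicator_one (chordSet_measurable hS y)]
    rfl
  have hnn : 0 ≤ᵐ[volume] chordLen S α :=
    Filter.Eventually.of_forall fun y => ENNReal.toReal_nonneg
  rw [integral_eq_lintegral_of_nonneg_ae hnn
    hm.aestronglyMeasurable, h1]
  congr 1
  refine lintegral_congr fun y => ?_
  exact ENNReal.ofReal_toReal (chordSet_volume_ne_top hsub y)

end chords

section flow

/-- times at which the torus line through height `y` is in `S` -/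
def flowSet (S : Set (ℝ × ℝ)) (α y : ℝ) : Set ℝ :=
  {t | (Int.fract t, Int.fract (y + α * t)) ∈ S}

variable {S : Set (ℝ × ℝ)} {α : ℝ}

lemma fract_eq_add_int {a b : ℝ} (k : ℤ) (h : b = a + k) (hb : b ∈ Set.Ico (0:ℝ) 1) :
    Int.fract a = b := by
  rw [Int.fract_eq_iff]
  exact ⟨hb.1, hb.2, -k, by rw [h]; push_cast; ring⟩

lemma flowSet_Ico (hsub : S ⊆ Set.Ico (0:ℝ) 1 ×ˢ Set.Ico (0:ℝ) 1) (y : ℝ) :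
    flowSet S α y ∩ Set.Ico 0 1 = ⋃ k : ℤ, chordSet S α (y + k) := by
  ext t
  constructor
  · rintro ⟨ht, h0⟩
    have hft : Int.fract t = t := Int.fract_eq_self.2 ⟨h0.1, h0.2⟩
    refine Set.mem_iUnion.2 ⟨-⌊y + α * t⌋, ?_⟩
    have ht2 : (Int.fract t, Int.fract (y + α * t)) ∈ S := ht
    rw [hft] at ht2
    have he : y + ((-⌊y + α * t⌋ : ℤ) : ℝ) + α * t = Int.fract (y + α * t) := by
      rw [← Int.self_sub_floor]; push_cast; ring
    show (t, _) ∈ S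
    rw [he]; exact ht2
  · intro h
    obtain ⟨k, hk⟩ := Set.mem_iUnion.1 h
    have hk' : (t, y + k + α * t) ∈ S := hk
    have hb := hsub hk'
    refine ⟨?_, hb.1⟩
    show (Int.fract t, Int.fract (y + α * t)) ∈ S
    rw [Int.fract_eq_self.2 ⟨hb.1.1, hb.1.2⟩,
      fract_eq_add_int (a := y + α * t) (b := y + k + α * t) k (by ring) hb.2]
    exact hk'

lemma chord_disjoint (hsub : S ⊆ Set.Ico (0:ℝ) 1 ×ˢ Set.Ico (0:ℝ) 1) (y : ℝ) :
    Pairwise (Function.onFun Disjoint fun k : ℤ => chordSet S α (y + k)) := by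
  intro k l hkl
  refine Set.disjoint_left.2 fun t hk hl => hkl ?_
  have h1 := (hsub (show (t, y + k + α * t) ∈ S from hk)).2
  have h2 := (hsub (show (t, y + l + α * t) ∈ S from hl)).2
  simp only [Set.mem_Ico] at h1 h2
  have h3 : (k:ℝ) < l + 1 := by linarith
  have h4 : (l:ℝ) < k + 1 := by linarith
  have h3' : k < l + 1 := by exact_mod_cast h3
  have h4' : l < k + 1 := by exact_mod_cast h4
  omega

lemma flowSet_add_int (y t : ℝ) (n : ℤ) :
    t + n ∈ flowSet S α y ↔ t ∈ flowSet S α (y + n * α) := by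
  show (Int.fract (t + n), Int.fract (y + α * (t + n))) ∈ S ↔
    (Int.fract t, Int.fract (y + n * α + α * t)) ∈ S
  rw [Int.fract_add_intCast, show y + α * (t + n) = y + n * α + α * t by ring]

lemma flowSet_measurable (hsub : S ⊆ Set.Ico (0:ℝ) 1 ×ˢ Set.Ico (0:ℝ) 1) (hS : Convex ℝ S)
    (y : ℝ) : MeasurableSet (flowSet S α y) := by
  have h : flowSet S α y = ⋃ n : ℤ, (fun t : ℝ => t - n) ⁻¹'
      (flowSet S α (y + n * α) ∩ Set.Ico 0 1) := by
    ext t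
    simp only [Set.mem_iUnion, Set.mem_preimage, Set.mem_inter_iff, ← flowSet_add_int,
      sub_add_cancel]
    constructor
    · intro ht
      exact ⟨⌊t⌋, ht, by rw [Int.self_sub_floor]; exact ⟨Int.fract_nonneg t, Int.fract_lt_one t⟩⟩
    · rintro ⟨n, h, -⟩; exact h
  rw [h]
  refine MeasurableSet.iUnion fun n => (measurable_id.sub_const _) ?_
  rw [flowSet_Ico hsub]
  exact MeasurableSet.iUnion fun k => chordSet_measurable hS _

/-- characteristic function along the flow -/
noncomputable def flowInd (S : Set (ℝ × ℝ)) (α y t : ℝ) : ℝ :=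
  Set.indicator S (fun _ => (1:ℝ)) (Int.fract t, Int.fract (y + α * t))

lemma flowInd_eq (y : ℝ) : flowInd S α y = (flowSet S α y).indicator (fun _ => (1:ℝ)) := rfl

lemma flowInd_norm (y t : ℝ) : ‖flowInd S α y t‖ ≤ 1 := by
  rw [flowInd_eq]
  refine (norm_indicator_le_norm_self _ _).trans ?_
  simp

lemma flowInd_intervalIntegrable (hsub : S ⊆ Set.Ico (0:ℝ) 1 ×ˢ Set.Ico (0:ℝ) 1)
    (hS : Convex ℝ S) (y u v : ℝ) : IntervalIntegrable (flowInd S α y) volume u v := by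
  refine (intervalIntegrable_const (c := (1:ℝ))).mono_fun ?_ ?_
  · rw [flowInd_eq]
    exact (measurable_const.indicator (flowSet_measurable hsub hS y)).aestronglyMeasurable
  · refine Filter.Eventually.of_forall fun t => ?_
    simpa using flowInd_norm y t

lemma flowInd_bound (y u v : ℝ) : |∫ t in u..v, flowInd S α y t| ≤ |v - u| := by
  have := intervalIntegral.norm_integral_le_of_norm_le_const (a := u) (b := v)
    (f := flowInd S α y) (C := 1) fun t _ => flowInd_norm y t
  simpa using this

lemma flowInd_unit (hsub : S ⊆ Set.Ico (0:ℝ) 1 ×ˢ Set.Ico (0:ℝ) 1) (hS : Convex ℝ S) (y : ℝ) :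
    ∫ t in (0:ℝ)..1, flowInd S α y t = ∑' k : ℤ, chordLen S α (y + k) := by
  rw [intervalIntegral.integral_of_le zero_le_one, ← integral_Ico_eq_integral_Ioc, flowInd_eq]
  refine (integral_indicator_one (flowSet_measurable hsub hS y)).trans ?_
  rw [Measure.real, Measure.restrict_apply (flowSet_measurable hsub hS y), flowSet_Ico hsub,
    measure_iUnion (chord_disjoint hsub y) (fun k => chordSet_measurable hS _),
    ENNReal.tsum_toReal_eq fun k => chordSet_volume_ne_top hsub _]
  rfl

lemma flowInd_shift (hsub : S ⊆ Set.Ico (0:ℝ) 1 ×ˢ Set.Ico (0:ℝ) 1) (hS : Convex ℝ S)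
    (y : ℝ) (n : ℕ) :
    ∫ t in (n:ℝ)..((n+1 : ℕ) : ℝ), flowInd S α y t = ∑' k : ℤ, chordLen S α (y + n * α + k) := by
  rw [← flowInd_unit hsub hS]
  have h : ∀ t, flowInd S α (y + n * α) t = flowInd S α y (t + n) := by
    intro t
    unfold flowInd
    rw [Int.fract_add_natCast, show y + α * (t + n) = y + n * α + α * t by ring]
  simp only [h]
  rw [intervalIntegral.integral_comp_add_right (fun t => flowInd S α y t) (n:ℝ)]
  congr 1
  · ring
  · push_cast; ring

lemma flowInd_sum (hsub : S ⊆ Set.Ico (0:ℝ) 1 ×ˢ Set.Ico (0:ℝ) 1) (hS : Convex ℝ S)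
    (y : ℝ) (N : ℕ) :
    ∑ n ∈ Finset.range N, ∑' k : ℤ, chordLen S α (y + n * α + k) =
      ∫ t in (0:ℝ)..N, flowInd S α y t := by
  have := intervalIntegral.sum_integral_adjacent_intervals (f := flowInd S α y) (μ := volume)
    (a := fun n : ℕ => (n:ℝ)) (n := N)
    fun k _ => flowInd_intervalIntegrable hsub hS y _ _
  simp only [flowInd_shift hsub hS] at this
  rw [this]; simp

lemma rotDelta_bound (hsub : S ⊆ Set.Ico (0:ℝ) 1 ×ˢ Set.Ico (0:ℝ) 1) (hS : Convex ℝ S)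
    {K x₁ x₂ : ℝ} (hx : x₁ ∈ Set.Ico (0:ℝ) 1)
    (hK : ∀ (y : ℝ) (N : ℕ), |∑ n ∈ Finset.range N, ∑' k : ℤ, chordLen S α (y + n * α + k)
      - N * (volume S).toReal| ≤ K) (T : ℝ) (hT : 0 < T) :
    |rotDelta S α x₁ x₂ T| ≤ K + 2 + (volume S).toReal := by
  set y := x₂ - α * x₁ with hy
  have hi := fun u v => flowInd_intervalIntegrable (α := α) hsub hS y u v
  have h1 : rotDelta S α x₁ x₂ T = (∫ t in x₁..(x₁ + T), flowInd S α y t)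
      - T * (volume S).toReal := by
    unfold rotDelta
    congr 1
    have h := intervalIntegral.integral_comp_add_left (a := 0) (b := T)
      (fun t => flowInd S α y t) x₁
    rw [add_zero] at h
    rw [← h]
    refine intervalIntegral.integral_congr fun t _ => ?_
    simp only [flowInd]
    rw [show y + α * (x₁ + t) = x₂ + α * t by rw [hy]; ring]
  set N := ⌊x₁ + T⌋₊
  have hpos : 0 ≤ x₁ + T := by linarith [hx.1]
  have hN1 : (N:ℝ) ≤ x₁ + T := Nat.floor_le hpos
  have hN2 : x₁ + T < N + 1 := Nat.lt_floor_add_one _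
  have h2 : ∫ t in x₁..(x₁ + T), flowInd S α y t = (∫ t in (0:ℝ)..N, flowInd S α y t)
      + (∫ t in (N:ℝ)..(x₁ + T), flowInd S α y t) - ∫ t in (0:ℝ)..x₁, flowInd S α y t := by
    have e1 := intervalIntegral.integral_add_adjacent_intervals (hi 0 N) (hi N (x₁ + T))
    have e2 := intervalIntegral.integral_add_adjacent_intervals (hi 0 x₁) (hi x₁ (x₁ + T))
    linarith
  have b1 := flowInd_bound (S := S) (α := α) y N (x₁ + T)
  have b2 := flowInd_bound (S := S) (α := α) y 0 x₁
  rw [abs_of_nonneg (by linarith : 0 ≤ x₁ + T - N)] at b1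
  rw [sub_zero, abs_of_nonneg hx.1] at b2
  have b3 := hK y N
  rw [flowInd_sum hsub hS] at b3
  have hv : 0 ≤ (volume S).toReal := ENNReal.toReal_nonneg
  have hx1 := hx.1
  have hx2 := hx.2
  rw [h1, h2]
  have b4 : |((N:ℝ) - T) * (volume S).toReal| ≤ (volume S).toReal := by
    rw [abs_mul, abs_of_nonneg hv]
    refine mul_le_of_le_one_left hv ?_
    rw [abs_le]; constructor <;> linarith
  rw [abs_le] at *
  constructor <;> linarith [b1.1, b1.2, b2.1, b2.2, b3.1, b3.2, b4.1, b4.2]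

end flow

theorem statement2 :
    ∀ᵐ α : ℝ ∂volume, 0 < α →
      ∀ x₁ x₂ : ℝ, x₁ ∈ Set.Ico (0:ℝ) 1 → x₂ ∈ Set.Ico (0:ℝ) 1 →
      ∀ S : Set (ℝ × ℝ), S ⊆ Set.Ico (0:ℝ) 1 ×ˢ Set.Ico (0:ℝ) 1 →
        Convex ℝ S → HasC2PosCurvBoundary S →
        IsBoundedRemainderSet S α x₁ x₂ := by
  filter_upwards [ae_real_of_ae_circle dioph_circle,
    (Set.countable_range ((↑) : ℚ → ℝ)).ae_notMem volume] with α hα hirr0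
  intro _ x₁ x₂ hx₁ _ S hsub hS hC
  have hirr : ∀ m : ℤ, m ≠ 0 → m • (α : UnitAddCircle) ≠ 0 := by
    intro m hm h0
    rw [← AddCircle.coe_zsmul, AddCircle.coe_eq_zero_iff] at h0
    obtain ⟨n, hn⟩ := h0
    apply hirr0
    refine ⟨(n : ℚ) / m, ?_⟩
    have hm' : (m:ℝ) ≠ 0 := by exact_mod_cast hm
    push_cast
    rw [div_eq_iff hm']
    simp only [zsmul_eq_mul, mul_one] at hn
    rw [hn]; ring
  obtain ⟨a, b, C, hE⟩ := chordLen_edgeConcave (α := α) hsub hS hC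
  obtain ⟨K, hK⟩ := birkhoff_bound hE hirr (dioph_circle' hα)
  rw [integral_chordLen hsub hS hE.continuous.measurable] at hK
  exact ⟨_, fun T hT => rotDelta_bound hsub hS hx₁ hK T hT⟩
end
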